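/- arXiv:1510.03309 — 3 statements merged into one kernel-verified Lean document; each statement's English description precedes it below -/
import Mathlib

section
/- There exists an absolute constant K such that the following holds for every sufficiently large prime p. Set α = 101/161 and β = 71/161, and let A ⊆ 𝔽_p satisfy 2 ≤ |A| ≤ p^α·(log p)^β. Then, with δ = 4/101, there exist disjoint subsets B and C of A with A = B ∪ C and max{E₊(B), E×(C)} ≤ K·|A|^(3−δ)·(log |A|)^(1−δ/2). -/
open Finset

/-- Additive energy `E₊(B) = #{(b₁,b₂,b₃,b₄) ∈ B⁴ : b₁+b₂ = b₃+b₄}` in `𝔽_p`. -/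
def addE {p : ℕ} (B : Finset (ZMod p)) : ℕ :=
  ((B ×ˢ B ×ˢ B ×ˢ B).filter fun x => x.1 + x.2.1 = x.2.2.1 + x.2.2.2).card

/-- Multiplicative energy `E×(C) = #{(c₁,c₂,c₃,c₄) ∈ C⁴ : c₁c₂ = c₃c₄}` in `𝔽_p`. -/
def mulE {p : ℕ} (C : Finset (ZMod p)) : ℕ :=
  ((C ×ˢ C ×ˢ C ×ˢ C).filter fun x => x.1 * x.2.1 = x.2.2.1 * x.2.2.2).card

section Lines
open MvPolynomial

variable {K : Type*} [Field K]

/-- Restriction of a polynomial in `(z, y, x)` to the line `z = z₀`, `y = X x + Y`. -/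
noncomputable def hLine (X Y z₀ : K) : MvPolynomial (Fin 3) K →ₐ[K] Polynomial K :=
  aeval ![Polynomial.C z₀, Polynomial.C X * Polynomial.X + Polynomial.C Y, Polynomial.X]

/-- Restriction of a polynomial in `(z, y, x)` to the line `y = y₀`, `z = β x + α`. -/
noncomputable def vLine (β α y₀ : K) : MvPolynomial (Fin 3) K →ₐ[K] Polynomial K :=
  aeval ![Polynomial.C β * Polynomial.X + Polynomial.C α, Polynomial.C y₀, Polynomial.X]

@[simp] lemma hLine_zero (X Y z₀ : K) : hLine X Y z₀ (MvPolynomial.X 0) = Polynomial.C z₀ := by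
  simp [hLine]
@[simp] lemma hLine_one (X Y z₀ : K) : hLine X Y z₀ (MvPolynomial.X 1) =
    Polynomial.C X * Polynomial.X + Polynomial.C Y := by
  simp [hLine]
@[simp] lemma hLine_two (X Y z₀ : K) : hLine X Y z₀ (MvPolynomial.X 2) = Polynomial.X := by
  simp [hLine]
@[simp] lemma vLine_zero (β α y₀ : K) : vLine β α y₀ (MvPolynomial.X 0) =
    Polynomial.C β * Polynomial.X + Polynomial.C α := by
  simp [vLine]
@[simp] lemma vLine_one (β α y₀ : K) : vLine β α y₀ (MvPolynomial.X 1) = Polynomial.C y₀ := by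
  simp [vLine]
@[simp] lemma vLine_two (β α y₀ : K) : vLine β α y₀ (MvPolynomial.X 2) = Polynomial.X := by
  simp [vLine]
@[simp] lemma hLine_C (X Y z₀ c : K) : hLine X Y z₀ (C c) = Polynomial.C c := by
  simp [hLine]
@[simp] lemma vLine_C (β α y₀ c : K) : vLine β α y₀ (C c) = Polynomial.C c := by
  simp [vLine]

lemma natDegree_C_mul_X_le' (a : K) : (Polynomial.C a * Polynomial.X).natDegree ≤ 1 := by
  simpa using Polynomial.natDegree_C_mul_X_pow_le a 1

lemma natDegree_hLine_le (X Y z₀ : K) (f : MvPolynomial (Fin 3) K) :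
    (hLine X Y z₀ f).natDegree ≤ f.totalDegree := by
  have := MvPolynomial.aeval_natDegree_le (m := f.totalDegree) (n := 1) f le_rfl
    ![Polynomial.C z₀, Polynomial.C X * Polynomial.X + Polynomial.C Y, Polynomial.X]
    (by intro i; fin_cases i <;> simp [natDegree_C_mul_X_le'])
  simpa [hLine] using this

lemma natDegree_vLine_le (β α y₀ : K) (f : MvPolynomial (Fin 3) K) :
    (vLine β α y₀ f).natDegree ≤ f.totalDegree := by
  have := MvPolynomial.aeval_natDegree_le (m := f.totalDegree) (n := 1) f le_rfl
    ![Polynomial.C β * Polynomial.X + Polynomial.C α, Polynomial.C y₀, Polynomial.X]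
    (by intro i; fin_cases i <;> simp [natDegree_C_mul_X_le'])
  simpa [vLine] using this

lemma eval_hLine (X Y z₀ t : K) (f : MvPolynomial (Fin 3) K) :
    (hLine X Y z₀ f).eval t = eval ![z₀, X * t + Y, t] f := by
  induction f using MvPolynomial.induction_on with
  | C a => simp
  | add p q hp hq => simp [hp, hq]
  | mul_X p i hp => simp only [map_mul, Polynomial.eval_mul, hp]; congr 1; fin_cases i <;> simp

lemma eval_vLine (β α y₀ t : K) (f : MvPolynomial (Fin 3) K) :
    (vLine β α y₀ f).eval t = eval ![β * t + α, y₀, t] f := by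
  induction f using MvPolynomial.induction_on with
  | C a => simp
  | add p q hp hq => simp [hp, hq]
  | mul_X p i hp => simp only [map_mul, Polynomial.eval_mul, hp]; congr 1; fin_cases i <;> simp

lemma totalDegree_pderiv_le {σ : Type*} (i : σ) (f : MvPolynomial σ K) :
    (pderiv i f).totalDegree ≤ f.totalDegree - 1 := by
  classical
  refine Finset.sup_le fun m hm => ?_
  rw [mem_support_iff, coeff_pderiv] at hm
  have h1 : m + Finsupp.single i 1 ∈ f.support := by
    rw [mem_support_iff]; intro h; apply hm; simp [h]
  have h2 := le_totalDegree h1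
  rw [Finsupp.sum_add_index' (by simp) (by simp), Finsupp.sum_single_index rfl] at h2
  omega

/-- Meeting of the two lines. -/
def Meets (X Y z₀ β α y₀ : K) : Prop := ∃ t : K, z₀ = β * t + α ∧ y₀ = X * t + Y

/-- A line `y = y₀`, `z = β x + α` not lying in the zero set of `f` meets at most `deg f`
lines from a family of horizontal lines in the zero set of `f` with distinct heights. -/
lemma card_meets_le_of_vLine_ne_zero {ι : Type*} (S : Finset ι) (X Y z : ι → K) (β α y₀ : K)
    (hz : Set.InjOn z S) (f : MvPolynomial (Fin 3) K)
    (hS : ∀ i ∈ S, hLine (X i) (Y i) (z i) f = 0 ∧ Meets (X i) (Y i) (z i) β α y₀)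
    (hf : vLine β α y₀ f ≠ 0) : S.card ≤ f.totalDegree := by
  classical
  have h : ∀ i, ∃ t : K, i ∈ S → z i = β * t + α ∧ y₀ = X i * t + Y i := by
    intro i
    by_cases hi : i ∈ S
    · obtain ⟨t, ht⟩ := (hS i hi).2
      exact ⟨t, fun _ => ht⟩
    · exact ⟨0, fun h => absurd h hi⟩
  choose t ht using h
  have hinj : Set.InjOn t S := by
    intro i hi j hj hij
    apply hz hi hj
    rw [(ht i hi).1, (ht j hj).1, hij]
  calc S.card = (S.image t).card := (card_image_of_injOn hinj).symm
    _ ≤ (vLine β α y₀ f).roots.toFinset.card := by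
        apply card_le_card
        intro u hu
        obtain ⟨i, hi, rfl⟩ := Finset.mem_image.1 hu
        rw [Multiset.mem_toFinset, Polynomial.mem_roots hf, Polynomial.IsRoot, eval_vLine,
          (ht i hi).2, ← (ht i hi).1, ← eval_hLine, (hS i hi).1, Polynomial.eval_zero]
    _ ≤ (vLine β α y₀ f).natDegree :=
        (Multiset.toFinset_card_le _).trans (Polynomial.card_roots' _)
    _ ≤ f.totalDegree := natDegree_vLine_le _ _ _ _

lemma card_meets_le_of_hLine_ne_zero {ι : Type*} (S : Finset ι) (β α y : ι → K) (X Y z₀ : K)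
    (hy : Set.InjOn y S) (f : MvPolynomial (Fin 3) K)
    (hS : ∀ j ∈ S, vLine (β j) (α j) (y j) f = 0 ∧ Meets X Y z₀ (β j) (α j) (y j))
    (hf : hLine X Y z₀ f ≠ 0) : S.card ≤ f.totalDegree := by
  classical
  have h : ∀ i, ∃ t : K, i ∈ S → z₀ = β i * t + α i ∧ y i = X * t + Y := by
    intro i
    by_cases hi : i ∈ S
    · obtain ⟨t, ht⟩ := (hS i hi).2
      exact ⟨t, fun _ => ht⟩
    · exact ⟨0, fun h => absurd h hi⟩
  choose t ht using h
  have hinj : Set.InjOn t S := by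
    intro i hi j hj hij
    apply hy hi hj
    rw [(ht i hi).2, (ht j hj).2, hij]
  calc S.card = (S.image t).card := (card_image_of_injOn hinj).symm
    _ ≤ (hLine X Y z₀ f).roots.toFinset.card := by
        apply card_le_card
        intro u hu
        obtain ⟨i, hi, rfl⟩ := Finset.mem_image.1 hu
        rw [Multiset.mem_toFinset, Polynomial.mem_roots hf, Polynomial.IsRoot, eval_hLine,
          ← (ht i hi).2, (ht i hi).1, ← eval_vLine, (hS i hi).1, Polynomial.eval_zero]
    _ ≤ (hLine X Y z₀ f).natDegree :=
        (Multiset.toFinset_card_le _).trans (Polynomial.card_roots' _)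
    _ ≤ f.totalDegree := natDegree_hLine_le _ _ _ _

/-- Polynomial interpolation through horizontal lines. -/
lemma exists_poly_vanishing_on_hLines {ι : Type*} (S : Finset ι) (X Y z : ι → K) (B : ℕ)
    (hB : 2 * S.card < B ^ 2) : ∃ Q : MvPolynomial (Fin 3) K, Q ≠ 0 ∧ Q.totalDegree < 3 * B ∧
      ∀ i ∈ S, hLine (X i) (Y i) (z i) Q = 0 := by
  classical
  have hB0 : 0 < B := by
    rcases Nat.eq_zero_or_pos B with h | h
    · subst h; simp at hB
    · exact h
  let e : (Fin B × Fin B × Fin B) → (Fin 3 →₀ ℕ) := fun t =>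
    Finsupp.equivFunOnFinite.symm ![(t.1 : ℕ), t.2.1, t.2.2]
  have he : Function.Injective e := by
    intro s t hst
    have h := Finsupp.equivFunOnFinite.symm.injective hst
    have h0 := congrFun h 0
    have h1 := congrFun h 1
    have h2 := congrFun h 2
    simp at h0 h1 h2
    ext <;> simp [h0, h1, h2]
  have hli : LinearIndependent K fun t => (basisMonomials (Fin 3) K) (e t) :=
    (basisMonomials (Fin 3) K).linearIndependent.comp e he
  let φ : ((Fin B × Fin B × Fin B) → K) →ₗ[K] MvPolynomial (Fin 3) K :=
    Fintype.linearCombination K (fun t => (basisMonomials (Fin 3) K) (e t))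
  let ψ : ((Fin B × Fin B × Fin B) → K) →ₗ[K] ((S × Fin (2 * B)) → K) :=
    LinearMap.pi fun u => (Polynomial.lcoeff K (u.2 : ℕ)) ∘ₗ
      (hLine (X u.1) (Y u.1) (z u.1)).toLinearMap ∘ₗ φ
  have hker : LinearMap.ker ψ ≠ ⊥ := by
    apply LinearMap.ker_ne_bot_of_finrank_lt
    simp only [Module.finrank_fintype_fun_eq_card, Fintype.card_prod, Fintype.card_fin,
      Fintype.card_coe]
    nlinarith
  obtain ⟨c, hc, hc0⟩ := (Submodule.ne_bot_iff _).1 hker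
  refine ⟨φ c, ?_, ?_, ?_⟩
  · intro h
    exact hc0 (LinearIndependent.fintypeLinearCombination_injective hli (by simpa [φ] using h))
  · have : (φ c).totalDegree ≤ 3 * (B - 1) := by
      simp only [φ, Fintype.linearCombination_apply]
      apply totalDegree_finsetSum_le
      intro t _
      refine (totalDegree_smul_le _ _).trans ?_
      rw [coe_basisMonomials]
      refine (totalDegree_monomial_le _ _).trans ?_
      rw [Finsupp.sum_fintype _ _ (by simp)]
      simp [e, Fin.sum_univ_three]
      omega
    omega
  · intro i hi
    have hdeg : (hLine (X i) (Y i) (z i) (φ c)).natDegree < 2 * B := by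
      have : (hLine (X i) (Y i) (z i) (φ c)).natDegree ≤ 2 * (B - 1) := by
        simp only [φ, Fintype.linearCombination_apply, map_sum, map_smul]
        apply Polynomial.natDegree_sum_le_of_forall_le
        intro t _
        refine (Polynomial.natDegree_smul_le _ _).trans ?_
        rw [coe_basisMonomials, hLine, aeval_monomial, Finsupp.prod_fintype _ _ (by simp)]
        simp only [map_one, one_mul, e, Fin.prod_univ_three]
        simp only [Finsupp.equivFunOnFinite_symm_apply_apply, Matrix.cons_val]
        rw [← Polynomial.C_pow, mul_assoc]
        refine (Polynomial.natDegree_C_mul_le _ _).trans ?_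
        refine Polynomial.natDegree_mul_le.trans ?_
        have h1 := Polynomial.natDegree_pow_le_of_le (t.2.1 : ℕ)
          (Polynomial.natDegree_linear_le (a := X i) (b := Y i))
        have h2 := Polynomial.natDegree_X_pow_le (R := K) (t.2.2 : ℕ)
        omega
      omega
    ext n
    rw [Polynomial.coeff_zero]
    by_cases hn : n < 2 * B
    · have := congrFun (LinearMap.mem_ker.1 hc) (⟨i, hi⟩, ⟨n, hn⟩)
      simpa [ψ] using this
    · exact Polynomial.coeff_eq_zero_of_natDegree_lt (by omega)

end Lines

section Elimination
open MvPolynomial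

variable {K : Type*} [Field K]

lemma aeval_eval_finSuccEquiv (c : K) (f : MvPolynomial (Fin 2) K) :
    aeval (fun _ : Fin 1 => (Polynomial.X : Polynomial K)) ((finSuccEquiv K 1 f).eval (C c)) =
      aeval ![Polynomial.C c, Polynomial.X] f := by
  induction f using MvPolynomial.induction_on with
  | C a => simp [finSuccEquiv_apply]
  | add p q hp hq => simp only [map_add, Polynomial.eval_add, hp, hq]
  | mul_X p i hp =>
    rw [map_mul, Polynomial.eval_mul, map_mul, map_mul, hp]
    have hi : i = 0 ∨ i = Fin.succ 0 := by revert i; decide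
    rcases hi with rfl | rfl
    · rw [finSuccEquiv_X_zero, Polynomial.eval_X, aeval_X, aeval_C]
      rfl
    · rw [finSuccEquiv_X_succ, Polynomial.eval_C, aeval_X, aeval_X]
      rfl

lemma card_le_totalDegree_of_aeval_eq_zero {ι : Type*} (S : Finset ι) (y : ι → K)
    (hy : Set.InjOn y S) (h : MvPolynomial (Fin 2) K) (h0 : h ≠ 0)
    (hS : ∀ j ∈ S, aeval ![Polynomial.C (y j), Polynomial.X] h = (0 : Polynomial K)) :
    S.card ≤ h.totalDegree := by
  classical
  have hinj : Function.Injective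
      (aeval (fun _ : Fin 1 => (Polynomial.X : Polynomial K)) :
        MvPolynomial (Fin 1) K →ₐ[K] Polynomial K) := by
    have : (aeval (fun _ : Fin 1 => (Polynomial.X : Polynomial K)) :
        MvPolynomial (Fin 1) K →ₐ[K] Polynomial K) =
        (MvPolynomial.uniqueAlgEquiv K (Fin 1)).toAlgHom := by
      ext i; simp
    rw [this]
    exact (MvPolynomial.uniqueAlgEquiv K (Fin 1)).injective
  set H := finSuccEquiv K 1 h with hH
  have hH0 : H ≠ 0 := by simpa [hH] using h0
  calc S.card = (S.image fun j => (C (y j) : MvPolynomial (Fin 1) K)).card := by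
        refine (card_image_of_injOn ?_).symm
        intro i hi j hj hij
        exact hy hi hj (C_injective _ _ hij)
    _ ≤ H.roots.toFinset.card := by
        apply card_le_card
        intro u hu
        obtain ⟨i, hi, rfl⟩ := Finset.mem_image.1 hu
        rw [Multiset.mem_toFinset, Polynomial.mem_roots hH0, Polynomial.IsRoot]
        apply hinj
        rw [aeval_eval_finSuccEquiv, hS i hi, map_zero]
    _ ≤ H.natDegree := (Multiset.toFinset_card_le _).trans (Polynomial.card_roots' _)
    _ = h.degreeOf 0 := natDegree_finSuccEquiv _
    _ ≤ h.totalDegree := degreeOf_le_totalDegree _ _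

lemma Polynomial.resultant_ne_zero_of_prime {R : Type*} [CommRing R] [IsDomain R]
    [UniqueFactorizationMonoid R] (f g : Polynomial R) (hf : Prime f) (hd : f.natDegree ≠ 0)
    (hfg : ¬ f ∣ g) : Polynomial.resultant f g ≠ 0 := by
  intro h0
  let F := FractionRing R
  have hinj : Function.Injective (algebraMap R F) := IsFractionRing.injective R F
  have hprim : f.IsPrimitive := hf.irreducible.isPrimitive hd
  have h1 : Polynomial.resultant (f.map (algebraMap R F)) (g.map (algebraMap R F)) = 0 := by
    rw [Polynomial.natDegree_map_eq_of_injective hinj, Polynomial.natDegree_map_eq_of_injective hinj,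
      Polynomial.resultant_map_map, h0, map_zero]
  rw [Polynomial.resultant_eq_zero_iff] at h1
  have hirr : Irreducible (f.map (algebraMap R F)) :=
    hprim.irreducible_iff_irreducible_map_fraction_map.1 hf.irreducible
  rcases hirr.isCoprime_or_dvd (g.map (algebraMap R F)) with h | ⟨u, hu⟩
  · exact h1.2 h
  · have : u ∈ Polynomial.lifts (algebraMap R F) := by
      rw [← hprim.map_mul_mem_lifts_iff, ← hu]
      exact ⟨g, rfl⟩
    obtain ⟨u0, hu0⟩ := this
    apply hfg
    refine ⟨u0, Polynomial.map_injective _ hinj ?_⟩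
    rw [hu, Polynomial.map_mul, ← hu0]
    rfl

lemma totalDegree_resultant_le {σ : Type*} (f g : Polynomial (MvPolynomial σ K)) (m n D : ℕ)
    (hf : ∀ i, (f.coeff i).totalDegree ≤ D) (hg : ∀ i, (g.coeff i).totalDegree ≤ D) :
    (Polynomial.resultant f g m n).totalDegree ≤ (m + n) * D := by
  rw [Polynomial.resultant, Matrix.det_apply]
  apply totalDegree_finsetSum_le
  intro s _
  have h1 : ∀ i j, (Polynomial.sylvester f g m n i j).totalDegree ≤ D := by
    intro i j
    rw [Polynomial.sylvester, Matrix.of_apply]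
    induction j using Fin.addCases with
    | left j => simp only [Fin.addCases_left]; split_ifs <;> simp [hg]
    | right j => simp only [Fin.addCases_right]; split_ifs <;> simp [hf]
  have h2 : (∏ i, Polynomial.sylvester f g m n (s i) i).totalDegree ≤ (m + n) * D := by
    refine (totalDegree_finsetProd _ _).trans ((sum_le_sum fun i _ => h1 _ _).trans ?_)
    simp
  rcases Int.units_eq_one_or (Equiv.Perm.sign s) with h | h <;> rw [h]
  · simpa using h2
  · simpa using h2

lemma vLine_finSuccEquiv_symm_C (β α y : K) (h : MvPolynomial (Fin 2) K) :
    vLine β α y ((finSuccEquiv K 2).symm (Polynomial.C h)) =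
      aeval ![Polynomial.C y, Polynomial.X] h := by
  induction h using MvPolynomial.induction_on with
  | C a =>
    have : (finSuccEquiv K 2).symm (Polynomial.C (C a)) = C a := by
      rw [AlgEquiv.symm_apply_eq]; simp [finSuccEquiv_apply]
    rw [this]; simp
  | add p q hp hq => simp only [map_add, hp, hq]
  | mul_X p i hp =>
    have : (finSuccEquiv K 2).symm (Polynomial.C (X i)) = X i.succ := by
      rw [AlgEquiv.symm_apply_eq, finSuccEquiv_X_succ]
    simp only [map_mul, hp, this]
    congr 1
    fin_cases i
    · simp
    · simp

lemma card_vLines_le_of_degreeOf_eq_zero {ι : Type*} (S : Finset ι) (β α y : ι → K)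
    (hy : Set.InjOn y S) (q : MvPolynomial (Fin 3) K) (hq : q ≠ 0) (hd : q.degreeOf 0 = 0)
    (hS : ∀ j ∈ S, vLine (β j) (α j) (y j) q = 0) : S.card ≤ q.totalDegree := by
  rw [← natDegree_finSuccEquiv] at hd
  obtain ⟨h, hh⟩ := Polynomial.natDegree_eq_zero.1 hd
  have hq' : q = (finSuccEquiv K 2).symm (Polynomial.C h) := by rw [hh]; simp
  have h0 : h ≠ 0 := by
    rintro rfl
    apply hq
    rw [hq']; simp
  refine (card_le_totalDegree_of_aeval_eq_zero S y hy h h0 ?_).trans ?_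
  · intro j hj
    rw [← vLine_finSuccEquiv_symm_C (β j) (α j), ← hq']
    exact hS j hj
  · have h1 : (finSuccEquiv K 2 q).coeff 0 = h := by rw [← hh, Polynomial.coeff_C_zero]
    have := totalDegree_coeff_finSuccEquiv_add_le q 0 (by rwa [h1])
    rwa [h1] at this

lemma totalDegree_pos_of_prime {σ : Type*} (q : MvPolynomial σ K) (hq : Prime q) :
    0 < q.totalDegree := by
  rw [Nat.pos_iff_ne_zero]
  intro h
  rw [totalDegree_eq_zero_iff_eq_C] at h
  apply hq.not_isUnit
  rw [h]
  apply IsUnit.map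
  rw [isUnit_iff_ne_zero]
  intro h0; rw [h0, map_zero] at h; exact hq.ne_zero h

/-- A Bézout-type bound for the number of vertical lines in the common zero set. -/
lemma card_common_vLines_le {ι : Type*} (S : Finset ι) (β α y : ι → K) (hy : Set.InjOn y S)
    (q g : MvPolynomial (Fin 3) K) (hq : Prime q) (hqg : ¬ q ∣ g) (D : ℕ)
    (hqD : q.totalDegree ≤ D) (hgD : g.totalDegree ≤ D)
    (hS : ∀ j ∈ S, vLine (β j) (α j) (y j) q = 0 ∧ vLine (β j) (α j) (y j) g = 0) :
    S.card ≤ (q.totalDegree + g.totalDegree) * D := by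
  set e := finSuccEquiv K 2 with he
  have hcoeff : ∀ f : MvPolynomial (Fin 3) K, ∀ i, ((e f).coeff i).totalDegree ≤ f.totalDegree := by
    intro f i
    by_cases h : (e f).coeff i = 0
    · rw [h]; simp
    · have := totalDegree_coeff_finSuccEquiv_add_le f i h
      exact (Nat.le_add_right _ _).trans this
  have hnat : ∀ f : MvPolynomial (Fin 3) K, (e f).natDegree ≤ f.totalDegree := by
    intro f
    rw [he, natDegree_finSuccEquiv]; exact degreeOf_le_totalDegree _ _
  by_cases hd : (e q).natDegree = 0
  · have h1 := card_vLines_le_of_degreeOf_eq_zero S β α y hy q hq.ne_zero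
      (by rwa [he, natDegree_finSuccEquiv] at hd) (fun j hj => (hS j hj).1)
    have := totalDegree_pos_of_prime q hq
    nlinarith
  · have hres : Polynomial.resultant (e q) (e g) ≠ 0 := by
      apply Polynomial.resultant_ne_zero_of_prime _ _ _ hd
      · rwa [map_dvd_iff]
      · exact (MulEquiv.prime_iff e).2 hq
    obtain ⟨a, b, -, -, hab⟩ := Polynomial.exists_mul_add_mul_eq_C_resultant (e q) (e g)
      le_rfl le_rfl (Or.inl hd)
    refine (card_le_totalDegree_of_aeval_eq_zero S y hy _ hres ?_).trans
      ((totalDegree_resultant_le (e q) (e g) _ _ D (fun i => (hcoeff q i).trans hqD)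
        (fun i => (hcoeff g i).trans hgD)).trans ?_)
    · intro j hj
      rw [← vLine_finSuccEquiv_symm_C (β j) (α j), ← hab, ← he]
      simp [(hS j hj).1, (hS j hj).2]
    · exact Nat.mul_le_mul_right _ (Nat.add_le_add (hnat q) (hnat g))

end Elimination

section Ruled
open MvPolynomial

variable {K : Type*} [Field K]

/-- The polynomial expressing that a surface is doubly tangent, within each plane of constant `y`,
to its tangent line. -/
noncomputable def inflection (q : MvPolynomial (Fin 3) K) : MvPolynomial (Fin 3) K :=
  pderiv 0 q ^ 2 * pderiv 2 (pderiv 2 q) -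
    pderiv 2 q * pderiv 0 q * (pderiv 0 (pderiv 2 q) + pderiv 2 (pderiv 0 q)) +
    pderiv 2 q ^ 2 * pderiv 0 (pderiv 0 q)

lemma totalDegree_inflection_le (q : MvPolynomial (Fin 3) K) :
    (inflection q).totalDegree ≤ 3 * q.totalDegree := by
  have h0 : ∀ i, (pderiv i q).totalDegree ≤ q.totalDegree := fun i =>
    (totalDegree_pderiv_le i q).trans (Nat.sub_le _ _)
  have h1 : ∀ i j, (pderiv i (pderiv j q)).totalDegree ≤ q.totalDegree := fun i j =>
    (totalDegree_pderiv_le i _).trans ((Nat.sub_le _ _).trans (h0 j))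
  have hmul : ∀ a b c : MvPolynomial (Fin 3) K, a.totalDegree ≤ q.totalDegree →
      b.totalDegree ≤ q.totalDegree → c.totalDegree ≤ q.totalDegree →
      (a * b * c).totalDegree ≤ 3 * q.totalDegree := by
    intro a b c ha hb hc
    have := totalDegree_mul (a * b) c
    have := totalDegree_mul a b
    omega
  rw [inflection, pow_two, pow_two]
  refine (totalDegree_add _ _).trans (max_le ((totalDegree_sub _ _).trans (max_le ?_ ?_)) ?_)
  · exact hmul _ _ _ (h0 _) (h0 _) (h1 _ _)
  · exact hmul _ _ _ (h0 _) (h0 _) ((totalDegree_add _ _).trans (max_le (h1 _ _) (h1 _ _)))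
  · exact hmul _ _ _ (h0 _) (h0 _) (h1 _ _)

lemma derivative_vLine (β α y : K) (f : MvPolynomial (Fin 3) K) :
    Polynomial.derivative (vLine β α y f) =
      vLine β α y (pderiv 2 f) + Polynomial.C β * vLine β α y (pderiv 0 f) := by
  induction f using MvPolynomial.induction_on with
  | C a => simp
  | add p q hp hq => simp only [map_add, hp, hq]; ring
  | mul_X p i hp =>
    simp only [map_mul, Polynomial.derivative_mul, hp, Derivation.leibniz, smul_eq_mul, map_add]
    have hi : i = 0 ∨ i = 1 ∨ i = 2 := by revert i; decide
    rcases hi with rfl | rfl | rfl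
    · simp [pderiv_X]; ring
    · simp [pderiv_X]; ring
    · simp [pderiv_X]; ring

lemma vLine_inflection_eq_zero (β α y : K) (q : MvPolynomial (Fin 3) K)
    (h : vLine β α y q = 0) : vLine β α y (inflection q) = 0 := by
  have h1 := derivative_vLine β α y q
  rw [h, Polynomial.derivative_zero] at h1
  have h2 : vLine β α y (pderiv 2 q) = - Polynomial.C β * vLine β α y (pderiv 0 q) := by
    linear_combination -h1
  have h3 := congrArg Polynomial.derivative h2
  rw [neg_mul, Polynomial.derivative_neg, Polynomial.derivative_C_mul, derivative_vLine,
    derivative_vLine] at h3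
  simp only [inflection, map_add, map_sub, map_mul, map_pow]
  rw [h2]
  linear_combination (vLine β α y (pderiv 0 q)) ^ 2 * h3

/-- Apply a derivation to each coefficient of a polynomial. -/
noncomputable def coeffDeriv {R : Type*} [CommRing R] [Algebra K R] (D : Derivation K R R) :
    Derivation K (Polynomial R) (Polynomial R) :=
  PolynomialModule.equivPolynomialSelf.toLinearMap.compDer D.mapCoeffs

lemma coeff_coeffDeriv {R : Type*} [CommRing R] [Algebra K R] (D : Derivation K R R)
    (p : Polynomial R) (i : ℕ) : (coeffDeriv D p).coeff i = D (p.coeff i) := by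
  rfl

/-- The derivation tangent to the level sets of `q` in each plane of constant `y`. -/
noncomputable def tangentDeriv (q : MvPolynomial (Fin 3) K) :
    Derivation K (MvPolynomial (Fin 3) K) (MvPolynomial (Fin 3) K) :=
  pderiv 0 q • pderiv 2 - pderiv 2 q • pderiv 0

lemma tangentDeriv_apply (q g : MvPolynomial (Fin 3) K) :
    tangentDeriv q g = pderiv 0 q * pderiv 2 g - pderiv 2 q * pderiv 0 g := by
  simp [tangentDeriv]

lemma tangentDeriv_X_zero (q : MvPolynomial (Fin 3) K) :
    tangentDeriv q (X 0) = - pderiv 2 q := by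
  simp [tangentDeriv_apply, pderiv_X]

lemma tangentDeriv_X_one (q : MvPolynomial (Fin 3) K) : tangentDeriv q (X 1) = 0 := by
  simp [tangentDeriv_apply, pderiv_X]

lemma tangentDeriv_X_two (q : MvPolynomial (Fin 3) K) :
    tangentDeriv q (X 2) = pderiv 0 q := by
  simp [tangentDeriv_apply, pderiv_X]

/-- Translation along the tangent direction by a formal parameter. -/
noncomputable def tangentShift (q : MvPolynomial (Fin 3) K) :
    MvPolynomial (Fin 3) K →ₐ[K] Polynomial (MvPolynomial (Fin 3) K) :=
  aeval ![Polynomial.C (X 0) - Polynomial.X * Polynomial.C (pderiv 2 q), Polynomial.C (X 1),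
    Polynomial.C (X 2) + Polynomial.X * Polynomial.C (pderiv 0 q)]

lemma tangentShift_C (q : MvPolynomial (Fin 3) K) (c : K) :
    tangentShift q (C c) = Polynomial.C (C c) := by
  rw [tangentShift, aeval_C]; rfl

lemma derivative_tangentShift (q h : MvPolynomial (Fin 3) K) :
    Polynomial.derivative (tangentShift q h) =
      Polynomial.C (pderiv 0 q) * tangentShift q (pderiv 2 h) -
      Polynomial.C (pderiv 2 q) * tangentShift q (pderiv 0 h) := by
  induction h using MvPolynomial.induction_on with
  | C a => simp
  | add f g hf hg => simp only [map_add, hf, hg]; ring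
  | mul_X p i hp =>
    simp only [map_mul, Polynomial.derivative_mul, hp, Derivation.leibniz, smul_eq_mul, map_add]
    have hi : i = 0 ∨ i = 1 ∨ i = 2 := by revert i; decide
    rcases hi with rfl | rfl | rfl
    · simp [pderiv_X, tangentShift]; ring
    · simp [pderiv_X, tangentShift]; ring
    · simp [pderiv_X, tangentShift]; ring

lemma coeffDeriv_C {R : Type*} [CommRing R] [Algebra K R] (D : Derivation K R R) (r : R) :
    coeffDeriv D (Polynomial.C r) = Polynomial.C (D r) := by
  ext i
  rw [coeff_coeffDeriv, Polynomial.coeff_C, Polynomial.coeff_C]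
  split_ifs <;> simp

lemma coeffDeriv_X {R : Type*} [CommRing R] [Algebra K R] (D : Derivation K R R) :
    coeffDeriv D (Polynomial.X) = 0 := by
  ext i
  rw [coeff_coeffDeriv, Polynomial.coeff_X]
  split_ifs <;> simp

lemma coeffDeriv_tangentShift (q h : MvPolynomial (Fin 3) K) :
    coeffDeriv (tangentDeriv q) (tangentShift q h) =
      tangentShift q (pderiv 2 h) * (Polynomial.C (pderiv 0 q) +
        Polynomial.X * Polynomial.C (tangentDeriv q (pderiv 0 q))) -
      tangentShift q (pderiv 0 h) * (Polynomial.C (pderiv 2 q) +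
        Polynomial.X * Polynomial.C (tangentDeriv q (pderiv 2 q))) := by
  induction h using MvPolynomial.induction_on with
  | C a =>
    rw [tangentShift_C, coeffDeriv_C, ← algebraMap_eq]
    simp
  | add f g hf hg => simp only [map_add, hf, hg]; ring
  | mul_X p i hp =>
    simp only [map_mul, hp, Derivation.leibniz, smul_eq_mul, map_add]
    have hi : i = 0 ∨ i = 1 ∨ i = 2 := by revert i; decide
    rcases hi with rfl | rfl | rfl
    · have : coeffDeriv (tangentDeriv q) (tangentShift q (X 0)) = - (Polynomial.C (pderiv 2 q) +
        Polynomial.X * Polynomial.C (tangentDeriv q (pderiv 2 q))) := by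
        simp [tangentShift, coeffDeriv_C, coeffDeriv_X, tangentDeriv_X_zero]
        ring
      rw [this]
      simp [pderiv_X]; ring
    · have : coeffDeriv (tangentDeriv q) (tangentShift q (X 1)) = 0 := by
        simp [tangentShift, coeffDeriv_C, tangentDeriv_X_one]
      rw [this]
      simp [pderiv_X]; ring
    · have : coeffDeriv (tangentDeriv q) (tangentShift q (X 2)) = (Polynomial.C (pderiv 0 q) +
        Polynomial.X * Polynomial.C (tangentDeriv q (pderiv 0 q))) := by
        simp [tangentShift, coeffDeriv_C, coeffDeriv_X, tangentDeriv_X_two]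
      rw [this]
      simp [pderiv_X]; ring

lemma tangentShift_ode (q : MvPolynomial (Fin 3) K) :
    Polynomial.C (pderiv 0 q) * coeffDeriv (tangentDeriv q) (tangentShift q q) =
      (Polynomial.C (pderiv 0 q) + Polynomial.X * Polynomial.C (tangentDeriv q (pderiv 0 q))) *
        Polynomial.derivative (tangentShift q q) -
      Polynomial.X * Polynomial.C (inflection q) * tangentShift q (pderiv 0 q) := by
  have h : inflection q = -(pderiv 2 q * tangentDeriv q (pderiv 0 q) -
      pderiv 0 q * tangentDeriv q (pderiv 2 q)) := by
    rw [tangentDeriv_apply, tangentDeriv_apply, inflection]; ring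
  rw [coeffDeriv_tangentShift, derivative_tangentShift, h]
  simp only [map_neg, map_sub, map_mul]
  ring

lemma natDegree_tangentShift_le (q h : MvPolynomial (Fin 3) K) :
    (tangentShift q h).natDegree ≤ h.totalDegree := by
  let A := MvPolynomial (Fin 3) K
  have h1 : tangentShift q h = aeval ![Polynomial.C (X 0) - Polynomial.X *
      Polynomial.C (pderiv 2 q), Polynomial.C (X 1),
      Polynomial.C (X 2) + Polynomial.X * Polynomial.C (pderiv 0 q)] (map (algebraMap K A) h) := by
    rw [aeval_map_algebraMap]; rfl
  have h2 : (map (algebraMap K A) h).totalDegree ≤ h.totalDegree :=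
    Finset.sup_mono (support_map_subset _ _)
  rw [h1]
  refine (MvPolynomial.aeval_natDegree_le (m := h.totalDegree) (n := 1) _ h2 _ ?_).trans (by simp)
  intro i
  have hX : ∀ a : A, (Polynomial.X * Polynomial.C a).natDegree ≤ 1 := by
    intro a
    rw [mul_comm]
    simpa using Polynomial.natDegree_C_mul_X_pow_le a 1
  fin_cases i
  · refine (Polynomial.natDegree_sub_le _ _).trans (max_le (by simp) (hX _))
  · simp
  · refine (Polynomial.natDegree_add_le _ _).trans (max_le (by simp) (hX _))

lemma coeff_zero_tangentShift (q h : MvPolynomial (Fin 3) K) :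
    (tangentShift q h).coeff 0 = h := by
  induction h using MvPolynomial.induction_on with
  | C a => simp
  | add f g hf hg => simp [hf, hg]
  | mul_X p i hp =>
    rw [map_mul, Polynomial.mul_coeff_zero, hp]
    congr 1
    have hi : i = 0 ∨ i = 1 ∨ i = 2 := by revert i; decide
    rcases hi with rfl | rfl | rfl <;> simp [tangentShift]

lemma dvd_coeff_tangentShift (q : MvPolynomial (Fin 3) K) (hq : Prime q)
    (hdvd : q ∣ inflection q) (hqz : ¬ q ∣ pderiv 0 q)
    (hchar : ∀ k : ℕ, 0 < k → k ≤ q.totalDegree → (k : K) ≠ 0) (j : ℕ) :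
    q ∣ (tangentShift q q).coeff j := by
  induction j with
  | zero => rw [coeff_zero_tangentShift]
  | succ j ih =>
    by_cases hj : q.totalDegree < j + 1
    · rw [Polynomial.coeff_eq_zero_of_natDegree_lt
        ((natDegree_tangentShift_le q q).trans_lt hj)]
      exact dvd_zero _
    have hD : q ∣ tangentDeriv q ((tangentShift q q).coeff j) := by
      obtain ⟨u, hu⟩ := ih
      rw [hu, Derivation.leibniz, tangentDeriv_apply q q]
      refine ⟨tangentDeriv q u, ?_⟩
      simp only [smul_eq_mul]; ring
    have h := congrArg (fun P => Polynomial.coeff P j) (tangentShift_ode q)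
    simp only [add_mul, mul_assoc, Polynomial.coeff_sub, Polynomial.coeff_add,
      Polynomial.coeff_C_mul, coeff_coeffDeriv, Polynomial.coeff_derivative] at h
    have h1 : q ∣ (Polynomial.X * (Polynomial.C (inflection q) *
        tangentShift q (pderiv 0 q))).coeff j := by
      cases j with
      | zero => simp
      | succ j =>
        rw [Polynomial.coeff_X_mul, Polynomial.coeff_C_mul]
        exact hdvd.mul_right _
    have h2 : q ∣ (Polynomial.X * (Polynomial.C (tangentDeriv q (pderiv 0 q)) *
        Polynomial.derivative (tangentShift q q))).coeff j := by
      cases j with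
      | zero => simp
      | succ j =>
        rw [Polynomial.coeff_X_mul, Polynomial.coeff_C_mul, Polynomial.coeff_derivative]
        exact (ih.mul_right _).mul_left _
    have h3 : q ∣ pderiv 0 q * ((tangentShift q q).coeff (j + 1) * ((j : MvPolynomial _ K) + 1)) := by
      have := (((hD.mul_left (pderiv 0 q)).add h1).sub h2)
      rw [h] at this
      convert this using 1
      ring
    have hunit : IsUnit ((j : MvPolynomial (Fin 3) K) + 1) := by
      have := hchar (j + 1) (Nat.succ_pos _) (by omega)
      have h4 : ((j : MvPolynomial (Fin 3) K) + 1) = C ((j + 1 : ℕ) : K) := by simp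
      rw [h4]
      exact (isUnit_iff_ne_zero.2 this).map C
    exact hunit.dvd_mul_right.1 ((hq.dvd_or_dvd h3).resolve_left hqz)

end Ruled

section Ruling
open MvPolynomial

variable {K : Type*} [Field K]

lemma exists_dvd_pow_mul_sub (X' Y z₀ : K) (hX : X' ≠ 0) (w v : Polynomial K)
    (T : MvPolynomial (Fin 3) K) (hT : T = C X'⁻¹ * (X 1 - C Y)) (h : MvPolynomial (Fin 3) K) :
    ∃ (e : ℕ) (P : Polynomial (Polynomial K)),
      (Polynomial.aeval T w * (X 0 - C z₀) + Polynomial.aeval T v * (X 2 - T)) ∣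
        Polynomial.aeval T w ^ e * h -
          P.eval₂ (Polynomial.aeval T : Polynomial K →ₐ[K] _).toRingHom (X 2) := by
  set W := Polynomial.aeval T w with hW
  set V := Polynomial.aeval T v with hV
  set φ : Polynomial K →+* MvPolynomial (Fin 3) K :=
    (Polynomial.aeval T : Polynomial K →ₐ[K] _).toRingHom with hφ
  have hφC : ∀ c, φ (Polynomial.C c) = C c := fun c => by simp [hφ]
  have hφX : φ Polynomial.X = T := by simp [hφ]
  have hφw : φ w = W := rfl
  have hφv : φ v = V := rfl
  induction h using MvPolynomial.induction_on with
  | C a => exact ⟨0, Polynomial.C (Polynomial.C a), by simp [hφC]⟩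
  | add f g hf hg =>
    obtain ⟨e, P, u, hu⟩ := hf
    obtain ⟨e', P', u', hu'⟩ := hg
    refine ⟨e + e', Polynomial.C (w ^ e') * P + Polynomial.C (w ^ e) * P',
      W ^ e' * u + W ^ e * u', ?_⟩
    rw [Polynomial.eval₂_add, Polynomial.eval₂_mul, Polynomial.eval₂_mul, Polynomial.eval₂_C,
      Polynomial.eval₂_C, map_pow, map_pow, hφw]
    linear_combination W ^ e' * hu + W ^ e * hu'
  | mul_X p i hp =>
    obtain ⟨e, P, u, hu⟩ := hp
    have hi : i = 0 ∨ i = 1 ∨ i = 2 := by revert i; decide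
    rcases hi with rfl | rfl | rfl
    · refine ⟨e + 1, (Polynomial.C (w * Polynomial.C z₀) -
        Polynomial.C v * (Polynomial.X - Polynomial.C Polynomial.X)) * P,
        u * W * X 0 + P.eval₂ φ (X 2), ?_⟩
      simp only [Polynomial.eval₂_sub, Polynomial.eval₂_mul, Polynomial.eval₂_C, map_mul,
        Polynomial.eval₂_X, hφw, hφv, hφC, hφX]
      linear_combination W * X 0 * hu
    · refine ⟨e, Polynomial.C (Polynomial.C X' * Polynomial.X + Polynomial.C Y) * P, u * X 1, ?_⟩
      have h1 : C X' * T + C Y = (X 1 : MvPolynomial (Fin 3) K) := by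
        rw [hT, ← mul_assoc, ← C_mul, mul_inv_cancel₀ hX, C_1]; ring
      rw [Polynomial.eval₂_mul, Polynomial.eval₂_C, map_add, map_mul, hφC, hφC, hφX, h1]
      linear_combination X 1 * hu
    · refine ⟨e, Polynomial.X * P, u * X 2, ?_⟩
      simp only [Polynomial.eval₂_mul, Polynomial.eval₂_X]
      linear_combination X 2 * hu

/-- On a surface satisfying the inflection equation, a vertical line in the surface meets every
transversal horizontal line of the surface away from few exceptional heights. -/
lemma eval_eq_zero_of_not_meets (q : MvPolynomial (Fin 3) K) (hq : Prime q)
    (hdvd : q ∣ inflection q) (hqz : ¬ q ∣ pderiv 0 q)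
    (hchar : ∀ k : ℕ, 0 < k → k ≤ q.totalDegree → (k : K) ≠ 0)
    (X' Y z₀ : K) (hX : X' ≠ 0) (hℓ : hLine X' Y z₀ q = 0)
    (hw : hLine X' Y z₀ (pderiv 0 q) ≠ 0) (β α y : K) (hm : vLine β α y q = 0)
    (hmeet : ¬ Meets X' Y z₀ β α y) :
    (hLine X' Y z₀ (pderiv 0 q)).eval (X'⁻¹ * (y - Y)) = 0 := by
  set w := hLine X' Y z₀ (pderiv 0 q) with hwdef
  set v := hLine X' Y z₀ (pderiv 2 q) with hvdef
  obtain ⟨T, hT⟩ : ∃ T : MvPolynomial (Fin 3) K, T = C X'⁻¹ * (X 1 - C Y) := ⟨_, rfl⟩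
  obtain ⟨e, P, hP⟩ := exists_dvd_pow_mul_sub X' Y z₀ hX w v T hT q
  set g := Polynomial.aeval T w * (X 0 - C z₀) + Polynomial.aeval T v * (X 2 - T) with hg
  let Ψ : MvPolynomial (Fin 3) K →ₐ[K] Polynomial (Polynomial K) :=
    (Polynomial.mapAlgHom (hLine X' Y z₀)).comp (tangentShift q)
  have hΨq : Ψ q = 0 := by
    ext1 j
    obtain ⟨u, hu⟩ := dvd_coeff_tangentShift q hq hdvd hqz hchar j
    have : (Ψ q).coeff j = hLine X' Y z₀ ((tangentShift q q).coeff j) := by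
      simp [Ψ]
    rw [this, hu, map_mul, hℓ, zero_mul, Polynomial.coeff_zero]
  have hΨC : ∀ c, Ψ (C c) = Polynomial.C (Polynomial.C c) := by
    intro c; simp [Ψ]
  have hΨ0 : Ψ (X 0) = Polynomial.C (Polynomial.C z₀) - Polynomial.X * Polynomial.C v := by
    simp [Ψ, tangentShift, hvdef]
  have hΨ1 : Ψ (X 1) = Polynomial.C (Polynomial.C X' * Polynomial.X + Polynomial.C Y) := by
    simp [Ψ, tangentShift]
  have hΨ2 : Ψ (X 2) = Polynomial.C Polynomial.X + Polynomial.X * Polynomial.C w := by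
    simp [Ψ, tangentShift, hwdef]
  have hΨT : Ψ T = Polynomial.C Polynomial.X := by
    rw [hT, map_mul, map_sub, hΨC, hΨ1, hΨC, ← Polynomial.C_sub, ← Polynomial.C_mul,
      add_sub_cancel_right, ← mul_assoc, ← Polynomial.C_mul, inv_mul_cancel₀ hX]
    simp
  have hΨf : ∀ f : Polynomial K, Ψ (Polynomial.aeval T f) = Polynomial.C f := by
    intro f
    rw [← Polynomial.aeval_algHom_apply, hΨT]
    induction f using Polynomial.induction_on' with
    | add a b ha hb => rw [map_add, ha, hb, Polynomial.C_add]
    | monomial n a =>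
      rw [Polynomial.aeval_monomial, ← Polynomial.C_pow]
      have : algebraMap K (Polynomial (Polynomial K)) a = Polynomial.C (Polynomial.C a) := rfl
      rw [this, ← Polynomial.C_mul, Polynomial.C_mul_X_pow_eq_monomial]
  have hΨg : Ψ g = 0 := by
    rw [hg]
    simp only [map_add, map_mul, map_sub, hΨf, hΨ0, hΨ2, hΨT, hΨC]
    ring
  have hΨP : Ψ (P.eval₂ (Polynomial.aeval T : Polynomial K →ₐ[K] _).toRingHom (X 2)) =
      P.comp (Polynomial.C w * Polynomial.X + Polynomial.C Polynomial.X) := by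
    have h1 := Polynomial.hom_eval₂ P
      (Polynomial.aeval T : Polynomial K →ₐ[K] MvPolynomial (Fin 3) K).toRingHom Ψ.toRingHom (X 2)
    refine h1.trans ?_
    rw [Polynomial.comp]
    congr 1
    · exact RingHom.ext hΨf
    · exact hΨ2.trans (by ring)
  have hP0 : P = 0 := by
    obtain ⟨u, hu⟩ := hP
    have h1 := congrArg Ψ hu
    rw [map_sub, map_mul, hΨq, mul_zero, hΨP, map_mul, hΨg, zero_mul, zero_sub, neg_eq_zero] at h1
    rw [Polynomial.comp_eq_zero_iff] at h1
    rcases h1 with h1 | ⟨-, h1⟩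
    · exact h1
    · have := congrArg (fun P => Polynomial.coeff P 1) h1
      simp at this
      exact absurd this hw
  rw [hP0, Polynomial.eval₂_zero, sub_zero] at hP
  obtain ⟨u, hu⟩ := hP
  have hqg : q ∣ g := by
    rcases hq.dvd_or_dvd (Dvd.intro_left _ hu : q ∣ g * u) with h | ⟨u', rfl⟩
    · exact h
    · exfalso
      have h1 : Polynomial.aeval T w ^ e = g * u' := by
        apply mul_right_cancel₀ hq.ne_zero
        rw [hu]; ring
      have h2 := congrArg Ψ h1
      rw [map_mul, hΨg, zero_mul, map_pow, hΨf] at h2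
      exact hw (Polynomial.C_eq_zero.1 (eq_zero_of_pow_eq_zero h2))
  have hvg : vLine β α y g = 0 := by
    obtain ⟨u, hu⟩ := hqg
    rw [hu, map_mul, hm, zero_mul]
  have hvT : vLine β α y T = Polynomial.C (X'⁻¹ * (y - Y)) := by
    rw [hT]; simp
  have hvf : ∀ f : Polynomial K, vLine β α y (Polynomial.aeval T f) =
      Polynomial.C (f.eval (X'⁻¹ * (y - Y))) := by
    intro f
    rw [← Polynomial.aeval_algHom_apply, hvT]
    induction f using Polynomial.induction_on' with
    | add a b ha hb => rw [map_add, ha, hb, Polynomial.eval_add, Polynomial.C_add]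
    | monomial n a => simp
  have h3 := congrArg (Polynomial.eval (X'⁻¹ * (y - Y))) hvg
  rw [hg] at h3
  simp only [map_add, map_mul, map_sub, hvf, hvT, vLine_zero, vLine_two, vLine_C,
    Polynomial.eval_add, Polynomial.eval_mul, Polynomial.eval_sub, Polynomial.eval_C,
    Polynomial.eval_X, sub_self, mul_zero, add_zero, Polynomial.eval_zero] at h3
  rcases mul_eq_zero.1 h3 with h | h
  · exact h
  · exfalso
    apply hmeet
    refine ⟨X'⁻¹ * (y - Y), (sub_eq_zero.1 h).symm, ?_⟩
    field_simp; ring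

lemma card_not_meets_le {ι : Type*} (S : Finset ι) (β α y : ι → K) (hy : Set.InjOn y S)
    (q : MvPolynomial (Fin 3) K) (hq : Prime q)
    (hdvd : q ∣ inflection q) (hqz : ¬ q ∣ pderiv 0 q)
    (hchar : ∀ k : ℕ, 0 < k → k ≤ q.totalDegree → (k : K) ≠ 0)
    (X' Y z₀ : K) (hX : X' ≠ 0) (hℓ : hLine X' Y z₀ q = 0)
    (hw : hLine X' Y z₀ (pderiv 0 q) ≠ 0)
    (hS : ∀ j ∈ S, vLine (β j) (α j) (y j) q = 0 ∧ ¬ Meets X' Y z₀ (β j) (α j) (y j)) :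
    S.card ≤ q.totalDegree := by
  classical
  calc S.card = (S.image fun j => X'⁻¹ * (y j - Y)).card := by
        refine (card_image_of_injOn ?_).symm
        intro i hi j hj hij
        exact hy hi hj (sub_left_injective (mul_left_cancel₀ (inv_ne_zero hX) hij))
    _ ≤ (hLine X' Y z₀ (pderiv 0 q)).roots.toFinset.card := by
        apply card_le_card
        intro u hu
        obtain ⟨j, hj, rfl⟩ := Finset.mem_image.1 hu
        rw [Multiset.mem_toFinset, Polynomial.mem_roots hw, Polynomial.IsRoot]
        exact eval_eq_zero_of_not_meets q hq hdvd hqz hchar X' Y z₀ hX hℓ hw _ _ _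
          (hS j hj).1 (hS j hj).2
    _ ≤ (hLine X' Y z₀ (pderiv 0 q)).natDegree :=
        (Multiset.toFinset_card_le _).trans (Polynomial.card_roots' _)
    _ ≤ (pderiv 0 q).totalDegree := natDegree_hLine_le _ _ _ _
    _ ≤ q.totalDegree := (totalDegree_pderiv_le _ _).trans (Nat.sub_le _ _)

end Ruling

section Incidence

/-- Number of incidences between two finite sets for a given relation. -/
noncomputable def incidences {I J : Type*} (r : I → J → Prop) (T : Finset I) (M : Finset J) : ℕ :=
  open Classical in ∑ i ∈ T, (M.filter (r i)).card

variable {I J : Type*} (r : I → J → Prop)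

lemma incidences_eq_sum [∀ i j, Decidable (r i j)] (T : Finset I) (M : Finset J) :
    incidences r T M = ∑ i ∈ T, (M.filter (r i)).card := by
  unfold incidences
  congr! 3

lemma incidences_eq_sum_right [∀ i j, Decidable (r i j)] (T : Finset I) (M : Finset J) :
    incidences r T M = ∑ j ∈ M, (T.filter fun i => r i j).card := by
  rw [incidences_eq_sum]
  exact sum_card_bipartiteAbove_eq_sum_card_bipartiteBelow r

lemma incidences_split_left (p : I → Prop) [DecidablePred p] (T : Finset I) (M : Finset J) :
    incidences r T M = incidences r (T.filter p) M + incidences r (T.filter fun i => ¬ p i) M :=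
  (sum_filter_add_sum_filter_not T p _).symm

lemma incidences_split_right (p : J → Prop) [DecidablePred p] (T : Finset I) (M : Finset J) :
    incidences r T M = incidences r T (M.filter p) + incidences r T (M.filter fun i => ¬ p i) := by
  classical
  simp only [incidences_eq_sum_right]
  exact (sum_filter_add_sum_filter_not M p _).symm

lemma incidences_le_left [∀ i j, Decidable (r i j)] (T : Finset I) (M : Finset J) (b : ℕ)
    (h : ∀ i ∈ T, (M.filter (r i)).card ≤ b) : incidences r T M ≤ b * T.card := by
  rw [incidences_eq_sum, mul_comm]
  exact sum_le_card_nsmul _ _ _ h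

lemma incidences_le_right [∀ i j, Decidable (r i j)] (T : Finset I) (M : Finset J) (b : ℕ)
    (h : ∀ j ∈ M, (T.filter fun i => r i j).card ≤ b) : incidences r T M ≤ b * M.card := by
  rw [incidences_eq_sum_right, mul_comm]
  exact sum_le_card_nsmul _ _ _ h

/-- The Kővári–Sós–Turán bound, in quadratic form. -/
lemma incidences_sq_le (T : Finset I) (M : Finset J) (k : ℕ)
    (hk : ∀ i i', i ≠ i' → ∀ M : Finset J, (∀ j ∈ M, r i j ∧ r i' j) → M.card ≤ k) :
    incidences r T M ^ 2 ≤ M.card * (incidences r T M + k * T.card ^ 2) := by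
  classical
  have h1 : ∑ j ∈ M, (T.filter fun i => r i j).card ^ 2 ≤
      incidences r T M + k * T.card ^ 2 := by
    have h2 : ∀ j ∈ M, (T.filter fun i => r i j).card ^ 2 =
        ((T ×ˢ T).filter fun u => r u.1 j ∧ r u.2 j).card := by
      intro j _
      rw [pow_two, ← card_product, ← filter_product]
    rw [sum_congr rfl h2]
    have h4 : ∑ j ∈ M, ((T ×ˢ T).filter fun u => r u.1 j ∧ r u.2 j).card =
        ∑ u ∈ T ×ˢ T, (M.filter fun j => r u.1 j ∧ r u.2 j).card :=
      sum_card_bipartiteAbove_eq_sum_card_bipartiteBelow (fun j (u : I × I) => r u.1 j ∧ r u.2 j)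
    rw [h4]
    have h3 : ∀ u ∈ T ×ˢ T, (M.filter fun j => r u.1 j ∧ r u.2 j).card ≤
        (if u.1 = u.2 then (M.filter fun j => r u.1 j).card else 0) + k := by
      intro u _
      split_ifs with h
      · rw [h]; simp
      · rw [zero_add]
        exact hk u.1 u.2 h _ (fun j hj => (mem_filter.1 hj).2)
    refine (sum_le_sum h3).trans ?_
    rw [sum_add_distrib, sum_product]
    simp only [sum_ite_eq, sum_const, card_product, smul_eq_mul]
    rw [sum_congr rfl (fun i hi => if_pos hi)]
    apply le_of_eq
    rw [incidences_eq_sum]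
    ring
  calc incidences r T M ^ 2 = (∑ j ∈ M, (T.filter fun i => r i j).card) ^ 2 := by
        rw [incidences_eq_sum_right]
    _ ≤ M.card * ∑ j ∈ M, (T.filter fun i => r i j).card ^ 2 := sq_sum_le_card_mul_sum_sq
    _ ≤ _ := Nat.mul_le_mul_left _ h1

lemma incidences_le_of_card_le (T : Finset I) (M : Finset J) (k s d : ℕ)
    (hk : ∀ i i', i ≠ i' → ∀ M : Finset J, (∀ j ∈ M, r i j ∧ r i' j) → M.card ≤ k)
    (hs : 12 * k ≤ s ^ 2) (hM : M.card ≤ 12 * d ^ 2) :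
    incidences r T M ≤ M.card + s * d * T.card := by
  have h := incidences_sq_le r T M k hk
  by_contra! hlt
  set x := incidences r T M
  set N := M.card
  set t := T.card
  have h1 : N * (k * t ^ 2) ≤ (s * d * t) ^ 2 := by
    calc N * (k * t ^ 2) ≤ (12 * d ^ 2) * (k * t ^ 2) := Nat.mul_le_mul_right _ hM
      _ = (12 * k) * (d ^ 2 * t ^ 2) := by ring
      _ ≤ s ^ 2 * (d ^ 2 * t ^ 2) := Nat.mul_le_mul_right _ hs
      _ = _ := by ring
  generalize s * d * t = u at *
  nlinarith

/-- Iterating a bound valid for small pieces. -/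
lemma incidences_le_of_pieces (M : Finset J) (t a b : ℕ)
    (h : ∀ T : Finset I, T.card ≤ t → incidences r T M ≤ a + b * T.card) (n : ℕ) :
    ∀ L : Finset I, L.card ≤ n * t → incidences r L M ≤ n * a + b * L.card := by
  classical
  induction n with
  | zero =>
    intro L hL
    have : L = ∅ := by
      rw [← card_eq_zero]; omega
    subst this
    simp [incidences]
  | succ n ih =>
    intro L hL
    by_cases hLt : L.card ≤ t
    · refine (h L hLt).trans ?_
      nlinarith
    · obtain ⟨T, hTL, hT⟩ := exists_subset_card_eq (le_of_not_ge hLt)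
      have h1 := incidences_split_left r (· ∈ T) L M
      have h2 : L.filter (· ∈ T) = T := by
        rw [filter_mem_eq_inter]; exact inter_eq_right.2 hTL
      have h3 : L.filter (fun i => ¬ i ∈ T) = L \ T := by
        ext; simp
      rw [h2, h3] at h1
      have h4 : (L \ T).card = L.card - t := by rw [card_sdiff_of_subset hTL, hT]
      have h5 := ih (L \ T) (by rw [h4]; rw [Nat.succ_mul] at hL; omega)
      have h6 := h T hT.le
      have h7 : (L \ T).card + T.card = L.card := by omega
      rw [h1, ← h7]
      nlinarith

end Incidence

section LineIncidence
open MvPolynomial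

variable {K I J : Type*} [Field K] (X Y z : I → K) (β α y : J → K)

/-- The incidence relation between horizontal and vertical lines. -/
def LineMeets (i : I) (j : J) : Prop := Meets (X i) (Y i) (z i) (β j) (α j) (y j)

lemma degreeOf_eq_zero_of_pderiv_eq_zero (q : MvPolynomial (Fin 3) K)
    (hchar : ∀ m : ℕ, 0 < m → m ≤ q.totalDegree → (m : K) ≠ 0) (h : pderiv 0 q = 0) :
    q.degreeOf 0 = 0 := by
  rw [← Nat.le_zero, degreeOf_le_iff]
  intro m hm
  by_contra! hpos
  have h1 := coeff_pderiv (i := 0) q (m - (Finsupp.single 0 1 : Fin 3 →₀ ℕ))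
  have h2 : m - (Finsupp.single 0 1 : Fin 3 →₀ ℕ) + Finsupp.single 0 1 = m := by
    ext i
    by_cases hi : i = 0
    · subst hi; simp; omega
    · simp [Ne.symm hi]
  rw [h, coeff_zero, h2] at h1
  have hm0 : m 0 ≤ q.totalDegree := by
    refine le_trans ?_ (degreeOf_le_totalDegree q 0)
    exact degreeOf_le_iff.1 le_rfl m hm
  have h3 : (((m - (Finsupp.single 0 1 : Fin 3 →₀ ℕ)) 0 : ℕ) : K) + 1 = (m 0 : K) := by
    have : (m - (Finsupp.single 0 1 : Fin 3 →₀ ℕ)) 0 + 1 = m 0 := by simp; omega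
    rw [← this]; push_cast; rfl
  rw [h3] at h1
  rcases mul_eq_zero.1 h1.symm with h4 | h4
  · exact (mem_support_iff.1 hm) h4
  · exact hchar _ hpos hm0 h4

variable {X Y z β α y}

/-- Incidences between lines in an irreducible surface. -/
lemma incidences_le_of_prime (hX : ∀ i, X i ≠ 0) (hz : Function.Injective z)
    (hy : Function.Injective y) (k s : ℕ) (hs : 12 * k ≤ s ^ 2)
    (hk : ∀ i i', i ≠ i' → ∀ M : Finset J,
      (∀ j ∈ M, LineMeets X Y z β α y i j ∧ LineMeets X Y z β α y i' j) → M.card ≤ k)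
    (q : MvPolynomial (Fin 3) K) (hq : Prime q)
    (hchar : ∀ m : ℕ, 0 < m → m ≤ q.totalDegree → (m : K) ≠ 0)
    (T : Finset I) (M : Finset J) (hT : ∀ i ∈ T, hLine (X i) (Y i) (z i) q = 0)
    (hM : ∀ j ∈ M, vLine (β j) (α j) (y j) q = 0) :
    incidences (LineMeets X Y z β α y) T M ≤
      3 * q.totalDegree * M.card + (k + (2 + s) * q.totalDegree) * T.card := by
  classical
  set r := LineMeets X Y z β α y with hr
  obtain ⟨d, hd⟩ : ∃ d, q.totalDegree = d := ⟨_, rfl⟩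
  have hdpos : 0 < d := hd ▸ totalDegree_pos_of_prime q hq
  rw [hd]
  by_cases hMc : M.card ≤ 12 * d ^ 2
  · have := incidences_le_of_card_le r T M k s d hk hs hMc
    nlinarith [Nat.zero_le (k * T.card), Nat.zero_le (d * T.card), Nat.mul_le_mul_right M.card hdpos]
  have hqz0 : pderiv 0 q ≠ 0 := by
    intro h
    have h1 := card_vLines_le_of_degreeOf_eq_zero M β α y hy.injOn q hq.ne_zero
      (degreeOf_eq_zero_of_pderiv_eq_zero q hchar h) hM
    apply hMc
    nlinarith
  have hqzd : (pderiv 0 q).totalDegree ≤ d - 1 := hd ▸ totalDegree_pderiv_le 0 q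
  have hqz : ¬ q ∣ pderiv 0 q := by
    intro h
    have := totalDegree_le_of_dvd_of_isDomain h hqz0
    omega
  have hF : q ∣ inflection q := by
    by_contra h
    have hdeg := totalDegree_inflection_le q
    rw [hd] at hdeg
    have := card_common_vLines_le M β α y hy.injOn q (inflection q) hq h (3 * d) (by omega) hdeg
      (fun j hj => ⟨hM j hj, vLine_inflection_eq_zero _ _ _ _ (hM j hj)⟩)
    apply hMc
    rw [hd] at this
    nlinarith
  have hMs : (M.filter fun j => vLine (β j) (α j) (y j) (pderiv 0 q) = 0).card ≤ 12 * d ^ 2 := by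
    have := card_common_vLines_le (M.filter fun j => vLine (β j) (α j) (y j) (pderiv 0 q) = 0)
      β α y hy.injOn q (pderiv 0 q) hq hqz d (by omega) (by omega)
      (fun j hj => ⟨hM j (mem_filter.1 hj).1, (mem_filter.1 hj).2⟩)
    rw [hd] at this
    nlinarith [Nat.sub_le d 1]
  set Ms := M.filter fun j => vLine (β j) (α j) (y j) (pderiv 0 q) = 0 with hMsdef
  set Mn := M.filter fun j => ¬ vLine (β j) (α j) (y j) (pderiv 0 q) = 0 with hMndef
  set Ts := T.filter fun i => hLine (X i) (Y i) (z i) (pderiv 0 q) = 0 with hTsdef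
  set Tn := T.filter fun i => ¬ hLine (X i) (Y i) (z i) (pderiv 0 q) = 0 with hTndef
  have hsplit : incidences r T M = incidences r Ts Ms + incidences r Ts Mn + incidences r Tn M := by
    have e1 : incidences r T M = incidences r Ts M + incidences r Tn M :=
      incidences_split_left r _ T M
    have e2 : incidences r Ts M = incidences r Ts Ms + incidences r Ts Mn :=
      incidences_split_right r _ Ts M
    omega
  have hTsT : Ts.card ≤ T.card := card_filter_le _ _
  have hTnT : Tn.card ≤ T.card := card_filter_le _ _
  have hMsM : Ms.card ≤ M.card := card_filter_le _ _
  have hMnM : Mn.card ≤ M.card := card_filter_le _ _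
  have h1 : incidences r Ts Ms ≤ M.card + s * d * T.card := by
    refine (incidences_le_of_card_le r Ts Ms k s d hk hs hMs).trans ?_
    gcongr
  have h2 : incidences r Ts Mn ≤ d * M.card := by
    refine (incidences_le_right r Ts Mn d ?_).trans (Nat.mul_le_mul_left _ hMnM)
    intro j hj
    have := card_meets_le_of_vLine_ne_zero (Ts.filter fun i => r i j) X Y z (β j) (α j) (y j)
      hz.injOn (pderiv 0 q) (fun i hi => ⟨(mem_filter.1 (mem_filter.1 hi).1).2,
        (mem_filter.1 hi).2⟩) (mem_filter.1 hj).2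
    omega
  have h3 : incidences r Tn M ≤ M.card + (k + 2 * d) * T.card := by
    by_cases hc : Tn.card ≤ 1
    · have := incidences_le_left r Tn M M.card (fun i _ => card_filter_le _ _)
      nlinarith [Nat.zero_le ((k + 2 * d) * T.card), Nat.mul_le_mul_left M.card hc]
    · obtain ⟨i, hi, i', hi', hne⟩ := one_lt_card.1 (not_le.1 hc)
      have hbad : ∀ i ∈ Tn, (M.filter fun j => ¬ r i j).card ≤ d := by
        intro i hi
        rw [← hd]
        refine card_not_meets_le _ β α y hy.injOn q hq hF hqz hchar (X i) (Y i) (z i) (hX i)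
          (hT i (mem_filter.1 hi).1) (mem_filter.1 hi).2 ?_
        intro j hj
        exact ⟨hM j (mem_filter.1 hj).1, (mem_filter.1 hj).2⟩
      have hcov : M ⊆ (M.filter fun j => ¬ r i j) ∪ (M.filter fun j => ¬ r i' j) ∪
          (M.filter fun j => r i j ∧ r i' j) := by
        intro j hj
        simp only [mem_union, mem_filter]
        tauto
      have hMk : M.card ≤ k + 2 * d := by
        have := card_le_card hcov
        have h4 := card_union_le ((M.filter fun j => ¬ r i j) ∪ (M.filter fun j => ¬ r i' j))
          (M.filter fun j => r i j ∧ r i' j)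
        have h5 := card_union_le (M.filter fun j => ¬ r i j) (M.filter fun j => ¬ r i' j)
        have h6 := hbad i hi
        have h7 := hbad i' hi'
        have h8 := hk i i' hne (M.filter fun j => r i j ∧ r i' j)
          (fun j hj => (mem_filter.1 hj).2)
        omega
      have := incidences_le_left r Tn M (k + 2 * d)
        (fun i _ => (card_filter_le _ _).trans hMk)
      have := Nat.mul_le_mul_left (k + 2 * d) hTnT
      omega
  rw [hsplit]
  nlinarith [Nat.mul_le_mul_right M.card hdpos]

/-- Incidences when all horizontal lines lie in a surface. -/
lemma incidences_le_of_vanishing (hX : ∀ i, X i ≠ 0) (hz : Function.Injective z)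
    (hy : Function.Injective y) (k s : ℕ) (hs : 12 * k ≤ s ^ 2)
    (hk : ∀ i i', i ≠ i' → ∀ M : Finset J,
      (∀ j ∈ M, LineMeets X Y z β α y i j ∧ LineMeets X Y z β α y i' j) → M.card ≤ k)
    (Q : MvPolynomial (Fin 3) K) (hQ : Q ≠ 0)
    (hchar : ∀ m : ℕ, 0 < m → m ≤ Q.totalDegree → (m : K) ≠ 0)
    (T : Finset I) (M : Finset J) (hT : ∀ i ∈ T, hLine (X i) (Y i) (z i) Q = 0) :
    incidences (LineMeets X Y z β α y) T M ≤
      4 * Q.totalDegree * M.card + (k + (3 + s) * Q.totalDegree) * T.card := by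
  classical
  set r := LineMeets X Y z β α y with hr
  induction Q using UniqueFactorizationMonoid.induction_on_prime generalizing T M with
  | h₁ => exact absurd rfl hQ
  | h₂ u hu =>
    have : T = ∅ := by
      rw [eq_empty_iff_forall_notMem]
      intro i hi
      have h := hu.map (hLine (X i) (Y i) (z i))
      rw [hT i hi] at h
      exact not_isUnit_zero h
    subst this
    simp [incidences]
  | h₃ Q q hQ0 hq ih =>
    have hdeg : (q * Q).totalDegree = q.totalDegree + Q.totalDegree :=
      totalDegree_mul_of_isDomain hq.ne_zero hQ0
    rw [hdeg] at hchar ⊢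
    set Tq := T.filter fun i => hLine (X i) (Y i) (z i) q = 0 with hTq
    set Tn := T.filter fun i => ¬ hLine (X i) (Y i) (z i) q = 0 with hTn
    set Mq := M.filter fun j => vLine (β j) (α j) (y j) q = 0 with hMq
    set Mn := M.filter fun j => ¬ vLine (β j) (α j) (y j) q = 0 with hMn
    have hcT : Tq.card + Tn.card = T.card := card_filter_add_card_filter_not _
    have hcM : Mq.card + Mn.card = M.card := card_filter_add_card_filter_not _
    have hsplit : incidences r T M = incidences r Tq Mq + incidences r Tq Mn +
        (incidences r Tn Mq + incidences r Tn Mn) := by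
      have e1 : incidences r T M = incidences r Tq M + incidences r Tn M :=
        incidences_split_left r _ T M
      have e2 : incidences r Tq M = incidences r Tq Mq + incidences r Tq Mn :=
        incidences_split_right r _ Tq M
      have e3 : incidences r Tn M = incidences r Tn Mq + incidences r Tn Mn :=
        incidences_split_right r _ Tn M
      omega
    have h1 := incidences_le_of_prime hX hz hy k s hs hk q hq
      (fun m hm hm' => hchar m hm (by omega)) Tq Mq (fun i hi => (mem_filter.1 hi).2)
      (fun j hj => (mem_filter.1 hj).2)
    have h2 : incidences r Tq Mn ≤ q.totalDegree * Mn.card := by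
      refine incidences_le_right r Tq Mn _ ?_
      intro j hj
      exact card_meets_le_of_vLine_ne_zero (Tq.filter fun i => r i j) X Y z (β j) (α j) (y j)
        hz.injOn q (fun i hi => ⟨(mem_filter.1 (mem_filter.1 hi).1).2,
          (mem_filter.1 hi).2⟩) (mem_filter.1 hj).2
    have h3 : incidences r Tn Mq ≤ q.totalDegree * Tn.card := by
      refine incidences_le_left r Tn Mq _ ?_
      intro i hi
      exact card_meets_le_of_hLine_ne_zero (Mq.filter (r i)) β α y (X i) (Y i) (z i)
        hy.injOn q (fun j hj => ⟨(mem_filter.1 (mem_filter.1 hj).1).2,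
          (mem_filter.1 hj).2⟩) (mem_filter.1 hi).2
    have h4 := ih hQ0 (fun m hm hm' => hchar m hm (by omega)) Tn Mn (by
      intro i hi
      have h := hT i (mem_filter.1 hi).1
      rw [map_mul] at h
      exact (mul_eq_zero.1 h).resolve_left (mem_filter.1 hi).2)
    rw [hsplit, ← hcT, ← hcM]
    change incidences r Tq Mq ≤ _ at h1
    generalize q.totalDegree = d at *
    generalize Q.totalDegree = D at *
    generalize Tq.card = a at *
    generalize Tn.card = b at *
    generalize Mq.card = a' at *
    generalize Mn.card = b' at *
    have : 4 * (d + D) * (a' + b') + (k + (3 + s) * (d + D)) * (a + b) =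
      (3 * d * a' + (k + (2 + s) * d) * a) + d * b' + (d * b +
        (4 * D * b' + (k + (3 + s) * D) * b)) +
        (d * a' + 4 * D * a' + 3 * d * b' + d * a + (3 + s) * D * a + (2 + s) * d * b) := by ring
    omega

/-- An incidence bound for horizontal and vertical lines in three dimensions. -/
lemma incidences_lines_le (hX : ∀ i, X i ≠ 0) (hz : Function.Injective z)
    (hy : Function.Injective y) (k s : ℕ) (hs : 12 * k ≤ s ^ 2)
    (hk : ∀ i i', i ≠ i' → ∀ M : Finset J,
      (∀ j ∈ M, LineMeets X Y z β α y i j ∧ LineMeets X Y z β α y i' j) → M.card ≤ k)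
    (B : ℕ) (hB : 2 ≤ B) (hchar : ∀ m : ℕ, 0 < m → m < 3 * B → (m : K) ≠ 0)
    (L : Finset I) (M : Finset J) :
    incidences (LineMeets X Y z β α y) L M ≤
      (L.card / ((B ^ 2 - 1) / 2) + 1) * (12 * B * M.card) +
        (k + (3 + s) * (3 * B)) * L.card := by
  have hB2 : 4 ≤ B ^ 2 := by nlinarith
  apply incidences_le_of_pieces (LineMeets X Y z β α y) M ((B ^ 2 - 1) / 2)
  · intro T hT
    obtain ⟨Q, hQ0, hQd, hQ⟩ := exists_poly_vanishing_on_hLines T X Y z B (by omega)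
    have := incidences_le_of_vanishing hX hz hy k s hs hk Q hQ0
      (fun m hm hm' => hchar m hm (by omega)) T M hQ
    refine this.trans ?_
    have h1 : 4 * Q.totalDegree ≤ 12 * B := by omega
    have h2 : (3 + s) * Q.totalDegree ≤ (3 + s) * (3 * B) := Nat.mul_le_mul_left _ hQd.le
    gcongr
  · have : 0 < (B ^ 2 - 1) / 2 := by omega
    have := Nat.lt_div_mul_add (a := L.card) this
    rw [Nat.succ_mul]
    omega

end LineIncidence

section PlaneIncidence
open Polynomial

variable {F : Type*} [Field F]

lemma coeffs_of_horizontal_eq {c₁ s₁ b₁ c₂ s₂ b₂ : F} (hc₁ : c₁ ≠ 0) (hc₂ : c₂ ≠ 0)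
    (h : (C (b₁ * c₁) + C s₁ * X ^ 2 + X ^ 8) * (C c₂ + C s₂ * X + X ^ 4) =
      (C (b₂ * c₂) + C s₂ * X ^ 2 + X ^ 8) * (C c₁ + C s₁ * X + X ^ 4)) :
    c₁ = c₂ ∧ s₁ = s₂ ∧ b₁ = b₂ := by
  have h' : C (b₁ * c₁ * c₂ - b₂ * c₂ * c₁) + C (b₁ * c₁ * s₂ - b₂ * c₂ * s₁) * X +
      C (s₁ * c₂ - s₂ * c₁) * X ^ 2 + C (b₁ * c₁ - b₂ * c₂) * X ^ 4 + C (s₁ - s₂) * X ^ 6 +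
      C (c₂ - c₁) * X ^ 8 + C (s₂ - s₁) * X ^ 9 = 0 := by
    simp only [map_sub, map_mul] at h ⊢
    linear_combination h
  have h0 := congrArg (coeff · 0) h'
  have h8 := congrArg (coeff · 8) h'
  have h9 := congrArg (coeff · 9) h'
  simp [coeff_X, coeff_C, coeff_X_pow, -map_sub, -map_mul] at h0 h8 h9
  have e1 : c₁ = c₂ := by linear_combination -h8
  refine ⟨e1, by linear_combination -h9, ?_⟩
  subst e1
  have : (b₁ - b₂) * (c₁ * c₁) = 0 := by linear_combination h0
  have := (mul_eq_zero.1 this).resolve_right (mul_ne_zero hc₁ hc₁)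
  linear_combination this

lemma coeffs_of_vertical_eq {c₁ s₁ b₁ c₂ s₂ b₂ : F} (hc₁ : c₁ ≠ 0) (hc₂ : c₂ ≠ 0)
    (h : (C (b₁ * c₁) - C s₁ * X ^ 4 + X ^ 8) * (C c₂ + C s₂ * X - X ^ 2) =
      (C (b₂ * c₂) - C s₂ * X ^ 4 + X ^ 8) * (C c₁ + C s₁ * X - X ^ 2)) :
    c₁ = c₂ ∧ s₁ = s₂ ∧ b₁ = b₂ := by
  have h' : C (b₁ * c₁ * c₂ - b₂ * c₂ * c₁) + C (b₁ * c₁ * s₂ - b₂ * c₂ * s₁) * X +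
      C (b₂ * c₂ - b₁ * c₁) * X ^ 2 + C (s₂ * c₁ - s₁ * c₂) * X ^ 4 + C (s₁ - s₂) * X ^ 6 +
      C (c₂ - c₁) * X ^ 8 + C (s₂ - s₁) * X ^ 9 = 0 := by
    simp only [map_sub, map_mul] at h ⊢
    linear_combination h
  have h0 := congrArg (coeff · 0) h'
  have h8 := congrArg (coeff · 8) h'
  have h9 := congrArg (coeff · 9) h'
  simp [coeff_X, coeff_C, coeff_X_pow, -map_sub, -map_mul] at h0 h8 h9
  have e1 : c₁ = c₂ := by linear_combination -h8
  refine ⟨e1, by linear_combination -h9, ?_⟩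
  subst e1
  have : (b₁ - b₂) * (c₁ * c₁) = 0 := by linear_combination h0
  have := (mul_eq_zero.1 this).resolve_right (mul_ne_zero hc₁ hc₁)
  linear_combination this

lemma horizontal_denom_ne_zero (c s : F) : C c + C s * X + X ^ 4 ≠ 0 := by
  intro h
  have := congrArg (coeff · 4) h
  simp [coeff_X_pow] at this

lemma vertical_denom_ne_zero (c s : F) : C c + C s * X - X ^ 2 ≠ 0 := by
  intro h
  have := congrArg (coeff · 2) h
  simp [coeff_X_pow] at this

/-- The relation `(s - b) c = (s' - b') c'` between triples `(c', s, b')` and `(c, s', b)`. -/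
def PlaneRel (u v : F × F × F) : Prop := (u.2.1 - v.2.2) * v.1 = (v.2.1 - u.2.2) * u.1

instance [DecidableEq F] (u v : F × F × F) : Decidable (PlaneRel u v) :=
  inferInstanceAs (Decidable (_ = _))

lemma card_le_of_two_planeRel [DecidableEq F] (D P A : Finset F) (hD : (0 : F) ∉ D) {u u' : F × F × F}
    (hu : u.1 ≠ 0) (huu : u ≠ u') (M : Finset (F × F × F)) (hM : M ⊆ D ×ˢ P ×ˢ A)
    (h : ∀ v ∈ M, PlaneRel u v ∧ PlaneRel u' v) : M.card ≤ P.card + D.card := by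
  obtain ⟨c, s, b⟩ := u
  obtain ⟨c', s', b'⟩ := u'
  simp only [PlaneRel, Prod.forall] at h
  simp only [ne_eq] at hu
  have hne : ∀ v ∈ M, v.1 ≠ 0 := by
    intro v hv h0
    have := (mem_product.1 (hM hv)).1
    rw [h0] at this
    exact hD this
  by_cases hs : s = s'
  · subst hs
    by_cases hc : c = c'
    · subst hc
      have : M = ∅ := by
        rw [eq_empty_iff_forall_notMem]
        rintro ⟨x, y, w⟩ hv
        obtain ⟨h1, h2⟩ := h x y w hv
        apply huu
        have : (b' - b) * c = 0 := by linear_combination h2 - h1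
        have := (mul_eq_zero.1 this).resolve_right hu
        have : b = b' := by linear_combination -this
        rw [this]
      simp [this]
    · refine (card_le_card_of_injOn (t := D) (fun v => v.1) ?_ ?_).trans (Nat.le_add_left _ _)
      · intro v hv
        exact (mem_product.1 (hM hv)).1
      · rintro ⟨x, y, w⟩ hv ⟨x', y', w'⟩ hv' hxx
        simp only at hxx
        subst hxx
        obtain ⟨h1, h2⟩ := h x y w hv
        obtain ⟨h3, h4⟩ := h x y' w' hv'
        have e1 : (y - y') * (c - c') = 0 := by linear_combination -h1 + h2 + h3 - h4
        have e2 : y - y' = 0 := (mul_eq_zero.1 e1).resolve_right (sub_ne_zero.2 hc)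
        have e3 : (w - w') * x = 0 := by linear_combination h3 - h1 - e2 * c
        have e4 := (mul_eq_zero.1 e3).resolve_right (hne _ hv)
        rw [sub_eq_zero.1 e2, sub_eq_zero.1 e4]
  · refine (card_le_card_of_injOn (t := P) (fun v => v.2.1) ?_ ?_).trans (Nat.le_add_right _ _)
    · intro v hv
      exact (mem_product.1 (mem_product.1 (hM hv)).2).1
    · rintro ⟨x, y, w⟩ hv ⟨x', y', w'⟩ hv' hyy
      simp only at hyy
      subst hyy
      obtain ⟨h1, h2⟩ := h x y w hv
      obtain ⟨h3, h4⟩ := h x' y w' hv'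
      have e1 : (x - x') * (s - s') = 0 := by linear_combination h1 - h2 - h3 + h4
      have e2 : x - x' = 0 := (mul_eq_zero.1 e1).resolve_right (sub_ne_zero.2 hs)
      have e3 : (w - w') * x = 0 := by linear_combination h3 - h1 + e2 * (s - w')
      have e4 := (mul_eq_zero.1 e3).resolve_right (hne _ hv)
      rw [sub_eq_zero.1 e2, sub_eq_zero.1 e4]

variable {K : Type*} [Field K]

lemma lineMeets_iff {D : Finset (F × F × F)} (φ : F[X] →+* K) (hφ : Function.Injective φ)
    (i j : D) :
    LineMeets (fun i : D => φ (C i.1.1 + C i.1.2.1 * X + X ^ 4)) (fun i : D => φ (C i.1.2.1))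
      (fun i : D => φ (C (i.1.2.2 * i.1.1) + C i.1.2.1 * X ^ 2 + X ^ 8) /
        φ (C i.1.1 + C i.1.2.1 * X + X ^ 4))
      (fun j : D => φ (C j.1.1 + C j.1.2.1 * X - X ^ 2)) (fun j : D => φ (C j.1.2.1))
      (fun j : D => φ (C (j.1.2.2 * j.1.1) - C j.1.2.1 * X ^ 4 + X ^ 8) /
        φ (C j.1.1 + C j.1.2.1 * X - X ^ 2)) i j ↔ PlaneRel i.1 j.1 := by
  obtain ⟨⟨c', s, b'⟩, hi⟩ := i
  obtain ⟨⟨c, s', b⟩, hj⟩ := j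
  simp only [LineMeets, Meets, PlaneRel]
  have hX : φ (C c' + C s * X + X ^ 4) ≠ 0 :=
    (map_ne_zero_iff φ hφ).2 (horizontal_denom_ne_zero c' s)
  have hβ : φ (C c + C s' * X - X ^ 2) ≠ 0 :=
    (map_ne_zero_iff φ hφ).2 (vertical_denom_ne_zero c s')
  have key : ∀ a b : F, φ (C a) = φ (C b) ↔ a = b := fun a b =>
    ⟨fun h => C_injective (hφ h), fun h => by rw [h]⟩
  rw [← key]
  simp only [map_add, map_sub, map_mul, map_pow] at hX hβ ⊢
  generalize φ (C c') = c' at *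
  generalize φ (C c) = c at *
  generalize φ (C s') = s' at *
  generalize φ (C s) = s at *
  generalize φ (C b') = b' at *
  generalize φ (C b) = b at *
  generalize φ X = x at *
  constructor
  · rintro ⟨t, h1, h2⟩
    rw [div_eq_iff hX] at h1
    rw [div_eq_iff hβ] at h2
    linear_combination h1 - h2
  · intro h
    generalize hv : c' + s * x + x ^ 4 = v at *
    generalize hw : c + s' * x - x ^ 2 = w at *
    refine ⟨((b * c - s' * x ^ 4 + x ^ 8) / w - s) / v, ?_, ?_⟩
    · field_simp
      rw [← hv, ← hw]
      linear_combination h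
    · field_simp
      ring

/-- The number of solutions of `(s - b) c = (s' - b') c'` is small in prime fields. -/
lemma card_planeRel_le {p : ℕ} [Fact p.Prime] (D P A : Finset (ZMod p)) (hD : (0 : ZMod p) ∉ D)
    (s B : ℕ) (hs : 12 * (P.card + D.card) ≤ s ^ 2) (hB : 2 ≤ B) (hBp : 3 * B ≤ p) (N : ℕ)
    (hN : N = D.card * (P.card * A.card)) :
    (((D ×ˢ P ×ˢ A) ×ˢ (D ×ˢ P ×ˢ A)).filter fun x => PlaneRel x.1 x.2).card ≤
      (N / ((B ^ 2 - 1) / 2) + 1) * (12 * B * N) +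
        ((P.card + D.card) + (3 + s) * (3 * B)) * N := by
  classical
  set S := D ×ˢ P ×ˢ A with hS
  have hNS : N = S.card := by rw [hN, hS, card_product, card_product]
  let φ : (ZMod p)[X] →+* FractionRing (ZMod p)[X] := algebraMap _ _
  have hφ : Function.Injective φ := IsFractionRing.injective _ _
  have hne : ∀ i : S, i.1.1 ≠ 0 := by
    intro i h0
    have := (mem_product.1 i.2).1
    rw [h0] at this
    exact hD this
  have hX : ∀ i : S, φ (C i.1.1 + C i.1.2.1 * X + X ^ 4) ≠ 0 := fun i =>
    (map_ne_zero_iff φ hφ).2 (horizontal_denom_ne_zero _ _)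
  have hβ : ∀ i : S, φ (C i.1.1 + C i.1.2.1 * X - X ^ 2) ≠ 0 := fun i =>
    (map_ne_zero_iff φ hφ).2 (vertical_denom_ne_zero _ _)
  have hz : Function.Injective fun i : S =>
      φ (C (i.1.2.2 * i.1.1) + C i.1.2.1 * X ^ 2 + X ^ 8) /
        φ (C i.1.1 + C i.1.2.1 * X + X ^ 4) := by
    intro i j h
    simp only at h
    rw [div_eq_div_iff (hX i) (hX j), ← map_mul, ← map_mul] at h
    obtain ⟨h1, h2, h3⟩ := coeffs_of_horizontal_eq (hne i) (hne j) (hφ h)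
    exact Subtype.ext (Prod.ext h1 (Prod.ext h2 h3))
  have hy : Function.Injective fun j : S =>
      φ (C (j.1.2.2 * j.1.1) - C j.1.2.1 * X ^ 4 + X ^ 8) /
        φ (C j.1.1 + C j.1.2.1 * X - X ^ 2) := by
    intro i j h
    simp only at h
    rw [div_eq_div_iff (hβ i) (hβ j), ← map_mul, ← map_mul] at h
    obtain ⟨h1, h2, h3⟩ := coeffs_of_vertical_eq (hne i) (hne j) (hφ h)
    exact Subtype.ext (Prod.ext h1 (Prod.ext h2 h3))
  have hchar : ∀ m : ℕ, 0 < m → m < 3 * B → (m : FractionRing (ZMod p)[X]) ≠ 0 := by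
    intro m hm hmB h
    have h1 : φ (C (m : ZMod p)) = 0 := by simpa using h
    rw [map_eq_zero_iff φ hφ, C_eq_zero, ZMod.natCast_eq_zero_iff] at h1
    have := Nat.le_of_dvd hm h1
    omega
  have hmain := incidences_lines_le (Y := fun i : S => φ (C i.1.2.1))
    (α := fun j : S => φ (C j.1.2.1)) hX hz hy (P.card + D.card) s hs (by
      intro i i' hii M hM
      have := card_le_of_two_planeRel D P A hD (hne i) (fun h => hii (Subtype.ext h))
        (M.map (Function.Embedding.subtype _)) (by
          intro v hv
          obtain ⟨w, -, rfl⟩ := mem_map.1 hv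
          exact w.2) (by
          intro v hv
          obtain ⟨w, hw, rfl⟩ := mem_map.1 hv
          exact ⟨(lineMeets_iff φ hφ i w).1 (hM w hw).1, (lineMeets_iff φ hφ i' w).1 (hM w hw).2⟩)
      rwa [card_map] at this) B hB hchar S.attach S.attach
  rw [card_attach, ← hNS] at hmain
  refine le_trans (le_of_eq ?_) hmain
  rw [incidences_eq_sum]
  simp only [lineMeets_iff φ hφ, card_filter]
  rw [sum_product, ← sum_attach S]
  refine sum_congr rfl fun i _ => ?_
  rw [← sum_attach S]

end PlaneIncidence

section Decomposition

variable {p : ℕ}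

/-- Number of representations of `x` as a sum of two elements of `A`. -/
def sumRep (A : Finset (ZMod p)) (x : ZMod p) : ℕ :=
  ((A ×ˢ A).filter fun u => u.1 + u.2 = x).card

lemma sumRep_le_card (A : Finset (ZMod p)) (x : ZMod p) : sumRep A x ≤ A.card := by
  refine card_le_card_of_injOn (fun u => u.1) (fun u hu => (mem_product.1 (mem_filter.1 hu).1).1) ?_
  rintro ⟨a, b⟩ hu ⟨a', b'⟩ hu' h
  have h1 := (mem_filter.1 hu).2
  have h2 := (mem_filter.1 hu').2
  simp only at h h1 h2
  subst h
  rw [add_left_cancel (h1.trans h2.symm)]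

lemma addE_le_sum_sumRep {A B : Finset (ZMod p)} (hBA : B ⊆ A) :
    addE B ≤ ∑ u ∈ B ×ˢ B, sumRep A (u.1 + u.2) := by
  have h1 : addE B ≤ ((B ×ˢ B) ×ˢ (A ×ˢ A) |>.filter
      fun x => x.2.1 + x.2.2 = x.1.1 + x.1.2).card := by
    refine card_le_card_of_injOn (fun x => ((x.1, x.2.1), (x.2.2.1, x.2.2.2))) ?_ ?_
    · rintro ⟨a, b, c, d⟩ hx
      simp only [mem_coe, mem_filter, mem_product] at hx ⊢
      obtain ⟨⟨ha, hb, hc, hd⟩, h⟩ := hx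
      exact ⟨⟨⟨ha, hb⟩, hBA hc, hBA hd⟩, h.symm⟩
    · rintro ⟨a, b, c, d⟩ _ ⟨a', b', c', d'⟩ _ h
      simp only [Prod.mk.injEq] at h ⊢
      tauto
  refine h1.trans (le_of_eq ?_)
  simp only [sumRep, card_filter]
  rw [sum_product]

variable [NeZero p]

/-- The popular sums of `A`. -/
def popularSums (A : Finset (ZMod p)) (m : ℕ) : Finset (ZMod p) :=
  univ.filter fun x => A.card ≤ 2 * m * sumRep A x

/-- The elements of `A` that take part in many popular sums. -/
def popularPart (A : Finset (ZMod p)) (m : ℕ) : Finset (ZMod p) :=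
  A.filter fun a => A.card ≤ 4 * m * (A.filter fun b => a + b ∈ popularSums A m).card

lemma card_popularSums_le (A : Finset (ZMod p)) (m : ℕ) (hA : 0 < A.card) :
    (popularSums A m).card ≤ 2 * m * A.card := by
  have h1 : ∑ x ∈ popularSums A m, sumRep A x ≤ A.card ^ 2 := by
    rw [pow_two, ← card_product]
    rw [card_eq_sum_card_fiberwise (f := fun u : ZMod p × ZMod p => u.1 + u.2) (t := univ)
      (fun _ _ => by simp)]
    exact sum_le_sum_of_subset (subset_univ _)
  have h2 : (popularSums A m).card * A.card ≤ ∑ x ∈ popularSums A m, 2 * m * sumRep A x := by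
    rw [← smul_eq_mul]
    exact card_nsmul_le_sum _ _ _ fun x hx => (mem_filter.1 hx).2
  rw [← mul_sum] at h2
  have h3 : (popularSums A m).card * A.card ≤ 2 * m * A.card * A.card :=
    h2.trans ((Nat.mul_le_mul_left _ h1).trans (le_of_eq (by ring)))
  exact Nat.le_of_mul_le_mul_right h3 hA

lemma addE_sdiff_popularPart_le (A : Finset (ZMod p)) (m : ℕ) :
    4 * m * addE (A \ popularPart A m) ≤ 3 * A.card ^ 3 := by
  classical
  set B := A \ popularPart A m with hB
  have hBA : B ⊆ A := sdiff_subset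
  have hBc : B.card ≤ A.card := card_le_card hBA
  set P := popularSums A m with hP
  have h1 := addE_le_sum_sumRep hBA
  have h2 : ∀ u ∈ B ×ˢ B, 4 * m * sumRep A (u.1 + u.2) ≤
      2 * A.card + 4 * m * A.card * (if u.1 + u.2 ∈ P then 1 else 0) := by
    intro u _
    split_ifs with h
    · have := Nat.mul_le_mul_left (4 * m) (sumRep_le_card A (u.1 + u.2))
      omega
    · have h3 : ¬ A.card ≤ 2 * m * sumRep A (u.1 + u.2) := fun h4 =>
        h (mem_filter.2 ⟨mem_univ _, h4⟩)
      have : 4 * m * sumRep A (u.1 + u.2) = 2 * (2 * m * sumRep A (u.1 + u.2)) := by ring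
      omega
  have h3 : ∀ a ∈ B, 4 * m * ∑ b ∈ B, (if a + b ∈ P then 1 else 0) ≤ A.card := by
    intro a ha
    rw [← card_filter]
    have ha1 := mem_sdiff.1 ha
    have h4 : ¬ A.card ≤ 4 * m * (A.filter fun b => a + b ∈ P).card := fun h5 =>
      ha1.2 (mem_filter.2 ⟨ha1.1, h5⟩)
    have h5 : (B.filter fun b => a + b ∈ P).card ≤ (A.filter fun b => a + b ∈ P).card :=
      card_le_card (filter_subset_filter _ hBA)
    have := Nat.mul_le_mul_left (4 * m) h5
    omega
  have h4 : 4 * m * ∑ u ∈ B ×ˢ B, (if u.1 + u.2 ∈ P then 1 else 0) ≤ A.card * A.card := by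
    rw [sum_product, mul_sum]
    calc _ ≤ ∑ a ∈ B, A.card := sum_le_sum h3
      _ ≤ A.card * A.card := by
        rw [sum_const, smul_eq_mul]
        exact Nat.mul_le_mul_right _ hBc
  calc 4 * m * addE B ≤ 4 * m * ∑ u ∈ B ×ˢ B, sumRep A (u.1 + u.2) := Nat.mul_le_mul_left _ h1
    _ ≤ ∑ u ∈ B ×ˢ B, (2 * A.card + 4 * m * A.card * (if u.1 + u.2 ∈ P then 1 else 0)) := by
        rw [mul_sum]
        exact sum_le_sum h2
    _ = B.card * B.card * (2 * A.card) +
        A.card * (4 * m * ∑ u ∈ B ×ˢ B, (if u.1 + u.2 ∈ P then 1 else 0)) := by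
        rw [sum_add_distrib, sum_const, card_product, smul_eq_mul, ← mul_sum]
        ring
    _ ≤ A.card * A.card * (2 * A.card) + A.card * (A.card * A.card) := by gcongr
    _ = 3 * A.card ^ 3 := by ring

lemma mulE_le_mulE_erase_zero {p : ℕ} [Fact p.Prime] (C : Finset (ZMod p)) :
    mulE C ≤ mulE (C.erase 0) + 4 * C.card ^ 2 := by
  classical
  unfold mulE
  set Z : Finset (ZMod p) := {0} with hZ
  have hcov : ((C ×ˢ C ×ˢ C ×ˢ C).filter fun x => x.1 * x.2.1 = x.2.2.1 * x.2.2.2) ⊆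
      (((C.erase 0) ×ˢ (C.erase 0) ×ˢ (C.erase 0) ×ˢ (C.erase 0)).filter
        fun x => x.1 * x.2.1 = x.2.2.1 * x.2.2.2) ∪
      ((Z ×ˢ C ×ˢ Z ×ˢ C) ∪ (Z ×ˢ C ×ˢ C ×ˢ Z) ∪ ((C ×ˢ Z ×ˢ Z ×ˢ C) ∪ (C ×ˢ Z ×ˢ C ×ˢ Z))) := by
    rintro ⟨a, b, c, d⟩ hx
    simp only [mem_filter, mem_product, mem_union, mem_erase, hZ, mem_singleton] at hx ⊢
    obtain ⟨⟨ha, hb, hc, hd⟩, h⟩ := hx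
    have e1 : a * b = 0 ↔ a = 0 ∨ b = 0 := mul_eq_zero
    have e2 : c * d = 0 ↔ c = 0 ∨ d = 0 := mul_eq_zero
    by_cases hab : a = 0 ∨ b = 0
    · have hcd : c = 0 ∨ d = 0 := e2.1 (h ▸ e1.2 hab)
      right
      rcases hab with rfl | rfl <;> rcases hcd with rfl | rfl <;> simp [*]
    · have hcd : ¬ (c = 0 ∨ d = 0) := fun hcd => hab (e1.1 (h.trans (e2.2 hcd)))
      rw [not_or] at hab hcd
      exact Or.inl ⟨⟨⟨hab.1, ha⟩, ⟨hab.2, hb⟩, ⟨hcd.1, hc⟩, hcd.2, hd⟩, h⟩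
  refine (card_le_card hcov).trans ?_
  refine (card_union_le _ _).trans ?_
  gcongr
  refine (card_union_le _ _).trans ?_
  have h1 := card_union_le (Z ×ˢ C ×ˢ Z ×ˢ C) (Z ×ˢ C ×ˢ C ×ˢ Z)
  have h2 := card_union_le (C ×ˢ Z ×ˢ Z ×ˢ C) (C ×ˢ Z ×ˢ C ×ˢ Z)
  simp only [card_product, hZ, card_singleton, one_mul, mul_one] at h1 h2 ⊢
  nlinarith

lemma sq_mul_mulE_le {p : ℕ} [Fact p.Prime] (A D P : Finset (ZMod p)) (t n : ℕ)
    (hD : ∀ a ∈ D, n ≤ t * (A.filter fun b => a + b ∈ P).card) :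
    n ^ 2 * mulE D ≤ t ^ 2 *
      (((D ×ˢ P ×ˢ A) ×ˢ (D ×ˢ P ×ˢ A)).filter fun x => PlaneRel x.1 x.2).card := by
  classical
  set W := ((D ×ˢ P ×ˢ A) ×ˢ (D ×ˢ P ×ˢ A)).filter fun x => PlaneRel x.1 x.2 with hW
  set Q := (D ×ˢ D ×ˢ D ×ˢ D).filter fun x => x.1 * x.2.1 = x.2.2.1 * x.2.2.2 with hQ
  let f : (ZMod p × ZMod p × ZMod p) × (ZMod p × ZMod p × ZMod p) →
      ZMod p × ZMod p × ZMod p × ZMod p := fun w =>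
    (w.1.2.1 - w.2.2.2, w.2.1, w.2.2.1 - w.1.2.2, w.1.1)
  have h1 : ∑ q ∈ Q, (W.filter fun w => f w = q).card ≤ W.card := by
    have h2 := card_eq_sum_card_fiberwise (s := W.filter fun w => f w ∈ Q) (f := f) (t := Q)
      (fun w hw => (mem_filter.1 hw).2)
    calc _ ≤ ∑ q ∈ Q, ((W.filter fun w => f w ∈ Q).filter fun w => f w = q).card := by
          refine sum_le_sum fun q hq => card_le_card ?_
          intro w hw
          simp only [mem_filter] at hw ⊢
          exact ⟨⟨hw.1, hw.2 ▸ hq⟩, hw.2⟩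
      _ = _ := h2.symm
      _ ≤ _ := card_filter_le _ _
  have h3 : ∀ q ∈ Q, n ^ 2 ≤ t ^ 2 * (W.filter fun w => f w = q).card := by
    rintro ⟨c₁, c₂, c₃, c₄⟩ hq
    simp only [hQ, mem_filter, mem_product] at hq
    obtain ⟨⟨hc₁, hc₂, hc₃, hc₄⟩, hmul⟩ := hq
    have h4 : ((A.filter fun b => c₁ + b ∈ P) ×ˢ (A.filter fun b => c₃ + b ∈ P)).card ≤
        (W.filter fun w => f w = (c₁, c₂, c₃, c₄)).card := by
      refine card_le_card_of_injOn (fun u => ((c₄, c₁ + u.1, u.2), (c₂, c₃ + u.2, u.1))) ?_ ?_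
      · rintro ⟨b, b'⟩ hu
        simp only [mem_coe, mem_filter, mem_product] at hu
        rw [mem_coe, mem_filter, hW, mem_filter]
        simp only [mem_product]
        refine ⟨⟨⟨⟨hc₄, hu.1.2, hu.2.1⟩, hc₂, hu.2.2, hu.1.1⟩, ?_⟩, ?_⟩
        · simp only [PlaneRel]
          linear_combination hmul
        · simp [f]
      · rintro ⟨b, b'⟩ _ ⟨d, d'⟩ _ h
        simp only [Prod.mk.injEq] at h ⊢
        exact ⟨h.2.2.2, h.1.2.2⟩
    rw [card_product] at h4
    calc n ^ 2 = n * n := pow_two n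
      _ ≤ _ := Nat.mul_le_mul (hD c₁ hc₁) (hD c₃ hc₃)
      _ = t ^ 2 * ((A.filter fun b => c₁ + b ∈ P).card * (A.filter fun b => c₃ + b ∈ P).card) := by
        ring
      _ ≤ _ := Nat.mul_le_mul_left _ h4
  calc n ^ 2 * mulE D = ∑ q ∈ Q, n ^ 2 := by
        rw [sum_const, smul_eq_mul, mul_comm]; rfl
    _ ≤ ∑ q ∈ Q, t ^ 2 * (W.filter fun w => f w = q).card := sum_le_sum h3
    _ ≤ _ := by
        rw [← mul_sum]
        exact Nat.mul_le_mul_left _ h1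

lemma mulE_popularPart_le {p : ℕ} [Fact p.Prime] (A : Finset (ZMod p)) (m s B : ℕ)
    (hs : 12 * ((popularSums A m).card + A.card) ≤ s ^ 2) (hB : 2 ≤ B) (hBp : 3 * B ≤ p) (N : ℕ)
    (hN : N = A.card * ((popularSums A m).card * A.card)) :
    A.card ^ 2 * mulE (popularPart A m) ≤ 16 * m ^ 2 * ((N / ((B ^ 2 - 1) / 2) + 1) * (12 * B * N) +
        (((popularSums A m).card + A.card) + (3 + s) * (3 * B)) * N) + 4 * A.card ^ 4 := by
  set D := (popularPart A m).erase 0 with hD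
  set P := popularSums A m with hP
  have hCA : (popularPart A m).card ≤ A.card := card_filter_le _ _
  have hDA : D.card ≤ A.card := (card_le_card (erase_subset _ _)).trans hCA
  have h1 := mulE_le_mulE_erase_zero (popularPart A m)
  have h2 := sq_mul_mulE_le A D P (4 * m) A.card
    (fun a ha => (mem_filter.1 (mem_of_mem_erase ha)).2)
  have h3 := card_planeRel_le D P A (notMem_erase _ _) s B (by omega) hB hBp _ rfl
  have hNN : D.card * (P.card * A.card) ≤ N := hN ▸ Nat.mul_le_mul_right _ hDA
  have h4 : (D.card * (P.card * A.card) / ((B ^ 2 - 1) / 2) + 1) *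
      (12 * B * (D.card * (P.card * A.card))) +
        ((P.card + D.card) + (3 + s) * (3 * B)) * (D.card * (P.card * A.card)) ≤
      (N / ((B ^ 2 - 1) / 2) + 1) * (12 * B * N) + ((P.card + A.card) + (3 + s) * (3 * B)) * N := by
    gcongr
  calc A.card ^ 2 * mulE (popularPart A m)
      ≤ A.card ^ 2 * (mulE D + 4 * (popularPart A m).card ^ 2) := Nat.mul_le_mul_left _ h1
    _ = A.card ^ 2 * mulE D + 4 * (A.card ^ 2 * (popularPart A m).card ^ 2) := by ring
    _ ≤ (4 * m) ^ 2 * ((N / ((B ^ 2 - 1) / 2) + 1) * (12 * B * N) +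
        ((P.card + A.card) + (3 + s) * (3 * B)) * N) + 4 * (A.card ^ 2 * A.card ^ 2) := by
        refine Nat.add_le_add (h2.trans (Nat.mul_le_mul_left _ (h3.trans h4))) ?_
        gcongr
    _ = _ := by ring

end Decomposition

section Numerics

/-- The polynomial bookkeeping behind the multiplicative energy bound. -/
lemma energy_numerics (v : ℝ) (hv : 1 ≤ v) (n m s B N P : ℕ) (hn : (n : ℝ) = v ^ 20)
    (hm : (m : ℝ) ≤ 2 * v) (hP : P ≤ 2 * m * n) (hs : (s : ℝ) ≤ 9 * v ^ 11)
    (hB : v ^ 25 ≤ B) (hB' : (B : ℝ) ≤ 2 * v ^ 25) (hB2 : 2 ≤ B) (hN : N = n * (P * n)) (E : ℕ)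
    (hE : n ^ 2 * E ≤ 16 * m ^ 2 * ((N / ((B ^ 2 - 1) / 2) + 1) * (12 * B * N) +
        ((P + n) + (3 + s) * (3 * B)) * N) + 4 * n ^ 4) :
    (E : ℝ) ≤ 100000 * v ^ 59 := by
  have hv0 : 0 < v := by linarith
  have pw : ∀ a b : ℕ, a ≤ b → v ^ a ≤ v ^ b := fun a b h => pow_le_pow_right₀ hv h
  have hP' : (P : ℝ) ≤ 4 * v ^ 21 := by
    have : (P : ℝ) ≤ 2 * m * n := by exact_mod_cast hP
    rw [hn] at this
    calc (P : ℝ) ≤ 2 * m * v ^ 20 := this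
      _ ≤ 2 * (2 * v) * v ^ 20 := by gcongr
      _ = _ := by ring
  have hN' : (N : ℝ) ≤ 4 * v ^ 61 := by
    rw [hN]
    push_cast
    rw [hn]
    calc v ^ 20 * (P * v ^ 20) ≤ v ^ 20 * (4 * v ^ 21 * v ^ 20) := by gcongr
      _ = _ := by ring
  have hq : ((N / ((B ^ 2 - 1) / 2) : ℕ) : ℝ) ≤ 4 * N / (B : ℝ) ^ 2 := by
    refine Nat.cast_div_le.trans ?_
    have hBB : 4 ≤ B ^ 2 := by nlinarith
    have h1 : B ^ 2 ≤ 4 * ((B ^ 2 - 1) / 2) := by omega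
    have h2 : (B : ℝ) ^ 2 ≤ 4 * (((B ^ 2 - 1) / 2 : ℕ) : ℝ) := by exact_mod_cast h1
    have h3 : (0 : ℝ) < (B : ℝ) ^ 2 := by positivity
    rw [div_le_div_iff₀ (by linarith) h3]
    nlinarith [Nat.cast_nonneg (α := ℝ) N]
  have hBpos : (0 : ℝ) < B := lt_of_lt_of_le (by positivity) hB
  have h1 : ((N / ((B ^ 2 - 1) / 2) : ℕ) : ℝ) * (12 * B * N) ≤ 768 * v ^ 97 := by
    calc ((N / ((B ^ 2 - 1) / 2) : ℕ) : ℝ) * (12 * B * N) ≤ 4 * N / (B : ℝ) ^ 2 * (12 * B * N) := by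
          gcongr
      _ = 48 * (N : ℝ) ^ 2 / B := by field_simp; ring
      _ ≤ 48 * (4 * v ^ 61) ^ 2 / v ^ 25 := by gcongr
      _ = 768 * v ^ 97 := by field_simp; ring
  have h2 : (12 * B * N : ℝ) ≤ 96 * v ^ 97 := by
    calc (12 * B * N : ℝ) ≤ 12 * (2 * v ^ 25) * (4 * v ^ 61) := by gcongr
      _ = 96 * v ^ 86 := by ring
      _ ≤ 96 * v ^ 97 := by gcongr 96 * ?_; exact pw _ _ (by norm_num)
  have h3 : (((P + n) + (3 + s) * (3 * B)) * N : ℝ) ≤ 308 * v ^ 97 := by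
    have e1 : (P + n : ℝ) ≤ 5 * v ^ 36 := by
      have := pw 21 36 (by norm_num)
      have := pw 20 36 (by norm_num)
      rw [hn]; linarith
    have e2 : (3 + s : ℝ) ≤ 12 * v ^ 11 := by
      have := pw 0 11 (by norm_num)
      rw [pow_zero] at this
      linarith
    calc (((P + n) + (3 + s) * (3 * B)) * N : ℝ)
        ≤ ((5 * v ^ 36) + (12 * v ^ 11) * (3 * (2 * v ^ 25))) * (4 * v ^ 61) := by gcongr
      _ = 308 * v ^ 97 := by ring
  have h4 : (n : ℝ) ^ 2 * E ≤ 16 * (m : ℝ) ^ 2 *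
      ((((N / ((B ^ 2 - 1) / 2) : ℕ) : ℝ) + 1) * (12 * B * N) +
        ((P + n) + (3 + s) * (3 * B)) * N) + 4 * (n : ℝ) ^ 4 := by
    exact_mod_cast hE
  have h5 : v ^ 40 * E ≤ v ^ 40 * (100000 * v ^ 59) := by
    calc v ^ 40 * E = (n : ℝ) ^ 2 * E := by rw [hn]; ring
      _ ≤ _ := h4
      _ ≤ 16 * (2 * v) ^ 2 * (768 * v ^ 97 + 96 * v ^ 97 + 308 * v ^ 97) + 4 * v ^ 99 := by
          have e1 : (n : ℝ) ^ 4 ≤ v ^ 99 := by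
            rw [hn, ← pow_mul]; exact pw _ _ (by norm_num)
          have e2 : (((N / ((B ^ 2 - 1) / 2) : ℕ) : ℝ) + 1) * (12 * B * N) +
              ((P + n) + (3 + s) * (3 * B)) * N ≤
              768 * v ^ 97 + 96 * v ^ 97 + 308 * v ^ 97 := by
            rw [add_mul, one_mul]
            linarith
          gcongr
      _ = 75012 * v ^ 99 := by ring
      _ ≤ 100000 * v ^ 99 := by gcongr; norm_num
      _ = _ := by ring
  exact le_of_mul_le_mul_left h5 (by positivity)

/-- Sets in the range of the theorem are small enough for the degree argument. -/
lemma six_mul_rpow_le {p : ℕ} (hp : 600 ^ 7 ≤ p) (x : ℝ) (hx0 : 0 ≤ x)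
    (hx : x ≤ (p : ℝ) ^ ((101 : ℝ) / 161) * Real.log p ^ ((71 : ℝ) / 161)) :
    6 * x ^ ((5 : ℝ) / 4) ≤ p := by
  have hp' : (600 : ℝ) ^ 7 ≤ p := by exact_mod_cast hp
  have hp1 : (1 : ℝ) ≤ p := le_trans (by norm_num) hp'
  have hp0 : (0 : ℝ) < p := by linarith
  have hlog : Real.log p ≤ 10 * (p : ℝ) ^ ((1 : ℝ) / 10) := by
    have := Real.log_le_rpow_div hp0.le (by norm_num : (0 : ℝ) < 1 / 10)
    linarith
  have hlog0 : 0 ≤ Real.log p := Real.log_nonneg hp1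
  have h1 : Real.log p ^ ((71 : ℝ) / 161) ≤ 10 * (p : ℝ) ^ ((71 : ℝ) / 1610) := by
    calc Real.log p ^ ((71 : ℝ) / 161) ≤ (10 * (p : ℝ) ^ ((1 : ℝ) / 10)) ^ ((71 : ℝ) / 161) :=
          Real.rpow_le_rpow hlog0 hlog (by norm_num)
      _ = 10 ^ ((71 : ℝ) / 161) * (p : ℝ) ^ ((71 : ℝ) / 1610) := by
          rw [Real.mul_rpow (by norm_num) (by positivity), ← Real.rpow_mul hp0.le]
          norm_num
      _ ≤ 10 ^ (1 : ℝ) * (p : ℝ) ^ ((71 : ℝ) / 1610) := by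
          gcongr
          · norm_num
          · norm_num
      _ = _ := by rw [Real.rpow_one]
  have h2 : x ≤ 10 * (p : ℝ) ^ ((1081 : ℝ) / 1610) := by
    calc x ≤ _ := hx
      _ ≤ (p : ℝ) ^ ((101 : ℝ) / 161) * (10 * (p : ℝ) ^ ((71 : ℝ) / 1610)) := by gcongr
      _ = 10 * ((p : ℝ) ^ ((101 : ℝ) / 161) * (p : ℝ) ^ ((71 : ℝ) / 1610)) := by ring
      _ = _ := by rw [← Real.rpow_add hp0]; norm_num
  have h3 : (600 : ℝ) ≤ (p : ℝ) ^ ((1 : ℝ) / 7) := by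
    calc (600 : ℝ) = ((600 : ℝ) ^ 7) ^ ((1 : ℝ) / 7) := by
          rw [← Real.rpow_natCast, ← Real.rpow_mul (by norm_num)]; norm_num
      _ ≤ _ := Real.rpow_le_rpow (by norm_num) hp' (by norm_num)
  calc 6 * x ^ ((5 : ℝ) / 4) ≤ 6 * (10 * (p : ℝ) ^ ((1081 : ℝ) / 1610)) ^ ((5 : ℝ) / 4) := by gcongr
    _ = 6 * (10 ^ ((5 : ℝ) / 4) * (p : ℝ) ^ ((1081 : ℝ) / 1288)) := by
        rw [Real.mul_rpow (by norm_num) (by positivity), ← Real.rpow_mul hp0.le]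
        norm_num
    _ ≤ 6 * (10 ^ (2 : ℝ) * (p : ℝ) ^ ((6 : ℝ) / 7)) := by
        have e1 : (10 : ℝ) ^ ((5 : ℝ) / 4) ≤ 10 ^ (2 : ℝ) :=
          Real.rpow_le_rpow_of_exponent_le (by norm_num) (by norm_num)
        have e2 : (p : ℝ) ^ ((1081 : ℝ) / 1288) ≤ (p : ℝ) ^ ((6 : ℝ) / 7) :=
          Real.rpow_le_rpow_of_exponent_le hp1 (by norm_num)
        gcongr
    _ = 600 * (p : ℝ) ^ ((6 : ℝ) / 7) := by norm_num; ring
    _ ≤ (p : ℝ) ^ ((1 : ℝ) / 7) * (p : ℝ) ^ ((6 : ℝ) / 7) := by gcongr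
    _ = p := by rw [← Real.rpow_add hp0]; norm_num

/-- Absorbing the bound `x ^ (59 / 20)` into the logarithmic form. -/
lemma rpow_le_mul_log_rpow (x : ℝ) (hx : 2 ≤ x) :
    x ^ ((59 : ℝ) / 20) ≤
      2 * x ^ ((3 : ℝ) - 4 / 101) * Real.log x ^ ((1 : ℝ) - (4 / 101) / 2) := by
  have hlog : (1 / 2 : ℝ) ≤ Real.log x := by
    have := Real.log_le_log (by norm_num) hx
    have := Real.log_two_gt_d9
    linarith
  have h1 : (1 / 2 : ℝ) ≤ Real.log x ^ ((1 : ℝ) - (4 / 101) / 2) := by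
    calc (1 / 2 : ℝ) = (1 / 2 : ℝ) ^ (1 : ℝ) := (Real.rpow_one _).symm
      _ ≤ (1 / 2 : ℝ) ^ ((1 : ℝ) - (4 / 101) / 2) :=
          Real.rpow_le_rpow_of_exponent_ge (by norm_num) (by norm_num) (by norm_num)
      _ ≤ _ := Real.rpow_le_rpow (by norm_num) hlog (by norm_num)
  have h2 : x ^ ((59 : ℝ) / 20) ≤ x ^ ((3 : ℝ) - 4 / 101) :=
    Real.rpow_le_rpow_of_exponent_le (by linarith) (by norm_num)
  have h3 : 0 ≤ x ^ ((3 : ℝ) - 4 / 101) := by positivity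
  nlinarith

end Numerics

/-- Theorem 1.3, first part: low-energy decompositions in `𝔽_p` for
`|A| ≤ p^(101/161)·(log p)^(71/161)`, with `δ = 4/101`. -/
theorem low_energy_decomposition_Fp_small :
    ∃ K : ℝ, 0 < K ∧ ∃ p₀ : ℕ, ∀ p : ℕ, p.Prime → p₀ ≤ p →
      ∀ A : Finset (ZMod p), 2 ≤ A.card →
        (A.card : ℝ) ≤ (p : ℝ) ^ ((101 : ℝ) / 161) * Real.log p ^ ((71 : ℝ) / 161) →
        ∃ B C : Finset (ZMod p), Disjoint B C ∧ B ∪ C = A ∧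
          (max (addE B) (mulE C) : ℝ) ≤
            K * (A.card : ℝ) ^ ((3 : ℝ) - 4 / 101) *
              Real.log A.card ^ ((1 : ℝ) - (4 / 101) / 2) := by
  refine ⟨200000, by norm_num, 600 ^ 7, fun p hp hp₀ A hA hAp => ?_⟩
  have : Fact p.Prime := ⟨hp⟩
  obtain ⟨n, hn⟩ : ∃ n, A.card = n := ⟨_, rfl⟩
  rw [hn] at hA hAp ⊢
  have hx : (2 : ℝ) ≤ n := by exact_mod_cast hA
  have hx0 : (0 : ℝ) ≤ n := by linarith
  obtain ⟨v, hv⟩ : ∃ v : ℝ, (n : ℝ) ^ ((1 : ℝ) / 20) = v := ⟨_, rfl⟩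
  have hpow : ∀ k : ℕ, v ^ k = (n : ℝ) ^ ((k : ℝ) / 20) := by
    intro k
    rw [← hv, ← Real.rpow_natCast, ← Real.rpow_mul hx0]
    congr 1
    ring
  have hv1 : 1 ≤ v := hv ▸ Real.one_le_rpow (by linarith) (by norm_num)
  have hv0 : 0 < v := by linarith
  have hv20 : (n : ℝ) = v ^ 20 := by rw [hpow]; norm_num
  have hv25 : (n : ℝ) ^ ((5 : ℝ) / 4) = v ^ 25 := by rw [hpow]; norm_num
  have hpow_mono : ∀ a b : ℕ, a ≤ b → v ^ a ≤ v ^ b := fun a b h => pow_le_pow_right₀ hv1 h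
  have hceil : ∀ y : ℝ, 1 ≤ y → (⌈y⌉₊ : ℝ) ≤ 2 * y := fun y hy => by
    have := Nat.ceil_lt_add_one (show (0 : ℝ) ≤ y by linarith)
    linarith
  obtain ⟨m, hm⟩ : ∃ m, ⌈v⌉₊ = m := ⟨_, rfl⟩
  have hm1 : v ≤ m := hm ▸ Nat.le_ceil v
  have hm2 : (m : ℝ) ≤ 2 * v := hm ▸ hceil v hv1
  obtain ⟨B, hB⟩ : ∃ B, ⌈v ^ 25⌉₊ = B := ⟨_, rfl⟩
  have hB1 : v ^ 25 ≤ B := hB ▸ Nat.le_ceil _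
  have hB2 : (B : ℝ) ≤ 2 * v ^ 25 := hB ▸ hceil _ (one_le_pow₀ hv1)
  have hBge : 2 ≤ B := by
    have := hpow_mono 20 25 (by norm_num)
    have : (2 : ℝ) ≤ B := by linarith
    exact_mod_cast this
  have hBp : 3 * B ≤ p := by
    have := six_mul_rpow_le hp₀ n hx0 hAp
    rw [hv25] at this
    have : (3 * B : ℝ) ≤ p := by linarith
    exact_mod_cast this
  have hP := card_popularSums_le A m (by omega)
  rw [hn] at hP
  obtain ⟨P, hPdef⟩ : ∃ P, (popularSums A m).card = P := ⟨_, rfl⟩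
  rw [hPdef] at hP
  obtain ⟨s, hsdef⟩ : ∃ s, Nat.sqrt (12 * (P + n)) + 1 = s := ⟨_, rfl⟩
  have hs : 12 * (P + n) ≤ s ^ 2 := by
    have := Nat.lt_succ_sqrt (12 * (P + n))
    rw [Nat.succ_eq_add_one, hsdef] at this
    nlinarith
  have hs' : (s : ℝ) ≤ 9 * v ^ 11 := by
    have h1 : (Nat.sqrt (12 * (P + n)) : ℝ) ^ 2 ≤ 12 * (P + n) := by
      exact_mod_cast Nat.sqrt_le' (12 * (P + n))
    have h2 : (P : ℝ) ≤ 2 * m * n := by exact_mod_cast hP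
    have h3 : (P : ℝ) ≤ 4 * v ^ 22 := by
      rw [hv20] at h2
      calc (P : ℝ) ≤ 2 * m * v ^ 20 := h2
        _ ≤ 2 * (2 * v) * v ^ 20 := by gcongr
        _ = 4 * v ^ 21 := by ring
        _ ≤ 4 * v ^ 22 := by gcongr 4 * ?_; exact hpow_mono _ _ (by norm_num)
    have h4 := hpow_mono 20 22 (by norm_num)
    have h5 : (Nat.sqrt (12 * (P + n)) : ℝ) ^ 2 ≤ (8 * v ^ 11) ^ 2 := by
      rw [hv20] at h1
      calc _ ≤ _ := h1
        _ ≤ 64 * v ^ 22 := by linarith [pow_pos hv0 22]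
        _ = _ := by ring
    have h6 := abs_le_of_sq_le_sq h5 (by positivity)
    have h7 : 1 ≤ v ^ 11 := one_le_pow₀ hv1
    rw [← hsdef]
    push_cast
    rw [abs_of_nonneg (Nat.cast_nonneg _)] at h6
    linarith
  have hmul := mulE_popularPart_le A m s B (by rw [hPdef, hn]; exact hs) hBge hBp _ rfl
  rw [hPdef, hn] at hmul
  have hmul' := energy_numerics v hv1 n m s B _ P hv20 hm2 hP hs' hB1 hB2 hBge rfl _ hmul
  have hadd := addE_sdiff_popularPart_le A m
  rw [hn] at hadd
  have hadd' : (addE (A \ popularPart A m) : ℝ) ≤ v ^ 59 := by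
    have h1 : 4 * (m : ℝ) * addE (A \ popularPart A m) ≤ 3 * (n : ℝ) ^ 3 := by exact_mod_cast hadd
    have h2 : v * addE (A \ popularPart A m) ≤ m * addE (A \ popularPart A m) := by gcongr
    have h3 : v * addE (A \ popularPart A m) ≤ v * v ^ 59 := by
      have : (n : ℝ) ^ 3 = v * v ^ 59 := by rw [hv20]; ring
      have := pow_pos hv0 59
      nlinarith
    exact le_of_mul_le_mul_left h3 hv0
  have hfin : 100000 * v ^ 59 ≤ 200000 * (n : ℝ) ^ ((3 : ℝ) - 4 / 101) *
      Real.log n ^ ((1 : ℝ) - (4 / 101) / 2) := by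
    have := rpow_le_mul_log_rpow n hx
    have h59 : v ^ 59 = (n : ℝ) ^ ((59 : ℝ) / 20) := by rw [hpow]; norm_num
    rw [h59]
    linarith
  refine ⟨A \ popularPart A m, popularPart A m, sdiff_disjoint,
    sdiff_union_of_subset (filter_subset _ _), max_le ?_ ?_⟩
  · exact hadd'.trans (le_trans (by linarith [pow_pos hv0 59]) hfin)
  · exact hmul'.trans hfin
end

section
/- There exists an absolute constant K such that the following holds for every sufficiently large prime p. Set α = 101/161 and β = 71/161, and let A ⊆ 𝔽_p satisfy |A| ≥ p^α·(log p)^β. Then there exist disjoint subsets B and C of A with A = B ∪ C and max{E₊(B), E×(C)} ≤ K·|A|³·(|A|/p)^(1/15)·(log |A|)^(14/15). -/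
open Finset

section Collisions

variable {α β : Type*} [Fintype β] [DecidableEq β]

/-- The number of collisions of `f` on `T` is the sum of the squares of the sizes of its fibres. -/
theorem card_collisions (T : Finset α) (f : α → β) :
    #{u ∈ T ×ˢ T | f u.1 = f u.2} = ∑ s, #{u ∈ T | f u = s} ^ 2 := by
  rw [card_eq_sum_card_fiberwise (f := fun u => f u.1) (t := univ) (by simp)]
  refine sum_congr rfl fun s _ => ?_
  rw [sq, ← card_product]
  congr 1
  ext u
  simp only [mem_filter, mem_product]
  grind

theorem sum_card_fibres (T : Finset α) (f : α → β) : ∑ s, #{u ∈ T | f u = s} = #T :=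
  (card_eq_sum_card_fiberwise (t := univ) (by simp)).symm

/-- Cauchy–Schwarz lower bound for the number of collisions. -/
theorem sq_card_le_card_mul_collisions (T : Finset α) (f : α → β) :
    #T ^ 2 ≤ Fintype.card β * #{u ∈ T ×ˢ T | f u.1 = f u.2} := by
  rw [card_collisions, ← sum_card_fibres T f]
  exact sq_sum_le_card_mul_sum_sq

end Collisions

section Dilates

variable {F : Type*} [Field F] [DecidableEq F]

/-- The number of solutions in `D` of `(x - y) * l = z - w`. -/
def dilateEnergy (D : Finset F) (l : F) : ℕ :=
  #{u ∈ (D ×ˢ D) ×ˢ (D ×ˢ D) | (u.1.1 - u.1.2) * l = u.2.1 - u.2.2}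

/-- If every element of `C` is a difference of elements of `D` in at least `t` ways, then the
ratios represented by `C` have large dilate energy. -/
theorem sq_mul_card_ratio_le_dilateEnergy {C D : Finset F} {t : ℝ} (ht : 0 ≤ t)
    (hC : ∀ c ∈ C, t ≤ #{u ∈ D ×ˢ D | u.1 - u.2 = c}) (hC0 : 0 ∉ C) (l : F) :
    t ^ 2 * #{u ∈ C ×ˢ C | u.1 / u.2 = l} ≤ dilateEnergy D l := by
  set R : Finset (F × F) := {u ∈ C ×ˢ C | u.1 / u.2 = l} with hR
  have h : ∑ v ∈ R, #{u ∈ D ×ˢ D | u.1 - u.2 = v.2} * #{u ∈ D ×ˢ D | u.1 - u.2 = v.1} ≤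
      dilateEnergy D l := by
    simp only [← card_product]
    rw [← card_sigma, dilateEnergy]
    refine card_le_card_of_injOn (fun s => s.2) ?_ ?_
    · rintro ⟨⟨b, d⟩, ⟨x, y⟩, z, w⟩ hs
      simp only [hR, coe_sigma, Set.mem_sigma_iff, mem_coe, mem_filter, mem_product,
        coe_filter, Set.mem_ofPred_eq] at hs ⊢
      obtain ⟨⟨⟨hb, hd⟩, hl⟩, ⟨hxy, e1⟩, hzw, e2⟩ := hs
      have hd0 : d ≠ 0 := fun h => hC0 (h ▸ hd)
      refine ⟨⟨hxy, hzw⟩, ?_⟩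
      rw [e1, e2, ← hl]
      field_simp
    · rintro ⟨⟨b, d⟩, ⟨x, y⟩, z, w⟩ hs ⟨⟨b', d'⟩, ⟨x', y'⟩, z', w'⟩ hs' e
      simp only [coe_sigma, Set.mem_sigma_iff, mem_coe, mem_filter, mem_product] at hs hs'
      simp only [Prod.mk.injEq] at e
      grind
  have h' : ∑ v ∈ R, t ^ 2 ≤ ∑ v ∈ R,
      (#{u ∈ D ×ˢ D | u.1 - u.2 = v.2} * #{u ∈ D ×ˢ D | u.1 - u.2 = v.1} : ℝ) := by
    refine sum_le_sum fun v hv => ?_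
    simp only [hR, mem_filter, mem_product] at hv
    rw [sq]
    exact mul_le_mul (hC _ hv.1.2) (hC _ hv.1.1) ht (Nat.cast_nonneg _)
  rw [sum_const, nsmul_eq_mul, mul_comm] at h'
  exact h'.trans (mod_cast h)

variable [Fintype F]

theorem card_pow_four_le_dilateEnergy (D : Finset F) (l : F) :
    #D ^ 4 ≤ Fintype.card F * dilateEnergy D l := by
  have h := sq_card_le_card_mul_collisions (D ×ˢ D) fun u : F × F => u.1 * l + u.2
  have h4 : #(D ×ˢ D) ^ 2 = #D ^ 4 := by rw [card_product]; ring
  rw [h4] at h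
  refine h.trans (Nat.mul_le_mul_left _ ?_)
  refine card_le_card_of_injOn (fun u => ((u.1.1, u.2.1), (u.2.2, u.1.2))) ?_ ?_
  · intro u hu
    simp only [coe_filter, mem_product, Set.mem_ofPred_eq] at hu ⊢
    exact ⟨by tauto, by linear_combination hu.2⟩
  · rintro ⟨⟨a, b⟩, c, d⟩ _ ⟨⟨a', b'⟩, c', d'⟩ _ h
    simp only [Prod.mk.injEq] at h ⊢
    tauto

theorem sum_dilateEnergy_le (D : Finset F) :
    ∑ l, dilateEnergy D l ≤ #D ^ 4 + Fintype.card F * #D ^ 2 := by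
  have h1 : ∑ l, dilateEnergy D l =
      ∑ u ∈ (D ×ˢ D) ×ˢ (D ×ˢ D), #{l : F | (u.1.1 - u.1.2) * l = u.2.1 - u.2.2} := by
    simp only [dilateEnergy, card_filter]
    exact sum_comm
  have h2 : ∀ u ∈ (D ×ˢ D) ×ˢ (D ×ˢ D), #{l : F | (u.1.1 - u.1.2) * l = u.2.1 - u.2.2} ≤
      1 + if u.1.1 = u.1.2 ∧ u.2.1 = u.2.2 then Fintype.card F else 0 := by
    rintro ⟨⟨x, y⟩, z, w⟩ -
    dsimp only
    split_ifs with h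
    · exact (card_le_univ _).trans (by omega)
    · refine card_le_one.2 fun a ha b hb => ?_
      simp only [mem_filter, mem_univ, true_and] at ha hb
      by_cases hxy : x = y
      · exact absurd ⟨hxy, by simpa [hxy, sub_eq_zero, eq_comm] using ha⟩ h
      · exact mul_left_cancel₀ (sub_ne_zero.2 hxy) (ha.trans hb.symm)
  have h3 : #{u ∈ (D ×ˢ D) ×ˢ (D ×ˢ D) | u.1.1 = u.1.2 ∧ u.2.1 = u.2.2} ≤ #D ^ 2 := by
    rw [sq, ← card_product]
    refine card_le_card_of_injOn (fun u => (u.1.1, u.2.1)) ?_ ?_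
    · intro u hu
      simp only [coe_filter, mem_product, Set.mem_ofPred_eq, coe_product, Set.mem_prod,
        mem_coe] at hu ⊢
      tauto
    · rintro ⟨⟨a, b⟩, c, d⟩ h ⟨⟨a', b'⟩, c', d'⟩ h' e
      simp only [coe_filter, mem_product, Set.mem_ofPred_eq, Prod.mk.injEq] at h h' e ⊢
      grind
  rw [h1]
  refine (sum_le_sum h2).trans ?_
  rw [sum_add_distrib, ← sum_filter, sum_const, sum_const, smul_eq_mul, smul_eq_mul, mul_one,
    card_product, card_product, mul_comm (Fintype.card F)]
  exact add_le_add (le_of_eq (by ring)) (Nat.mul_le_mul_right _ h3)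

end Dilates

section PrimeField

variable {p : ℕ} [Fact p.Prime]

theorem mulE_le_sum_sq {C : Finset (ZMod p)} (hC0 : 0 ∉ C) :
    mulE C ≤ ∑ l : ZMod p, #{u ∈ C ×ˢ C | u.1 / u.2 = l} ^ 2 := by
  rw [← card_collisions, mulE]
  refine card_le_card_of_injOn (fun u => ((u.1, u.2.2.1), (u.2.2.2, u.2.1))) ?_ ?_
  · rintro ⟨a, b, c, d⟩ hu
    simp only [coe_filter, mem_product, Set.mem_ofPred_eq] at hu ⊢
    obtain ⟨⟨ha, hb, hc, hd⟩, e⟩ := hu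
    have hc0 : c ≠ 0 := fun h => hC0 (h ▸ hc)
    have hb0 : b ≠ 0 := fun h => hC0 (h ▸ hb)
    refine ⟨by tauto, ?_⟩
    rw [div_eq_div_iff hc0 hb0, e, mul_comm]
  · rintro ⟨a, b, c, d⟩ _ ⟨a', b', c', d'⟩ _ h
    simp only [Prod.mk.injEq] at h ⊢
    tauto

theorem addE_le_sum_sq (B : Finset (ZMod p)) :
    addE B ≤ ∑ s : ZMod p, #{u ∈ B ×ˢ B | u.1 + u.2 = s} ^ 2 := by
  rw [← card_collisions, addE]
  refine card_le_card_of_injOn (fun u => ((u.1, u.2.1), u.2.2)) ?_ ?_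
  · rintro ⟨a, b, c, d⟩ hu
    simp only [coe_filter, mem_product, Set.mem_ofPred_eq] at hu ⊢
    tauto
  · rintro ⟨a, b, c, d⟩ _ ⟨a', b', c', d'⟩ _ h
    simp only [Prod.mk.injEq] at h ⊢
    tauto

/-- A set of nonzero elements, each a difference of elements of `D` in many ways, has small
multiplicative energy. -/
theorem mul_mulE_le {C D : Finset (ZMod p)} {t : ℝ} (ht : 0 ≤ t)
    (hC : ∀ c ∈ C, t ≤ #{u ∈ D ×ˢ D | u.1 - u.2 = c}) (hC0 : 0 ∉ C) :
    p * t ^ 2 * mulE C ≤ #C * (p ^ 2 * #D ^ 2) + #C ^ 2 * (#D : ℝ) ^ 4 := by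
  have hcard : Fintype.card (ZMod p) = p := ZMod.card p
  set r : ZMod p → ℝ := fun l => #{u ∈ C ×ˢ C | u.1 / u.2 = l} with hr
  have hr0 : ∀ l, 0 ≤ r l := fun l => Nat.cast_nonneg _
  have hrsum : ∑ l, r l = (#C : ℝ) ^ 2 := by
    have := sum_card_fibres (C ×ˢ C) fun u : ZMod p × ZMod p => u.1 / u.2
    rw [card_product, ← sq] at this
    simp only [hr]
    exact_mod_cast this
  have hrC : ∀ l, r l ≤ #C := fun l => by
    simp only [hr, Nat.cast_le]
    refine card_le_card_of_injOn (fun u => u.2) ?_ ?_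
    · intro u hu
      simp only [coe_filter, mem_product, Set.mem_ofPred_eq] at hu
      exact hu.1.2
    · rintro ⟨a, b⟩ h ⟨a', b'⟩ h' e
      simp only [coe_filter, mem_product, Set.mem_ofPred_eq] at h h' e
      subst e
      have hb0 : b ≠ 0 := fun h0 => hC0 (h0 ▸ h.1.2)
      have : a = a' := by
        have := h.2.trans h'.2.symm
        rwa [div_left_inj' hb0] at this
      rw [this]
  have hE : (mulE C : ℝ) ≤ ∑ l, r l ^ 2 := by
    simp only [hr]
    exact_mod_cast mulE_le_sum_sq hC0
  have hQ : ∀ l, t ^ 2 * r l ≤ dilateEnergy D l :=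
    sq_mul_card_ratio_le_dilateEnergy ht hC hC0
  have hlow : ∀ l, (#D : ℝ) ^ 4 ≤ p * dilateEnergy D l := fun l => by
    have := card_pow_four_le_dilateEnergy D l
    rw [hcard] at this
    exact_mod_cast this
  have hup : ∑ l, (dilateEnergy D l : ℝ) ≤ (#D : ℝ) ^ 4 + p * #D ^ 2 := by
    have := sum_dilateEnergy_le D
    rw [hcard] at this
    exact_mod_cast this
  have hp : (0 : ℝ) ≤ p := Nat.cast_nonneg p
  calc p * t ^ 2 * mulE C ≤ p * t ^ 2 * ∑ l, r l ^ 2 := by gcongr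
    _ = ∑ l, r l * (p * (t ^ 2 * r l)) := by
        rw [mul_sum]; exact sum_congr rfl fun l _ => by ring
    _ ≤ ∑ l, (#C * (p * dilateEnergy D l - (#D : ℝ) ^ 4) + r l * (#D : ℝ) ^ 4) := by
        refine sum_le_sum fun l _ => ?_
        have h1 := mul_le_mul_of_nonneg_left (mul_le_mul_of_nonneg_left (hQ l) hp) (hr0 l)
        have h2 := mul_le_mul_of_nonneg_right (hrC l) (sub_nonneg.2 (hlow l))
        linarith
    _ = #C * (p * ∑ l, (dilateEnergy D l : ℝ) - p * (#D : ℝ) ^ 4) + #C ^ 2 * (#D : ℝ) ^ 4 := by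
        rw [sum_add_distrib, ← sum_mul, hrsum, ← mul_sum, sum_sub_distrib, ← mul_sum, sum_const,
          card_univ, hcard, nsmul_eq_mul]
    _ ≤ #C * (p * ((#D : ℝ) ^ 4 + p * #D ^ 2) - p * (#D : ℝ) ^ 4) + #C ^ 2 * (#D : ℝ) ^ 4 := by
        gcongr
    _ = _ := by ring

/-- A set whose sums rarely fall among its popular sums has small additive energy. -/
theorem addE_le {A B P : Finset (ZMod p)} (hBA : B ⊆ A) {T t : ℝ} (hT : 0 ≤ T) (ht : 0 ≤ t)
    (hP : ∀ s ∉ P, #{u ∈ A ×ˢ A | u.1 + u.2 = s} ≤ T)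
    (hB : ∀ b ∈ B, b ≠ 0 → #{y ∈ A | b + y ∈ P} ≤ t) :
    addE B ≤ T * (#A : ℝ) ^ 2 + #A * (#A * t + #A) := by
  set r : ZMod p → ℝ := fun s => #{u ∈ B ×ˢ B | u.1 + u.2 = s} with hr
  have hr0 : ∀ l, 0 ≤ r l := fun l => Nat.cast_nonneg _
  have hBAc : (#B : ℝ) ≤ #A := by exact_mod_cast card_le_card hBA
  have hrsum : ∑ s, r s = (#B : ℝ) ^ 2 := by
    have := sum_card_fibres (B ×ˢ B) fun u : ZMod p × ZMod p => u.1 + u.2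
    rw [card_product, ← sq] at this
    simp only [hr]
    exact_mod_cast this
  have hrA : ∀ s, r s ≤ #A := fun s => by
    refine le_trans ?_ hBAc
    simp only [hr, Nat.cast_le]
    refine card_le_card_of_injOn (fun u => u.2) ?_ ?_
    · intro u hu
      simp only [coe_filter, mem_product, Set.mem_ofPred_eq] at hu
      exact hu.1.2
    · rintro ⟨a, b⟩ h ⟨a', b'⟩ h' e
      simp only [coe_filter, mem_product, Set.mem_ofPred_eq] at h h' e
      subst e
      rw [add_right_cancel (h.2.trans h'.2.symm)]
  have hrT : ∀ s ∉ P, r s ≤ T := fun s hs => by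
    refine le_trans ?_ (hP s hs)
    simp only [hr, Nat.cast_le]
    exact card_le_card (filter_subset_filter _ (product_subset_product hBA hBA))
  have hrP : ∑ s ∈ P, r s ≤ #A * t + #A := by
    have h1 : ∑ s ∈ P, #{u ∈ B ×ˢ B | u.1 + u.2 = s} =
        ∑ b ∈ B, #{y ∈ B | b + y ∈ P} := by
      simp only [card_filter, sum_product]
      rw [sum_comm]
      refine sum_congr rfl fun b _ => ?_
      rw [sum_comm]
      refine sum_congr rfl fun y _ => ?_
      simp
    have h2 : ∀ b ∈ B, (#{y ∈ B | b + y ∈ P} : ℝ) ≤ t + if b = 0 then (#A : ℝ) else 0 := by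
      intro b hb
      split_ifs with h0
      · have : (#{y ∈ B | b + y ∈ P} : ℝ) ≤ #B := mod_cast card_filter_le _ _
        linarith
      · rw [add_zero]
        refine le_trans ?_ (hB b hb h0)
        exact_mod_cast card_le_card (filter_subset_filter _ hBA)
    calc ∑ s ∈ P, r s = ∑ b ∈ B, (#{y ∈ B | b + y ∈ P} : ℝ) := by
          simp only [hr]
          exact_mod_cast h1
      _ ≤ ∑ b ∈ B, (t + if b = 0 then (#A : ℝ) else 0) := sum_le_sum h2
      _ ≤ #A * t + #A := by
        rw [sum_add_distrib, sum_const, nsmul_eq_mul, sum_ite_eq' B 0]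
        gcongr
        split_ifs <;> simp
  calc (addE B : ℝ) ≤ ∑ s, r s ^ 2 := by
          simp only [hr]
          exact_mod_cast addE_le_sum_sq B
    _ ≤ ∑ s, (T * r s + if s ∈ P then #A * r s else 0) := by
        refine sum_le_sum fun s _ => ?_
        split_ifs with hs
        · nlinarith [hr0 s, hrA s, mul_nonneg hT (hr0 s)]
        · nlinarith [hr0 s, hrT s hs]
    _ = T * (#B : ℝ) ^ 2 + #A * ∑ s ∈ P, r s := by
        rw [sum_add_distrib, ← mul_sum, hrsum, sum_ite_mem, univ_inter, mul_sum]
    _ ≤ _ := by gcongr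

/-- A decomposition into a part of small additive energy and a part of small multiplicative
energy, with a parameter `M` measuring the saving. -/
theorem exists_decomposition (A : Finset (ZMod p)) {M : ℝ} (hM : 1 ≤ M) (hA : 0 < #A) :
    ∃ B C : Finset (ZMod p), Disjoint B C ∧ B ∪ C = A ∧
      (addE B : ℝ) ≤ 2 * (#A : ℝ) ^ 3 / M + (#A : ℝ) ^ 2 ∧
      (mulE C : ℝ) ≤ 9 * M ^ 4 * p * #A + 81 * M ^ 6 * (#A : ℝ) ^ 4 / p := by
  have hM0 : 0 < M := by linarith
  have hp : (0 : ℝ) < p := by exact_mod_cast (Fact.out : p.Prime).pos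
  have ha : (0 : ℝ) < #A := by exact_mod_cast hA
  set a : ℝ := (#A : ℝ) with ha_def
  set T : ℝ := a / (2 * M) with hT
  set t : ℝ := a / M with ht
  have hT0 : 0 < T := by positivity
  have ht0 : 0 < t := by positivity
  classical
  set P : Finset (ZMod p) := {s | T ≤ #{u ∈ A ×ˢ A | u.1 + u.2 = s}} with hP
  set C : Finset (ZMod p) := {c ∈ A | c ≠ 0 ∧ t ≤ #{y ∈ A | c + y ∈ P}} with hC
  have hCA : C ⊆ A := filter_subset _ _
  have hCa : (#C : ℝ) ≤ a := Nat.cast_le.2 <| card_le_card hCA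
  have hPcard : (#P : ℝ) ≤ 2 * M * a := by
    have h1 : ∑ s ∈ P, T ≤ a ^ 2 := by
      calc ∑ s ∈ P, T ≤ ∑ s ∈ P, (#{u ∈ A ×ˢ A | u.1 + u.2 = s} : ℝ) :=
            sum_le_sum fun s hs => (mem_filter.1 hs).2
        _ ≤ ∑ s, (#{u ∈ A ×ˢ A | u.1 + u.2 = s} : ℝ) :=
            sum_le_univ_sum_of_nonneg fun s => Nat.cast_nonneg _
        _ = a ^ 2 := by
            have := sum_card_fibres (A ×ˢ A) fun u : ZMod p × ZMod p => u.1 + u.2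
            rw [card_product, ← sq] at this
            rw [ha_def]
            exact_mod_cast this
    rw [sum_const, nsmul_eq_mul, ← le_div_iff₀ hT0] at h1
    refine h1.trans (le_of_eq ?_)
    rw [hT]
    field_simp
  set D := A ∪ P with hD
  have hDcard : (#D : ℝ) ≤ 3 * M * a := by
    have h1 : (#D : ℝ) ≤ a + #P := by
      rw [ha_def]
      exact_mod_cast card_union_le A P
    nlinarith
  refine ⟨A \ C, C, sdiff_disjoint, sdiff_union_of_subset hCA, ?_, ?_⟩
  · have h := addE_le (A := A) (B := A \ C) (P := P) sdiff_subset hT0.le ht0.le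
      (fun s hs => by
        simp only [hP, mem_filter, mem_univ, true_and, not_le] at hs
        exact hs.le)
      (fun b hb hb0 => by
        simp only [hC, mem_sdiff, mem_filter, not_and, not_le] at hb
        exact (hb.2 hb.1 hb0).le)
    refine h.trans ?_
    have e : T * a ^ 2 + a * (a * t + a) = (3 / 2) * (a ^ 3 / M) + a ^ 2 := by
      rw [hT, ht]; field_simp; ring
    have : 0 ≤ a ^ 3 / M := by positivity
    rw [← ha_def, e, mul_div_assoc]
    linarith
  · have h := mul_mulE_le (C := C) (D := D) ht0.le
      (fun c hc => by
        refine (mem_filter.1 hc).2.2.trans ?_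
        rw [Nat.cast_le]
        refine card_le_card_of_injOn (fun y => (c + y, y)) ?_ ?_
        · intro y hy
          simp only [coe_filter, Set.mem_ofPred_eq, mem_product] at hy ⊢
          exact ⟨⟨mem_union_right _ hy.2, mem_union_left _ hy.1⟩, add_sub_cancel_right _ _⟩
        · intro y _ y' _ e
          exact (Prod.mk.inj e).2)
      (fun h0 => (mem_filter.1 h0).2.1 rfl)
    have h2 : p * t ^ 2 * mulE C ≤ a * (p ^ 2 * (3 * M * a) ^ 2) + a ^ 2 * (3 * M * a) ^ 4 :=
      h.trans (by gcongr)
    have hpt : 0 < p * t ^ 2 := by positivity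
    rw [mul_comm, ← le_div_iff₀ hpt] at h2
    refine h2.trans (le_of_eq ?_)
    rw [ht]
    field_simp
    ring

end PrimeField

theorem energy_bounds_le {a q M : ℝ} (ha : 1 ≤ a) (hM : 1 ≤ M) (hq : 1 ≤ q)
    (haM : M ^ 15 * a = q) (haq : q ^ 4 ≤ a ^ 7) :
    2 * a ^ 3 / M + a ^ 2 ≤ 90 * a ^ 3 / M ∧
      9 * M ^ 4 * q * a + 81 * M ^ 6 * a ^ 4 / q ≤ 90 * a ^ 3 / M := by
  have hM0 : 0 < M := by linarith
  have ha0 : 0 < a := by linarith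
  have hMq : M ^ 5 * q ≤ a ^ 2 := by
    refine le_of_pow_le_pow_left₀ (n := 3) (by norm_num) (by positivity) ?_
    refine le_of_mul_le_mul_right ?_ ha0
    calc (M ^ 5 * q) ^ 3 * a = (M ^ 15 * a) * q ^ 3 := by ring
      _ = q ^ 4 := by rw [haM]; ring
      _ ≤ a ^ 7 := haq
      _ = (a ^ 2) ^ 3 * a := by ring
  have hMa : M ≤ a := by
    have h1 : a ≤ q := by
      rw [← haM]
      exact le_mul_of_one_le_left ha0.le (one_le_pow₀ hM)
    have h2 : M * a ≤ a * a := by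
      calc M * a ≤ M ^ 5 * q := by
            gcongr
            exact le_self_pow₀ hM (by norm_num)
        _ ≤ a ^ 2 := hMq
        _ = a * a := by ring
    exact le_of_mul_le_mul_right h2 ha0
  constructor
  · rw [le_div_iff₀ hM0, add_mul, div_mul_cancel₀ _ hM0.ne']
    have : a ^ 2 * M ≤ a ^ 2 * a := by gcongr
    nlinarith [pow_pos ha0 3]
  · rw [le_div_iff₀ hM0, add_mul]
    have h1 : 9 * M ^ 4 * q * a * M ≤ 9 * a ^ 3 := by
      calc 9 * M ^ 4 * q * a * M = 9 * a * (M ^ 5 * q) := by ring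
        _ ≤ 9 * a * a ^ 2 := by gcongr
        _ = 9 * a ^ 3 := by ring
    have h2 : 81 * M ^ 6 * a ^ 4 / q * M ≤ 81 * a ^ 3 := by
      rw [div_mul_eq_mul_div, div_le_iff₀ (by linarith), ← haM]
      calc 81 * M ^ 6 * a ^ 4 * M = 81 * a ^ 4 * M ^ 7 := by ring
        _ ≤ 81 * a ^ 4 * M ^ 15 := by gcongr; norm_num
        _ = 81 * a ^ 3 * (M ^ 15 * a) := by ring
    linarith

/-- Theorem 1.3, second part: low-energy decompositions in `𝔽_p` for
`|A| ≥ p^(101/161)·(log p)^(71/161)`. -/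
theorem low_energy_decomposition_Fp_large :
    ∃ K : ℝ, 0 < K ∧ ∃ p₀ : ℕ, ∀ p : ℕ, p.Prime → p₀ ≤ p →
      ∀ A : Finset (ZMod p),
        (p : ℝ) ^ ((101 : ℝ) / 161) * Real.log p ^ ((71 : ℝ) / 161) ≤ (A.card : ℝ) →
        ∃ B C : Finset (ZMod p), Disjoint B C ∧ B ∪ C = A ∧
          (max (addE B) (mulE C) : ℝ) ≤
            K * (A.card : ℝ) ^ 3 * ((A.card : ℝ) / p) ^ ((1 : ℝ) / 15) *
              Real.log A.card ^ ((14 : ℝ) / 15) := by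
  refine ⟨90, by norm_num, 9, fun p hp hp9 A hA => ?_⟩
  have : Fact p.Prime := ⟨hp⟩
  set a : ℝ := (#A : ℝ) with ha_def
  have hq9 : (9 : ℝ) ≤ p := by exact_mod_cast hp9
  have hq0 : (0 : ℝ) < p := by linarith
  have hlog : ∀ x : ℝ, 3 ≤ x → 1 ≤ Real.log x := fun x hx => by
    rw [Real.le_log_iff_exp_le (by linarith)]
    linarith [Real.exp_one_lt_d9]
  have h47 : (p : ℝ) ^ ((4 : ℝ) / 7) ≤ a := by
    refine le_trans ?_ hA
    refine le_trans (Real.rpow_le_rpow_of_exponent_le (by linarith)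
      (by norm_num : (4 : ℝ) / 7 ≤ 101 / 161)) ?_
    exact le_mul_of_one_le_right (by positivity)
      (Real.one_le_rpow (hlog _ (by linarith)) (by norm_num))
  have haq : (p : ℝ) ^ 4 ≤ a ^ 7 := by
    calc (p : ℝ) ^ 4 = ((p : ℝ) ^ ((4 : ℝ) / 7)) ^ 7 := by
          rw [← Real.rpow_natCast ((p : ℝ) ^ ((4 : ℝ) / 7)), ← Real.rpow_mul hq0.le,
            ← Real.rpow_natCast]
          norm_num
      _ ≤ a ^ 7 := by gcongr
  have ha3 : 3 ≤ a := by
    refine le_of_pow_le_pow_left₀ (n := 7) (by norm_num) (by positivity) ?_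
    calc (3 : ℝ) ^ 7 ≤ 9 ^ 4 := by norm_num
      _ ≤ (p : ℝ) ^ 4 := by gcongr
      _ ≤ a ^ 7 := haq
  have ha0 : 0 < a := by linarith
  have hap : a ≤ p := by
    have := card_le_univ A
    rw [ZMod.card] at this
    rw [ha_def]
    exact_mod_cast this
  set M : ℝ := ((p : ℝ) / a) ^ ((1 : ℝ) / 15) with hM_def
  have hM : 1 ≤ M := Real.one_le_rpow ((one_le_div ha0).2 hap) (by norm_num)
  have haM : M ^ 15 * a = p := by
    rw [hM_def, ← Real.rpow_natCast, ← Real.rpow_mul (by positivity)]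
    norm_num
    field_simp
  have hMinv : (a / p) ^ ((1 : ℝ) / 15) = M⁻¹ := by
    rw [hM_def, ← Real.inv_rpow (by positivity), inv_div]
  obtain ⟨B, C, hBC, hU, hadd, hmul⟩ :=
    exists_decomposition A hM (Nat.cast_pos.1 ha0)
  obtain ⟨b1, b2⟩ := energy_bounds_le (by linarith) hM (by linarith) haM haq
  refine ⟨B, C, hBC, hU, (max_le (hadd.trans b1) (hmul.trans b2)).trans ?_⟩
  rw [hMinv, ← div_eq_mul_inv]
  exact le_mul_of_one_le_right (by positivity) (Real.one_le_rpow (hlog _ ha3) (by norm_num))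
end

section
/- Let A be a finite subset of the real numbers with |A| ≥ 2, and suppose that m and n are integers with m ≥ 2 and n ≥ 2. Then, with δ = 2/33, there exist disjoint subsets B and C of A with A = B ∪ C such that E₊⁽ᵐ⁾(B) ≤ K·|A|^(2m−1−δ)·(log |A|)^(1−δ) and E×⁽ⁿ⁾(C) ≤ K·|A|^(2n−1−δ)·(log |A|)^(1−δ), where K is a constant depending at most on m and n. -/
open Finset

/-- The `k`-fold additive energy `E₊(A₁,…,A_k)`:
the number of pairs `(a, a')` with `aᵢ, a'ᵢ ∈ Aᵢ` and `a₁+⋯+a_k = a'₁+⋯+a'_k`. -/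
noncomputable def addEnergyK {k : ℕ} (A : Fin k → Finset ℝ) : ℕ :=
  ((Fintype.piFinset A ×ˢ Fintype.piFinset A).filter
    fun x => ∑ i, x.1 i = ∑ i, x.2 i).card

/-- The `k`-fold multiplicative energy `E×(A₁,…,A_k)`:
the number of pairs `(a, a')` with `aᵢ, a'ᵢ ∈ Aᵢ` and `a₁⋯a_k = a'₁⋯a'_k`. -/
noncomputable def mulEnergyK {k : ℕ} (A : Fin k → Finset ℝ) : ℕ :=
  ((Fintype.piFinset A ×ˢ Fintype.piFinset A).filter
    fun x => ∏ i, x.1 i = ∏ i, x.2 i).card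

/-- The number of pairs `(a, b) ∈ P × Q` with `f a = g b`. -/
def collisions {α β γ : Type*} [DecidableEq γ] (P : Finset α) (Q : Finset β)
    (f : α → γ) (g : β → γ) : ℕ :=
  #{x ∈ P ×ˢ Q | f x.1 = g x.2}

theorem collisions_eq_sum {α β γ : Type*} [DecidableEq γ] {P : Finset α} (Q : Finset β)
    {f : α → γ} (g : β → γ) {T : Finset γ} (hT : ∀ a ∈ P, f a ∈ T) :
    collisions P Q f g = ∑ t ∈ T, #{a ∈ P | f a = t} * #{b ∈ Q | g b = t} := by
  unfold collisions
  rw [card_eq_sum_card_fiberwise (f := fun x => f x.1) (t := T)]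
  · refine sum_congr rfl fun t _ => ?_
    rw [← card_product]
    congr 1
    ext ⟨a, b⟩
    simp only [mem_filter, mem_product]
    grind
  · intro x hx
    simp only [coe_filter, mem_product, Set.mem_ofPred_eq] at hx
    exact hT _ hx.1.1

theorem two_mul_collisions_le {α β γ : Type*} [DecidableEq γ] (P : Finset α) (Q : Finset β)
    (f : α → γ) (g : β → γ) :
    2 * collisions P Q f g ≤ collisions P P f f + collisions Q Q g g := by
  have hf : ∀ a ∈ P, f a ∈ P.image f ∪ Q.image g := fun a ha =>
    mem_union_left _ (mem_image_of_mem f ha)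
  have hg : ∀ b ∈ Q, g b ∈ P.image f ∪ Q.image g := fun b hb =>
    mem_union_right _ (mem_image_of_mem g hb)
  rw [collisions_eq_sum Q g hf, collisions_eq_sum P f hf, collisions_eq_sum Q g hg, mul_sum,
    ← sum_add_distrib]
  refine sum_le_sum fun t _ => ?_
  nlinarith [two_mul_le_add_sq (#{a ∈ P | f a = t}) (#{b ∈ Q | g b = t})]

/-- If `S` is covered by a family `F` of sets, each of which has at most `M` coincidences of
ratios, then `S` has at most `|F|⁴ M` coincidences of products. -/
@[to_additive]
theorem collisions_mul_le_of_cover {G : Type*} [DivisionCommMonoid G] [DecidableEq G]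
    {S : Finset G} {F : Finset (Finset G)} {M : ℝ} (hS : S ⊆ F.biUnion id)
    (hF : ∀ X ∈ F, ∀ x ∈ X, IsUnit x)
    (hM : ∀ X ∈ F, (collisions (X ×ˢ X) (X ×ˢ X) (fun x => x.1 / x.2) (fun x => x.1 / x.2) : ℝ)
      ≤ M) :
    (collisions (S ×ˢ S) (S ×ˢ S) (fun x => x.1 * x.2) (fun x => x.1 * x.2) : ℝ)
      ≤ (#F : ℝ) ^ 4 * M := by
  have pair : ∀ X ∈ F, ∀ Y ∈ F,
      (collisions (X ×ˢ Y) (X ×ˢ Y) (fun x => x.1 * x.2) (fun x => x.1 * x.2) : ℝ) ≤ M := by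
    intro X hX Y hY
    have h1 : collisions (X ×ˢ Y) (X ×ˢ Y) (fun x => x.1 * x.2) (fun x => x.1 * x.2)
        = collisions (X ×ˢ X) (Y ×ˢ Y) (fun x => x.1 / x.2) (fun x => x.2 / x.1) := by
      unfold collisions
      refine card_nbij' (fun x => ((x.1.1, x.2.1), (x.1.2, x.2.2)))
        (fun x => ((x.1.1, x.2.1), (x.1.2, x.2.2))) ?_ ?_ ?_ ?_
      · rintro ⟨⟨a, b⟩, ⟨c, d⟩⟩ h
        simp only [coe_filter, mem_product, Set.mem_ofPred_eq] at h ⊢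
        refine ⟨by tauto, ?_⟩
        rw [(hF X hX c h.1.2.1).div_eq_div_iff (hF Y hY b h.1.1.2), h.2, mul_comm]
      · rintro ⟨⟨a, b⟩, ⟨c, d⟩⟩ h
        simp only [coe_filter, mem_product, Set.mem_ofPred_eq] at h ⊢
        refine ⟨by tauto, ?_⟩
        rw [(hF X hX b h.1.1.2).div_eq_div_iff (hF Y hY c h.1.2.1)] at h
        rw [h.2, mul_comm]
      · intro x _; rfl
      · intro x _; rfl
    have h2 : collisions (Y ×ˢ Y) (Y ×ˢ Y) (fun x => x.2 / x.1) (fun x => x.2 / x.1)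
        = collisions (Y ×ˢ Y) (Y ×ˢ Y) (fun x => x.1 / x.2) (fun x => x.1 / x.2) := by
      unfold collisions
      congr 1
      refine filter_congr fun x _ => ?_
      show x.1.2 / x.1.1 = x.2.2 / x.2.1 ↔ _
      rw [← inv_div, ← inv_div x.2.1, inv_inj]
    have h3 := two_mul_collisions_le (X ×ˢ X) (Y ×ˢ Y) (fun x => x.1 / x.2) (fun x => x.2 / x.1)
    rw [← h1, h2] at h3
    have h4 : (2 : ℝ) * collisions (X ×ˢ Y) (X ×ˢ Y) (fun x => x.1 * x.2) (fun x => x.1 * x.2) ≤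
      collisions (X ×ˢ X) (X ×ˢ X) (fun x => x.1 / x.2) (fun x => x.1 / x.2) +
      collisions (Y ×ˢ Y) (Y ×ˢ Y) (fun x => x.1 / x.2) (fun x => x.1 / x.2) := by
      exact_mod_cast h3
    linarith [hM X hX, hM Y hY]
  have quad : ∀ X ∈ F, ∀ Y ∈ F, ∀ Z ∈ F, ∀ W ∈ F,
      (collisions (X ×ˢ Y) (Z ×ˢ W) (fun x => x.1 * x.2) (fun x => x.1 * x.2) : ℝ) ≤ M := by
    intro X hX Y hY Z hZ W hW
    have h3 := two_mul_collisions_le (X ×ˢ Y) (Z ×ˢ W) (fun x => x.1 * x.2) (fun x => x.1 * x.2)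
    have h4 : (2 : ℝ) * collisions (X ×ˢ Y) (Z ×ˢ W) (fun x => x.1 * x.2) (fun x => x.1 * x.2) ≤
      collisions (X ×ˢ Y) (X ×ˢ Y) (fun x => x.1 * x.2) (fun x => x.1 * x.2) +
      collisions (Z ×ˢ W) (Z ×ˢ W) (fun x => x.1 * x.2) (fun x => x.1 * x.2) := by
      exact_mod_cast h3
    linarith [pair X hX Y hY, pair Z hZ W hW]
  have hsub : {x ∈ (S ×ˢ S) ×ˢ (S ×ˢ S) | x.1.1 * x.1.2 = x.2.1 * x.2.2} ⊆
      ((F ×ˢ F) ×ˢ (F ×ˢ F)).biUnion fun t =>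
        {x ∈ (t.1.1 ×ˢ t.1.2) ×ˢ (t.2.1 ×ˢ t.2.2) | x.1.1 * x.1.2 = x.2.1 * x.2.2} := by
    rintro ⟨⟨a, b⟩, ⟨c, d⟩⟩ h
    simp only [mem_filter, mem_product] at h
    obtain ⟨⟨⟨ha, hb⟩, hc, hd⟩, h⟩ := h
    obtain ⟨X, hX, ha⟩ := mem_biUnion.1 (hS ha)
    obtain ⟨Y, hY, hb⟩ := mem_biUnion.1 (hS hb)
    obtain ⟨Z, hZ, hc⟩ := mem_biUnion.1 (hS hc)
    obtain ⟨W, hW, hd⟩ := mem_biUnion.1 (hS hd)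
    refine mem_biUnion.2 ⟨((X, Y), (Z, W)), ?_, ?_⟩
    · simp [hX, hY, hZ, hW]
    · simp only [mem_filter, mem_product]
      exact ⟨⟨⟨ha, hb⟩, hc, hd⟩, h⟩
  have hcard := (card_le_card hsub).trans card_biUnion_le
  calc (collisions (S ×ˢ S) (S ×ˢ S) (fun x => x.1 * x.2) (fun x => x.1 * x.2) : ℝ)
      ≤ ∑ t ∈ (F ×ˢ F) ×ˢ (F ×ˢ F), (collisions (t.1.1 ×ˢ t.1.2) (t.2.1 ×ˢ t.2.2)
          (fun x => x.1 * x.2) (fun x => x.1 * x.2) : ℝ) := by exact_mod_cast hcard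
    _ ≤ ∑ t ∈ (F ×ˢ F) ×ˢ (F ×ˢ F), M := by
        refine sum_le_sum fun t ht => ?_
        simp only [mem_product] at ht
        exact quad _ ht.1.1 _ ht.1.2 _ ht.2.1 _ ht.2.2
    _ = (#F : ℝ) ^ 4 * M := by
        rw [sum_const, nsmul_eq_mul]
        simp only [card_product]
        push_cast
        ring

/-- The `(k + 2)`-fold energy is controlled by the `2`-fold energy. -/
@[to_additive]
theorem collisions_prod_le {G : Type*} [CommMonoid G] [DecidableEq G]
    (S : Finset G) (hS : ∀ x ∈ S, IsUnit x) (k : ℕ) :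
    collisions (Fintype.piFinset fun _ : Fin (k + 2) => S)
        (Fintype.piFinset fun _ : Fin (k + 2) => S) (fun a => ∏ i, a i) (fun a => ∏ i, a i)
      ≤ #S ^ (2 * k) *
        collisions (S ×ˢ S) (S ×ˢ S) (fun x => x.1 * x.2) (fun x => x.1 * x.2) := by
  induction k with
  | zero =>
    rw [mul_zero, pow_zero, one_mul]
    unfold collisions
    refine card_le_card_of_injOn (fun x => ((x.1 0, x.1 1), (x.2 0, x.2 1))) ?_ ?_
    · rintro ⟨a, b⟩ h
      simp only [coe_filter, mem_product, Fintype.mem_piFinset, Set.mem_ofPred_eq] at h ⊢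
      exact ⟨⟨⟨h.1.1 0, h.1.1 1⟩, h.1.2 0, h.1.2 1⟩, by simpa [Fin.prod_univ_two] using h.2⟩
    · rintro ⟨a, b⟩ _ ⟨c, d⟩ _ h
      simp only [Prod.mk.injEq] at h
      obtain ⟨⟨h1, h2⟩, h3, h4⟩ := h
      refine Prod.ext (funext fun i => ?_) (funext fun i => ?_) <;> fin_cases i <;> assumption
  | succ k ih =>
    set P := Fintype.piFinset fun _ : Fin (k + 2) => S
    have key : ∀ t ∈ S ×ˢ S, collisions P P (fun a => t.1 * ∏ i, a i) (fun a => t.2 * ∏ i, a i)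
        ≤ collisions P P (fun a => ∏ i, a i) (fun a => ∏ i, a i) := by
      rintro ⟨s, t⟩ hst
      rw [mem_product] at hst
      have self : ∀ s ∈ S, collisions P P (fun a => s * ∏ i, a i) (fun a => s * ∏ i, a i)
          = collisions P P (fun a => ∏ i, a i) (fun a => ∏ i, a i) := by
        intro s hs
        unfold collisions
        congr 1
        exact filter_congr fun x _ => (hS s hs).mul_right_inj
      have h := two_mul_collisions_le P P (fun a => s * ∏ i, a i) (fun a => t * ∏ i, a i)
      rw [self s hst.1, self t hst.2] at h
      show collisions P P (fun a => s * ∏ i, a i) (fun a => t * ∏ i, a i) ≤ _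
      omega
    calc _ ≤ ∑ t ∈ S ×ˢ S,
          collisions P P (fun a => t.1 * ∏ i, a i) (fun a => t.2 * ∏ i, a i) := by
          rw [collisions, card_eq_sum_card_fiberwise (f := fun x => (x.1 0, x.2 0)) (t := S ×ˢ S)]
          · refine sum_le_sum fun t _ => ?_
            refine card_le_card_of_injOn (fun x => (Fin.tail x.1, Fin.tail x.2)) ?_ ?_
            · rintro ⟨a, b⟩ h
              simp only [coe_filter, mem_filter, mem_product, Fintype.mem_piFinset,
                Set.mem_ofPred_eq] at h
              simp only [coe_filter, mem_product, Set.mem_ofPred_eq, P, Fintype.mem_piFinset]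
              refine ⟨⟨fun i => h.1.1.1 _, fun i => h.1.1.2 _⟩, ?_⟩
              have h2 := h.1.2
              rw [Fin.prod_univ_succ a, Fin.prod_univ_succ b] at h2
              rw [← h.2]
              exact h2
            · rintro ⟨a, b⟩ h ⟨c, d⟩ h' e
              simp only [coe_filter, mem_filter, Set.mem_ofPred_eq] at h h'
              simp only [Prod.mk.injEq] at e
              have e2 := h.2.trans h'.2.symm
              simp only [Prod.mk.injEq] at e2
              rw [← Fin.cons_self_tail a, ← Fin.cons_self_tail b, e.1, e.2, e2.1, e2.2,
                Fin.cons_self_tail, Fin.cons_self_tail]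
          · rintro ⟨a, b⟩ h
            simp only [coe_filter, mem_product, Fintype.mem_piFinset, Set.mem_ofPred_eq] at h
            simp only [coe_product, Set.mem_prod, mem_coe]
            exact ⟨h.1.1 0, h.1.2 0⟩
      _ ≤ ∑ t ∈ S ×ˢ S, #S ^ (2 * k) *
            collisions (S ×ˢ S) (S ×ˢ S) (fun x => x.1 * x.2) (fun x => x.1 * x.2) :=
          sum_le_sum fun t ht => (key t ht).trans ih
      _ = _ := by
          rw [sum_const, card_product, smul_eq_mul]
          ring

theorem collisions_add_eq_sub {G : Type*} [AddCommGroup G] [DecidableEq G] (S : Finset G) :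
    collisions (S ×ˢ S) (S ×ˢ S) (fun x => x.1 + x.2) (fun x => x.1 + x.2)
      = collisions (S ×ˢ S) (S ×ˢ S) (fun x => x.1 - x.2) (fun x => x.1 - x.2) := by
  unfold collisions
  refine card_nbij' (fun x => ((x.1.1, x.2.2), (x.2.1, x.1.2)))
    (fun x => ((x.1.1, x.2.2), (x.2.1, x.1.2))) ?_ ?_ ?_ ?_
  · rintro ⟨⟨a, b⟩, ⟨c, d⟩⟩ h
    simp only [coe_filter, mem_product, Set.mem_ofPred_eq] at h ⊢
    exact ⟨by tauto, sub_eq_sub_iff_add_eq_add.2 h.2⟩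
  · rintro ⟨⟨a, b⟩, ⟨c, d⟩⟩ h
    simp only [coe_filter, mem_product, Set.mem_ofPred_eq] at h ⊢
    exact ⟨by tauto, sub_eq_sub_iff_add_eq_add.1 h.2⟩
  · intro x _; rfl
  · intro x _; rfl

section Solymosi

open scoped Pointwise

theorem card_mul_sq_le_card_below {X : Finset ℝ} {τ : ℕ} (S : Finset ℝ) :
    (∀ s ∈ S, τ ≤ #{x ∈ X | 0 < x ∧ s * x ∈ X}) → ∀ u : ℝ, τ ≤ #{x ∈ X | 0 < x ∧ u * x ∈ X} →
    (∀ s ∈ S, s < u) → #S * τ ^ 2 ≤ #{p ∈ (X + X) ×ˢ (X + X) | 0 < p.1 ∧ p.2 < u * p.1} := by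
  induction S using Finset.induction_on_max with
  | empty => simp
  | insert a S ha ih =>
    intro hS u hu hSu
    have hau : a < u := hSu a (mem_insert_self a S)
    have haS : a ∉ S := fun h => lt_irrefl a (ha a h)
    have hqa := hS a (mem_insert_self a S)
    have h1 := ih (fun s hs => hS s (mem_insert_of_mem hs)) a hqa ha
    set Pa := {x ∈ X | 0 < x ∧ a * x ∈ X}
    set Pu := {x ∈ X | 0 < x ∧ u * x ∈ X}
    set W := (Pa ×ˢ Pu).image fun p => (p.1 + p.2, a * p.1 + u * p.2)
    have hW : #W = #Pa * #Pu := by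
      rw [card_image_of_injective, card_product]
      rintro ⟨x, y⟩ ⟨x', y'⟩ h
      simp only [Prod.mk.injEq] at h
      have hy : (u - a) * (y - y') = 0 := by linear_combination h.2 - a * h.1
      have hy' : y = y' := by
        rcases mul_eq_zero.1 hy with h | h <;> linarith
      exact Prod.ext (by simp only; linarith [h.1]) hy'
    have hdisj : Disjoint {p ∈ (X + X) ×ˢ (X + X) | 0 < p.1 ∧ p.2 < a * p.1} W := by
      rw [disjoint_left]
      rintro p hp hpW
      obtain ⟨⟨x, y⟩, hxy, rfl⟩ := mem_image.1 hpW
      simp only [mem_product, mem_filter, Pa, Pu] at hxy hp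
      nlinarith [hp.2.2, mul_pos (sub_pos.2 hau) hxy.2.2.1]
    have hsub : {p ∈ (X + X) ×ˢ (X + X) | 0 < p.1 ∧ p.2 < a * p.1} ∪ W ⊆
        {p ∈ (X + X) ×ˢ (X + X) | 0 < p.1 ∧ p.2 < u * p.1} := by
      intro p hp
      rcases mem_union.1 hp with hp | hp
      · simp only [mem_filter] at hp ⊢
        exact ⟨hp.1, hp.2.1, by nlinarith [mul_pos (sub_pos.2 hau) hp.2.1]⟩
      · obtain ⟨⟨x, y⟩, hxy, rfl⟩ := mem_image.1 hp
        simp only [mem_product, mem_filter, Pa, Pu] at hxy ⊢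
        refine ⟨⟨add_mem_add hxy.1.1 hxy.2.1, add_mem_add hxy.1.2.2 hxy.2.2.2⟩,
          add_pos hxy.1.2.1 hxy.2.2.1, ?_⟩
        nlinarith [mul_pos (sub_pos.2 hau) hxy.1.2.1]
    have h2 := card_le_card hsub
    rw [card_union_of_disjoint hdisj, hW] at h2
    rw [card_insert_of_notMem haS]
    nlinarith [Nat.mul_le_mul hqa hu]

theorem card_rich_mul_sq_le {X : Finset ℝ} {τ : ℕ} (S : Finset ℝ)
    (hS : ∀ s ∈ S, τ ≤ #{x ∈ X | 0 < x ∧ s * x ∈ X}) : #S * τ ^ 2 ≤ 2 * #(X + X) ^ 2 := by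
  rcases S.eq_empty_or_nonempty with rfl | hne
  · simp
  set m := S.max' hne
  have hm : m ∈ S := S.max'_mem hne
  have hτ := hS m hm
  have h1 := card_mul_sq_le_card_below (S.erase m)
    (fun s hs => hS s (mem_of_mem_erase hs)) m hτ
    (fun s hs => lt_of_le_of_ne (S.le_max' s (mem_of_mem_erase hs)) (ne_of_mem_erase hs))
  have h2 : #{p ∈ (X + X) ×ˢ (X + X) | 0 < p.1 ∧ p.2 < m * p.1} ≤ #(X + X) ^ 2 :=
    (card_filter_le _ _).trans (by rw [card_product, sq])
  have h3 : τ ≤ #(X + X) := by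
    refine (hτ.trans (card_filter_le _ _)).trans ?_
    rcases X.eq_empty_or_nonempty with rfl | hX
    · simp
    · exact card_le_card_add_right hX
  rw [← card_erase_add_one hm]
  nlinarith [Nat.pow_le_pow_left h3 2]

theorem sum_card_sq_le_of_pos (X R : Finset ℝ) :
    (∑ s ∈ R, (#{x ∈ X | 0 < x ∧ s * x ∈ X} : ℝ) ^ 2)
      ≤ 4 * (#(X + X) : ℝ) ^ 2 * (1 + Real.log #X) := by
  set q : ℝ → ℕ := fun s => #{x ∈ X | 0 < x ∧ s * x ∈ X}
  have hq : ∀ s, (q s : ℝ) ^ 2 ≤ ∑ τ ∈ Icc 1 #X, if τ ≤ q s then 2 * (τ : ℝ) else 0 := by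
    intro s
    have hqX : q s ≤ #X := card_filter_le _ _
    rw [← sum_filter]
    have : {τ ∈ Icc 1 #X | τ ≤ q s} = Icc 1 (q s) := by
      ext τ; simp only [mem_filter, mem_Icc]; omega
    rw [this]
    generalize q s = n
    clear * -
    induction n with
    | zero => simp
    | succ n ih =>
      rw [sum_Icc_succ_top (by omega)]
      push_cast
      nlinarith
  calc (∑ s ∈ R, (q s : ℝ) ^ 2)
      ≤ ∑ s ∈ R, ∑ τ ∈ Icc 1 #X, if τ ≤ q s then 2 * (τ : ℝ) else 0 := sum_le_sum fun s _ => hq s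
    _ = ∑ τ ∈ Icc 1 #X, (#{s ∈ R | τ ≤ q s} : ℝ) * (2 * τ) := by
        rw [sum_comm]
        refine sum_congr rfl fun τ _ => ?_
        rw [← sum_filter, sum_const, nsmul_eq_mul]
    _ ≤ ∑ τ ∈ Icc 1 #X, 4 * (#(X + X) : ℝ) ^ 2 * (τ : ℝ)⁻¹ := by
        refine sum_le_sum fun τ hτ => ?_
        have hτ0 : (0 : ℝ) < τ := by exact_mod_cast (mem_Icc.1 hτ).1
        have h := card_rich_mul_sq_le (X := X) (τ := τ) {s ∈ R | τ ≤ q s}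
          (fun s hs => (mem_filter.1 hs).2)
        have h' : (#{s ∈ R | τ ≤ q s} : ℝ) * (τ : ℝ) ^ 2 ≤ 2 * (#(X + X) : ℝ) ^ 2 := by
          exact_mod_cast h
        rw [← div_eq_mul_inv, le_div_iff₀ hτ0]
        nlinarith
    _ = 4 * (#(X + X) : ℝ) ^ 2 * (harmonic #X : ℝ) := by
        rw [← mul_sum, harmonic_eq_sum_Icc]
        push_cast
        rfl
    _ ≤ _ := by
        gcongr
        exact harmonic_le_one_add_log _

/-- Solymosi's bound for the multiplicative energy by the size of the sumset. -/
theorem collisions_div_le_card_add_sq {X : Finset ℝ} (hX : ∀ x ∈ X, IsUnit x) :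
    (collisions (X ×ˢ X) (X ×ˢ X) (fun x => x.1 / x.2) (fun x => x.1 / x.2) : ℝ)
      ≤ 16 * (#(X + X) : ℝ) ^ 2 * (1 + Real.log #X) := by
  set R := (X ×ˢ X).image fun x => x.1 / x.2
  rw [collisions_eq_sum (T := R) _ _ (fun a ha => mem_image_of_mem _ ha)]
  have hpos := sum_card_sq_le_of_pos X R
  have hneg := sum_card_sq_le_of_pos (-X) R
  have hcard : #(-X + -X) = #(X + X) := by rw [← neg_add, card_neg]
  rw [hcard, card_neg] at hneg
  have hsplit : ∀ s ∈ R, #{a ∈ X ×ˢ X | a.1 / a.2 = s} ≤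
      #{x ∈ X | 0 < x ∧ s * x ∈ X} + #{x ∈ -X | 0 < x ∧ s * x ∈ -X} := by
    intro s _
    rw [← card_filter_add_card_filter_not (s := {a ∈ X ×ˢ X | a.1 / a.2 = s}) (fun a => 0 < a.2)]
    refine add_le_add ?_ ?_
    · refine card_le_card_of_injOn (fun a => a.2) ?_ ?_
      · rintro ⟨a, b⟩ h
        simp only [coe_filter, mem_filter, mem_product, Set.mem_ofPred_eq] at h ⊢
        obtain ⟨⟨⟨ha, hb⟩, rfl⟩, hb0⟩ := h
        exact ⟨hb, hb0, by rwa [div_mul_cancel₀ _ hb0.ne']⟩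
      · rintro ⟨a, b⟩ h ⟨c, d⟩ h' e
        simp only [coe_filter, mem_filter, mem_product, Set.mem_ofPred_eq] at h h' e
        subst e
        have := h.1.2.trans h'.1.2.symm
        rw [div_left_inj' h.2.ne'] at this
        rw [this]
    · refine card_le_card_of_injOn (fun a => -a.2) ?_ ?_
      · rintro ⟨a, b⟩ h
        simp only [coe_filter, mem_filter, mem_product, Set.mem_ofPred_eq, mem_neg'] at h ⊢
        obtain ⟨⟨⟨ha, hb⟩, rfl⟩, hb0⟩ := h
        have hb1 : b ≠ 0 := (hX b hb).ne_zero
        have hb2 : b < 0 := lt_of_le_of_ne (not_lt.1 hb0) hb1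
        refine ⟨by simpa using hb, by linarith, ?_⟩
        rwa [mul_neg, neg_neg, div_mul_cancel₀ _ hb1]
      · rintro ⟨a, b⟩ h ⟨c, d⟩ h' e
        simp only [coe_filter, mem_filter, mem_product, Set.mem_ofPred_eq, neg_inj] at h h' e
        subst e
        have := h.1.2.trans h'.1.2.symm
        rw [div_left_inj' (hX b h.1.1.2).ne_zero] at this
        rw [this]
  push_cast
  calc _ ≤ ∑ s ∈ R, (2 * (#{x ∈ X | 0 < x ∧ s * x ∈ X} : ℝ) ^ 2 +
        2 * (#{x ∈ -X | 0 < x ∧ s * x ∈ -X} : ℝ) ^ 2) := by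
        refine sum_le_sum fun s hs => ?_
        have h : (#{a ∈ X ×ˢ X | a.1 / a.2 = s} : ℝ) ≤
            (#{x ∈ X | 0 < x ∧ s * x ∈ X} : ℝ) + (#{x ∈ -X | 0 < x ∧ s * x ∈ -X} : ℝ) := by
          exact_mod_cast hsplit s hs
        have h0 : (0 : ℝ) ≤ #{a ∈ X ×ˢ X | a.1 / a.2 = s} := Nat.cast_nonneg _
        nlinarith [sq_nonneg ((#{x ∈ X | 0 < x ∧ s * x ∈ X} : ℝ) -
          (#{x ∈ -X | 0 < x ∧ s * x ∈ -X} : ℝ)), pow_le_pow_left₀ h0 h 2]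
    _ ≤ _ := by
        rw [sum_add_distrib, ← mul_sum, ← mul_sum]
        linarith

end Solymosi

section BalogSzemerediGowers

open scoped Pointwise

variable {G : Type*} [AddCommGroup G] [DecidableEq G]

/-- The number of representations of `d` as a difference of two elements of `S`. -/
def diffRep (S : Finset G) (d : G) : ℕ := #{p ∈ S ×ˢ S | p.1 - p.2 = d}

theorem diffRep_neg (S : Finset G) (d : G) : diffRep S (-d) = diffRep S d := by
  refine card_nbij' Prod.swap Prod.swap ?_ ?_ (fun _ _ => rfl) (fun _ _ => rfl)
  all_goals
    rintro ⟨a, b⟩ h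
    simp only [coe_filter, mem_product, Set.mem_ofPred_eq, Prod.swap] at h ⊢
    refine ⟨h.1.symm, ?_⟩
    rw [← neg_sub, h.2]
  exact neg_neg d

theorem card_filter_add_eq (S : Finset G) (x : G) :
    #{p ∈ S ×ˢ S | p.1 + p.2 = x} = #{a ∈ S | x - a ∈ S} := by
  refine card_nbij' (fun p => p.1) (fun a => (a, x - a)) ?_ ?_ ?_ ?_
  · rintro ⟨a, b⟩ h
    simp only [coe_filter, mem_product, Set.mem_ofPred_eq] at h ⊢
    refine ⟨h.1.1, ?_⟩
    rw [← h.2, add_sub_cancel_left]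
    exact h.1.2
  · intro a h
    simp only [coe_filter, mem_product, Set.mem_ofPred_eq] at h ⊢
    exact ⟨h, by abel⟩
  · rintro ⟨a, b⟩ h
    simp only [coe_filter, mem_product, Set.mem_ofPred_eq] at h ⊢
    rw [← h.2, add_sub_cancel_left]
  · intro a _; rfl

theorem sum_card_unpopular_le (S T : Finset G) {θ : ℝ} (hθ : 0 ≤ θ) :
    (∑ x ∈ T, (#{p ∈ {a ∈ S | x - a ∈ S} ×ˢ {a ∈ S | x - a ∈ S} |
      (diffRep S (p.1 - p.2) : ℝ) < θ} : ℝ)) ≤ (#S : ℝ) ^ 2 * θ := by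
  set D := {p ∈ S ×ˢ S | (diffRep S (p.1 - p.2) : ℝ) < θ}
  have h1 : ∀ x ∈ T, #{p ∈ {a ∈ S | x - a ∈ S} ×ˢ {a ∈ S | x - a ∈ S} |
      (diffRep S (p.1 - p.2) : ℝ) < θ} = #(D.bipartiteAbove
        (fun x p => x - p.1 ∈ S ∧ x - p.2 ∈ S) x) := by
    intro x _
    congr 1
    ext p
    simp only [D, bipartiteAbove, mem_filter, mem_product]
    tauto
  have h2 : ∀ p ∈ D, (#(T.bipartiteBelow (fun x p => x - p.1 ∈ S ∧ x - p.2 ∈ S) p) : ℝ) ≤ θ := by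
    intro p hp
    refine le_trans ?_ (mem_filter.1 hp).2.le
    rw [Nat.cast_le]
    refine card_le_card_of_injOn (fun x => (x - p.2, x - p.1)) ?_ ?_
    · intro x h
      simp only [bipartiteBelow, coe_filter, Set.mem_ofPred_eq, mem_product] at h ⊢
      exact ⟨h.2.symm, by abel⟩
    · intro x _ y _ h
      exact sub_left_injective (Prod.mk.inj h).1
  have h3 : (#D : ℝ) ≤ (#S : ℝ) ^ 2 := by
    exact_mod_cast (card_filter_le _ _).trans (by rw [card_product, sq])
  calc _ = ∑ x ∈ T, (#(D.bipartiteAbove (fun x p => x - p.1 ∈ S ∧ x - p.2 ∈ S) x) : ℝ) :=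
        sum_congr rfl fun x hx => by rw [h1 x hx]
    _ = ∑ p ∈ D, (#(T.bipartiteBelow (fun x p => x - p.1 ∈ S ∧ x - p.2 ∈ S) p) : ℝ) := by
        exact_mod_cast sum_card_bipartiteAbove_eq_sum_card_bipartiteBelow _
    _ ≤ ∑ p ∈ D, θ := sum_le_sum h2
    _ ≤ _ := by
        rw [sum_const, nsmul_eq_mul]
        gcongr

theorem exists_popular_sum {S : Finset G} {n K : ℝ} (hn : 0 < n) (hK : 0 < K) (hS : #S ≤ n)
    (hE : n ^ 3 / K ≤ collisions (S ×ˢ S) (S ×ˢ S) (fun x => x.1 + x.2) (fun x => x.1 + x.2)) :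
    ∃ x, n / (4 * K) ≤ #{a ∈ S | x - a ∈ S} ∧
      8 * (#{p ∈ {a ∈ S | x - a ∈ S} ×ˢ {a ∈ S | x - a ∈ S} |
      (diffRep S (p.1 - p.2) : ℝ) < n / (16 * K)} : ℝ) ≤ (#{a ∈ S | x - a ∈ S} : ℝ) ^ 2 := by
  by_contra! hcon
  have hmaps : ∀ p ∈ S ×ˢ S, p.1 + p.2 ∈ S + S := fun p hp =>
    add_mem_add (mem_product.1 hp).1 (mem_product.1 hp).2
  have hsum : (∑ x ∈ S + S, (#{a ∈ S | x - a ∈ S} : ℝ)) = (#S : ℝ) ^ 2 := by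
    have h := card_eq_sum_card_fiberwise (f := fun p : G × G => p.1 + p.2) (s := S ×ˢ S)
      (t := S + S) hmaps
    simp only [card_filter_add_eq, card_product] at h
    rw [sq]
    exact_mod_cast h.symm
  rw [collisions_eq_sum (T := S + S) _ _ hmaps] at hE
  simp only [card_filter_add_eq] at hE
  push_cast at hE
  have hbad := sum_card_unpopular_le S (S + S) (θ := n / (16 * K)) (by positivity)
  have hle : (∑ x ∈ S + S, (#{a ∈ S | x - a ∈ S} : ℝ) * #{a ∈ S | x - a ∈ S}) ≤
      ∑ x ∈ S + S, (n / (4 * K) * #{a ∈ S | x - a ∈ S} +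
        8 * (#{p ∈ {a ∈ S | x - a ∈ S} ×ˢ {a ∈ S | x - a ∈ S} |
      (diffRep S (p.1 - p.2) : ℝ) < n / (16 * K)} : ℝ)) := by
    refine sum_le_sum fun x _ => ?_
    rcases lt_or_ge (#{a ∈ S | x - a ∈ S} : ℝ) (n / (4 * K)) with h | h
    · have := mul_le_mul_of_nonneg_right h.le (Nat.cast_nonneg (α := ℝ) #{a ∈ S | x - a ∈ S})
      refine this.trans (le_add_of_nonneg_right (by positivity))
    · have := (hcon x h).le
      rw [sq] at this
      exact this.trans (le_add_of_nonneg_left (by positivity))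
  rw [sum_add_distrib, ← mul_sum, ← mul_sum, hsum] at hle
  have hS2 : (#S : ℝ) ^ 2 ≤ n ^ 2 := by gcongr
  have e1 : n / (4 * K) * (#S : ℝ) ^ 2 ≤ n / (4 * K) * n ^ 2 := by gcongr
  have e2 : (#S : ℝ) ^ 2 * (n / (16 * K)) ≤ n ^ 2 * (n / (16 * K)) := by gcongr
  have e3 : n / (4 * K) * n ^ 2 + 8 * (n ^ 2 * (n / (16 * K))) = 3 / 4 * (n ^ 3 / K) := by
    field_simp
    norm_num
  have e4 : 0 < n ^ 3 / K := by positivity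
  linarith

/-- A large fibre of `S` all of whose differences are mostly popular contains half of its
elements in a set of small doubling. -/
theorem exists_subset_of_popular_sum {S : Finset G} {θ : ℝ} (hθ : 0 ≤ θ) {x : G}
    (hpos : 0 < #{a ∈ S | x - a ∈ S})
    (hx : 8 * (#{p ∈ {a ∈ S | x - a ∈ S} ×ˢ {a ∈ S | x - a ∈ S} |
      (diffRep S (p.1 - p.2) : ℝ) < θ} : ℝ) ≤ (#{a ∈ S | x - a ∈ S} : ℝ) ^ 2) :
    ∃ X ⊆ {a ∈ S | x - a ∈ S}, (#{a ∈ S | x - a ∈ S} : ℝ) ≤ 2 * #X ∧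
      (#(X + X) : ℝ) * #{a ∈ S | x - a ∈ S} * θ ^ 2 ≤ 2 * (#S : ℝ) ^ 4 := by
  set F := {a ∈ S | x - a ∈ S}
  have hFsymm : ∀ a ∈ F, x - a ∈ F := by
    intro a ha
    simp only [F, mem_filter, sub_sub_cancel] at ha ⊢
    exact ha.symm
  set N : G → Finset G := fun a => {b ∈ F | (diffRep S (a - b) : ℝ) < θ}
  set X := {a ∈ F | 4 * #(N a) ≤ #F}
  have hFpos : (0 : ℝ) < #F := by exact_mod_cast hpos
  have hNsymm : ∀ a, #(N a) ≤ #(N (x - a)) := by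
    intro a
    refine card_le_card_of_injOn (fun b => x - b) ?_ (fun b _ c _ h => sub_right_injective h)
    intro b hb
    simp only [N, coe_filter, Set.mem_ofPred_eq] at hb ⊢
    refine ⟨hFsymm b hb.1, ?_⟩
    rw [sub_sub_sub_cancel_left, ← neg_sub, diffRep_neg]
    exact hb.2
  have hXsymm : ∀ a ∈ X, x - a ∈ X := by
    intro a ha
    simp only [X, mem_filter] at ha ⊢
    refine ⟨hFsymm a ha.1, le_trans ?_ ha.2⟩
    have := hNsymm (x - a)
    rw [sub_sub_cancel] at this
    omega
  refine ⟨X, filter_subset _ _, ?_, ?_⟩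
  · have hbad : #{p ∈ F ×ˢ F | (diffRep S (p.1 - p.2) : ℝ) < θ} = ∑ a ∈ F, #(N a) := by
      rw [card_filter, sum_product]
      exact sum_congr rfl fun a _ => (card_filter _ _).symm
    have h1 : (#{a ∈ F | ¬ 4 * #(N a) ≤ #F} : ℝ) * #F ≤ 4 * ∑ a ∈ F, (#(N a) : ℝ) := by
      rw [mul_sum, ← nsmul_eq_mul, ← sum_const]
      refine le_trans (sum_le_sum (g := fun a => 4 * (#(N a) : ℝ)) fun a ha => ?_)
        (sum_le_sum_of_subset_of_nonneg (filter_subset _ _) fun _ _ _ => by positivity)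
      exact_mod_cast (not_le.1 (mem_filter.1 ha).2).le
    have h2 : (#X : ℝ) + #{a ∈ F | ¬ 4 * #(N a) ≤ #F} = #F := by
      exact_mod_cast card_filter_add_card_filter_not (s := F) (fun a => 4 * #(N a) ≤ #F)
    rw [hbad] at hx
    push_cast at hx
    have h3 : (#{a ∈ F | ¬ 4 * #(N a) ≤ #F} : ℝ) * #F ≤ (#F / 2) * #F := by nlinarith
    have h4 := le_of_mul_le_mul_right h3 hFpos
    linarith
  · set Q : G → Finset ((G × G) × (G × G)) := fun u =>
      {z ∈ (S ×ˢ S) ×ˢ (S ×ˢ S) | (z.1.1 - z.1.2) - (z.2.1 - z.2.2) + x = u}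
    have hQ : ∀ u ∈ X + X, (#F : ℝ) / 2 * θ ^ 2 ≤ #(Q u) := by
      intro u hu
      obtain ⟨a, ha, a', ha', rfl⟩ := mem_add.1 hu
      obtain ⟨c, rfl⟩ : ∃ c, a' = x - c := ⟨x - a', by abel⟩
      have hc := hXsymm _ ha'
      rw [sub_sub_cancel] at hc
      set H := F \ (N a ∪ N c)
      have hH : (#F : ℝ) / 2 ≤ #H := by
        have h1 : #F - #(N a ∪ N c) ≤ #H := le_card_sdiff (N a ∪ N c) F
        have h2 := card_union_le (N a) (N c)
        have h3 := (mem_filter.1 ha).2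
        have h4 := (mem_filter.1 hc).2
        have h5 : #F ≤ 2 * #H := by omega
        have h6 : (#F : ℝ) ≤ 2 * #H := by exact_mod_cast h5
        linarith
      have hsub : (H.biUnion fun b => {p ∈ S ×ˢ S | p.1 - p.2 = a - b} ×ˢ
          {p ∈ S ×ˢ S | p.1 - p.2 = c - b}) ⊆ Q (a + (x - c)) := by
        rintro ⟨p, q⟩ h
        obtain ⟨b, _, h⟩ := mem_biUnion.1 h
        simp only [mem_product, mem_filter] at h
        simp only [Q, mem_filter, mem_product]
        refine ⟨⟨h.1.1, h.2.1⟩, ?_⟩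
        rw [h.1.2, h.2.2]
        abel
      have hcard := card_le_card hsub
      rw [card_biUnion] at hcard
      · calc (#F : ℝ) / 2 * θ ^ 2 ≤ #H * θ ^ 2 := by gcongr
          _ = ∑ b ∈ H, θ * θ := by rw [sum_const, nsmul_eq_mul, sq]
          _ ≤ ∑ b ∈ H, (diffRep S (a - b) : ℝ) * diffRep S (c - b) := by
              refine sum_le_sum fun b hb => ?_
              simp only [H, N, mem_sdiff, mem_union, mem_filter, not_or, not_and, not_lt] at hb
              exact mul_le_mul (hb.2.1 hb.1) (hb.2.2 hb.1) hθ (Nat.cast_nonneg _)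
          _ ≤ _ := by
              simp only [card_product] at hcard
              exact_mod_cast hcard
      · intro b _ b' _ hbb
        rw [Function.onFun, disjoint_left]
        rintro ⟨p, q⟩ h h'
        simp only [mem_product, mem_filter] at h h'
        exact hbb (sub_right_injective (h.1.2.symm.trans h'.1.2))
    have hsum : (∑ u ∈ X + X, #(Q u)) ≤ #S ^ 4 := by
      rw [← card_biUnion]
      · refine (card_le_card (biUnion_subset.2 fun u _ => filter_subset _ _)).trans ?_
        simp only [card_product]
        exact le_of_eq (by ring)
      · intro u _ v _ huv
        rw [Function.onFun, disjoint_left]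
        intro z h h'
        exact huv ((mem_filter.1 h).2.symm.trans (mem_filter.1 h').2)
    have h1 := sum_le_sum hQ
    rw [sum_const, nsmul_eq_mul] at h1
    have h2 : (∑ u ∈ X + X, (#(Q u) : ℝ)) ≤ (#S : ℝ) ^ 4 := by exact_mod_cast hsum
    nlinarith

/-- A form of the Balog–Szemerédi–Gowers theorem. -/
theorem exists_subset_card_add_mul_card_le {S : Finset G} {n K : ℝ} (hn : 0 < n) (hK : 0 < K)
    (hS : #S ≤ n)
    (hE : n ^ 3 / K ≤ collisions (S ×ˢ S) (S ×ˢ S) (fun x => x.1 + x.2) (fun x => x.1 + x.2)) :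
    ∃ X ⊆ S, n / (8 * K) ≤ #X ∧ (#(X + X) : ℝ) * #X ≤ 512 * K ^ 2 * n ^ 2 := by
  obtain ⟨x, hx1, hx2⟩ := exists_popular_sum hn hK hS hE
  have hpos : 0 < #{a ∈ S | x - a ∈ S} := by
    have : (0 : ℝ) < #{a ∈ S | x - a ∈ S} := lt_of_lt_of_le (by positivity) hx1
    exact_mod_cast this
  obtain ⟨X, hXF, hX1, hX2⟩ := exists_subset_of_popular_sum (by positivity) hpos hx2
  refine ⟨X, hXF.trans (filter_subset _ _), ?_, ?_⟩
  · have : n / (8 * K) = n / (4 * K) / 2 := by field_simp; norm_num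
    linarith
  · have h1 : (#X : ℝ) ≤ #{a ∈ S | x - a ∈ S} := by exact_mod_cast card_le_card hXF
    have h2 : (#(X + X) : ℝ) * #X * (n / (16 * K)) ^ 2 ≤ 2 * n ^ 4 :=
      calc _ ≤ (#(X + X) : ℝ) * #{a ∈ S | x - a ∈ S} * (n / (16 * K)) ^ 2 := by gcongr
        _ ≤ 2 * (#S : ℝ) ^ 4 := hX2
        _ ≤ 2 * n ^ 4 := by gcongr
    rw [div_pow, ← mul_div_assoc, div_le_iff₀ (by positivity)] at h2
    refine le_of_mul_le_mul_right (h2.trans_eq ?_) (pow_pos hn 2)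
    ring

end BalogSzemerediGowers

section Decomposition

open scoped Pointwise

theorem exists_cover_of_large_energy {n K M : ℝ} (hn : 0 < n) (hK : 0 < K) (A : Finset ℝ)
    (hA : #A ≤ n)
    (hM : ∀ X ⊆ A, n / (8 * K) ≤ #X → (#(X + X) : ℝ) * #X ≤ 512 * K ^ 2 * n ^ 2 →
      (collisions (X ×ˢ X) (X ×ˢ X) (fun x => x.1 / x.2) (fun x => x.1 / x.2) : ℝ) ≤ M) :
    ∃ (B : Finset ℝ) (F : Finset (Finset ℝ)), A ⊆ B ∪ F.biUnion id ∧
      (∀ X ∈ F, X ⊆ A ∧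
        (collisions (X ×ˢ X) (X ×ˢ X) (fun x => x.1 / x.2) (fun x => x.1 / x.2) : ℝ) ≤ M) ∧
      (collisions (B ×ˢ B) (B ×ˢ B) (fun x => x.1 + x.2) (fun x => x.1 + x.2) : ℝ) ≤ n ^ 3 / K ∧
      (#F : ℝ) * (n / (8 * K)) ≤ #A := by
  induction A using Finset.strongInduction with
  | H A ih =>
    rcases le_total (n ^ 3 / K)
      (collisions (A ×ˢ A) (A ×ˢ A) (fun x => x.1 + x.2) (fun x => x.1 + x.2) : ℝ) with h | h
    · obtain ⟨X, hXA, hX, hXX⟩ := exists_subset_card_add_mul_card_le hn hK hA h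
      have hXpos : (0 : ℝ) < #X := lt_of_lt_of_le (by positivity) hX
      have hXne : X.Nonempty := card_pos.1 (by exact_mod_cast hXpos)
      have hcard : (#(A \ X) : ℝ) + #X = #A := by
        exact_mod_cast card_sdiff_add_card_eq_card hXA
      obtain ⟨B, F, hcov, hF, hB, hFc⟩ := ih (A \ X) (sdiff_ssubset hXA hXne) (by linarith)
        (fun Y hY => hM Y (hY.trans sdiff_subset))
      refine ⟨B, insert X F, ?_, ?_, hB, ?_⟩
      · intro a ha
        by_cases haX : a ∈ X
        · exact mem_union_right _ (mem_biUnion.2 ⟨X, mem_insert_self _ _, haX⟩)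
        · rw [biUnion_insert]
          rcases mem_union.1 (hcov (mem_sdiff.2 ⟨ha, haX⟩)) with h | h
          · exact mem_union_left _ h
          · exact mem_union_right _ (mem_union_right _ h)
      · intro Y hY
        rcases mem_insert.1 hY with rfl | hY
        · exact ⟨hXA, hM _ hXA hX hXX⟩
        · exact ⟨(hF Y hY).1.trans sdiff_subset, (hF Y hY).2⟩
      · have h1 : (#(insert X F) : ℝ) ≤ #F + 1 := by exact_mod_cast card_insert_le X F
        have h2 : (0 : ℝ) ≤ n / (8 * K) := by positivity
        nlinarith [mul_le_mul_of_nonneg_right h1 h2]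
    · exact ⟨A, ∅, by simp, by simp, h, by simp⟩

theorem collisions_div_le_of_small_doubling {n K : ℝ} (hn : 0 < n) (hK : 0 < K) {X : Finset ℝ}
    (hunit : ∀ x ∈ X, IsUnit x) (hXn : #X ≤ n) (hX : n / (8 * K) ≤ #X)
    (hXX : (#(X + X) : ℝ) * #X ≤ 512 * K ^ 2 * n ^ 2) :
    (collisions (X ×ˢ X) (X ×ˢ X) (fun x => x.1 / x.2) (fun x => x.1 / x.2) : ℝ)
      ≤ 2 ^ 28 * K ^ 6 * n ^ 2 * (1 + Real.log n) := by
  have hXpos : (0 : ℝ) < #X := lt_of_lt_of_le (by positivity) hX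
  have h1 : (#(X + X) : ℝ) ≤ 4096 * K ^ 3 * n := by
    have h := (mul_le_mul_of_nonneg_left hX (Nat.cast_nonneg (α := ℝ) #(X + X))).trans hXX
    rw [← mul_div_assoc, div_le_iff₀ (by positivity)] at h
    refine le_of_mul_le_mul_right (h.trans_eq ?_) hn
    ring
  have hX1 : (1 : ℝ) ≤ #X := by
    have : 0 < #X := by exact_mod_cast hXpos
    exact_mod_cast this
  have hlog : 0 ≤ Real.log #X := Real.log_nonneg hX1
  calc _ ≤ 16 * (#(X + X) : ℝ) ^ 2 * (1 + Real.log #X) := collisions_div_le_card_add_sq hunit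
    _ ≤ 16 * (4096 * K ^ 3 * n) ^ 2 * (1 + Real.log n) := by gcongr
    _ = _ := by ring

theorem exists_low_energy_decomposition (A : Finset ℝ) (hA : 1 ≤ #A) :
    ∃ B C : Finset ℝ, Disjoint B C ∧ B ∪ C = A ∧ 0 ∉ C ∧
      (collisions (B ×ˢ B) (B ×ˢ B) (fun x => x.1 + x.2) (fun x => x.1 + x.2) : ℝ)
        ≤ 2 ^ 42 * (#A : ℝ) ^ (97 / 33 : ℝ) ∧
      (collisions (C ×ˢ C) (C ×ˢ C) (fun x => x.1 * x.2) (fun x => x.1 * x.2) : ℝ)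
        ≤ 2 ^ 42 * (#A : ℝ) ^ (97 / 33 : ℝ) := by
  set n : ℝ := (#A : ℝ)
  have hn1 : 1 ≤ n := Nat.one_le_cast.2 hA
  have hn : 0 < n := by linarith
  set K : ℝ := n ^ (2 / 33 : ℝ)
  have hK : 0 < K := Real.rpow_pos_of_pos hn _
  have herase : (#(A.erase 0) : ℝ) ≤ n := Nat.cast_le.2 card_erase_le
  have hunit : ∀ X ⊆ A.erase 0, ∀ x ∈ X, IsUnit x := fun X hX x hx =>
    isUnit_iff_ne_zero.2 (ne_of_mem_erase (hX hx))
  obtain ⟨B, F, hcov, hF, hB, hFc⟩ := exists_cover_of_large_energy hn hK (A.erase 0) herase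
    (M := 2 ^ 28 * K ^ 6 * n ^ 2 * (1 + Real.log n)) fun X hX hXc hXX =>
      collisions_div_le_of_small_doubling hn hK (hunit X hX)
        (le_trans (by exact_mod_cast card_le_card hX) herase) hXc hXX
  have hKn : n ^ 3 / K = n ^ (97 / 33 : ℝ) := by
    rw [← Real.rpow_natCast, ← Real.rpow_sub hn]
    norm_num
  have hone : 1 ≤ n ^ (97 / 33 : ℝ) := Real.one_le_rpow hn1 (by norm_num)
  refine ⟨A ∩ insert 0 B, A \ insert 0 B, (disjoint_sdiff_inter A (insert 0 B)).symm,
    by rw [union_comm, sdiff_union_inter], by simp, ?_, ?_⟩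
  · have h := collisions_add_le_of_cover (S := A ∩ insert 0 B) (F := {{0}, B})
      (M := n ^ (97 / 33 : ℝ)) ?_ (fun _ _ x _ => AddGroup.isAddUnit x) ?_
    · refine h.trans ?_
      gcongr
      have h2 : (#({{0}, B} : Finset (Finset ℝ)) : ℝ) ≤ 2 := by exact_mod_cast card_le_two
      calc _ ≤ (2 : ℝ) ^ 4 := by gcongr
        _ ≤ _ := by norm_num
    · refine inter_subset_right.trans ?_
      intro x hx
      simpa using hx
    · intro X hX
      simp only [mem_insert, mem_singleton] at hX
      rcases hX with rfl | rfl
      · refine le_trans ?_ hone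
        have : collisions (({0} : Finset ℝ) ×ˢ {0}) (({0} : Finset ℝ) ×ˢ {0})
            (fun x => x.1 - x.2) (fun x => x.1 - x.2) ≤ 1 :=
          (card_filter_le _ _).trans (by simp)
        exact_mod_cast this
      · rw [← collisions_add_eq_sub, ← hKn]
        exact hB
  · have hFK : (#F : ℝ) ≤ 8 * K := by
      have h := hFc.trans herase
      rw [← mul_div_assoc, div_le_iff₀ (by positivity)] at h
      refine le_of_mul_le_mul_right (h.trans_eq ?_) hn
      ring
    have hlog : 1 + Real.log n ≤ 4 * n ^ (1 / 3 : ℝ) := by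
      have h1 := Real.log_le_rpow_div hn.le (ε := 1 / 3) (by norm_num)
      have h2 : 1 ≤ n ^ (1 / 3 : ℝ) := Real.one_le_rpow hn1 (by norm_num)
      linarith
    have hlog0 : 0 ≤ Real.log n := Real.log_nonneg hn1
    refine (collisions_mul_le_of_cover (F := F)
      (M := 2 ^ 28 * K ^ 6 * n ^ 2 * (1 + Real.log n)) ?_
      (fun X hX => hunit X (hF X hX).1) (fun X hX => (hF X hX).2)).trans ?_
    · intro x hx
      simp only [mem_sdiff, mem_insert, not_or] at hx
      exact (mem_union.1 (hcov (mem_erase.2 ⟨hx.2.1, hx.1⟩))).resolve_left hx.2.2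
    · calc _ ≤ (8 * K) ^ 4 * (2 ^ 28 * K ^ 6 * n ^ 2 * (4 * n ^ (1 / 3 : ℝ))) := by gcongr
        _ = 2 ^ 42 * (K ^ 10 * n ^ 2 * n ^ (1 / 3 : ℝ)) := by ring
        _ = _ := by
          rw [← Real.rpow_natCast K, ← Real.rpow_mul hn.le, ← Real.rpow_natCast n,
            ← Real.rpow_add hn, ← Real.rpow_add hn]
          norm_num

end Decomposition

theorem kfold_bound {E c n : ℝ} {s k e : ℕ} (hn : 2 ≤ n) (hs : s ≤ n) (hc : 0 ≤ c)
    (hk : 2 ≤ k) (he : e ≤ c * n ^ (97 / 33 : ℝ)) (hE : E ≤ (s : ℝ) ^ (2 * (k - 2)) * e) :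
    E ≤ c / Real.log 2 ^ ((1 : ℝ) - 2 / 33) * n ^ (2 * (k : ℝ) - 1 - 2 / 33) *
      Real.log n ^ ((1 : ℝ) - 2 / 33) := by
  have hn0 : 0 < n := by linarith
  have hlog2 : 0 < Real.log 2 := Real.log_pos (by norm_num)
  have hl : 0 < Real.log 2 ^ ((1 : ℝ) - 2 / 33) := Real.rpow_pos_of_pos hlog2 _
  have hll : Real.log 2 ^ ((1 : ℝ) - 2 / 33) ≤ Real.log n ^ ((1 : ℝ) - 2 / 33) := by
    gcongr
  obtain ⟨j, rfl⟩ : ∃ j, k = j + 2 := ⟨k - 2, by omega⟩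
  calc E ≤ n ^ (2 * j) * (c * n ^ (97 / 33 : ℝ)) := by
        refine hE.trans ?_
        rw [Nat.add_sub_cancel]
        gcongr
    _ = c * n ^ (2 * ((j + 2 : ℕ) : ℝ) - 1 - 2 / 33) := by
        rw [mul_left_comm, ← Real.rpow_natCast, ← Real.rpow_add hn0]
        congr 2
        push_cast
        ring
    _ = c / Real.log 2 ^ ((1 : ℝ) - 2 / 33) * n ^ (2 * ((j + 2 : ℕ) : ℝ) - 1 - 2 / 33) *
        Real.log 2 ^ ((1 : ℝ) - 2 / 33) := by
        field_simp
    _ ≤ _ := by gcongr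

/-- Theorem 1.4: low-energy decompositions for `k`-fold energies, with `δ = 2/33`.
`E₊⁽ᵐ⁾(B) = addEnergyK (fun _ : Fin m => B)` and similarly for `E×⁽ⁿ⁾(C)`. -/
theorem low_energy_decomposition_kfold (m n : ℕ) (hm : 2 ≤ m) (hn : 2 ≤ n) :
    ∃ K : ℝ, 0 < K ∧ ∀ A : Finset ℝ, 2 ≤ A.card →
      ∃ B C : Finset ℝ, Disjoint B C ∧ B ∪ C = A ∧
        (addEnergyK (fun _ : Fin m => B) : ℝ) ≤
          K * (A.card : ℝ) ^ (2 * (m : ℝ) - 1 - 2 / 33) *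
            Real.log A.card ^ ((1 : ℝ) - 2 / 33) ∧
        (mulEnergyK (fun _ : Fin n => C) : ℝ) ≤
          K * (A.card : ℝ) ^ (2 * (n : ℝ) - 1 - 2 / 33) *
            Real.log A.card ^ ((1 : ℝ) - 2 / 33) := by
  have hlog2 : 0 < Real.log 2 := Real.log_pos (by norm_num)
  refine ⟨2 ^ 42 / Real.log 2 ^ ((1 : ℝ) - 2 / 33), by positivity, fun A hA => ?_⟩
  obtain ⟨B, C, hd, hu, h0, hB, hC⟩ := exists_low_energy_decomposition A (by omega)
  have hA2 : (2 : ℝ) ≤ #A := by exact_mod_cast hA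
  have hBA : (#B : ℝ) ≤ #A := by exact_mod_cast card_le_card (hu ▸ subset_union_left)
  have hCA : (#C : ℝ) ≤ #A := by exact_mod_cast card_le_card (hu ▸ subset_union_right)
  have hm' := collisions_sum_le B (fun x _ => AddGroup.isAddUnit x) (m - 2)
  have hn' := collisions_prod_le C
    (fun x hx => isUnit_iff_ne_zero.2 (ne_of_mem_of_not_mem hx h0)) (n - 2)
  rw [Nat.sub_add_cancel hm] at hm'
  rw [Nat.sub_add_cancel hn] at hn'
  exact ⟨B, C, hd, hu, kfold_bound hA2 hBA (by norm_num) hm hB (by exact_mod_cast hm'),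
    kfold_bound hA2 hCA (by norm_num) hn hC (by exact_mod_cast hn')⟩
end
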